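/- For every odd positive integer m there exist a real number μ ∈ (m, m+1), a real number σ ∈ (0, 1), and a μ-homogeneous solution u of the thin obstacle problem in ℝ³ which is not identically zero and whose contact set is exactly Z(u) = {(r·cos θ, r·sin θ, 0) : r ≥ 0, θ ∈ ℝ, and |θ − 2πk/m| ≤ σπ/m for some integer k}. -/

import Mathlib

open Real Set Filter

/-- Partial derivative of `f : ℝⁿ → ℝ` in the `i`-th coordinate direction. -/
noncomputable def pd {n : ℕ} (i : Fin n) (f : (Fin n → ℝ) → ℝ) (x : Fin n → ℝ) : ℝ :=
  fderiv ℝ f x (Pi.single i 1)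

/-- The Laplacian of `f : ℝⁿ → ℝ`. -/
noncomputable def lap {n : ℕ} (f : (Fin n → ℝ) → ℝ) (x : Fin n → ℝ) : ℝ :=
  ∑ i, pd i (pd i f) x

/-- The contact set `Z(u) = {xᵢ = 0} ∩ {u = 0}`, `i` being the distinguished coordinate. -/
def contactSet {n : ℕ} (u : (Fin n → ℝ) → ℝ) (i : Fin n) : Set (Fin n → ℝ) :=
  {x | x i = 0 ∧ u x = 0}

/-- `d` is the one-sided derivative `∂ᵢ⁺u(x) = lim_{t→0⁺} (u(x+t eᵢ) - u(x))/t`. -/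
def HasUpperDeriv {n : ℕ} (u : (Fin n → ℝ) → ℝ) (i : Fin n) (x : Fin n → ℝ) (d : ℝ) : Prop :=
  Filter.Tendsto (fun t : ℝ => (u (x + t • (Pi.single i 1 : Fin n → ℝ)) - u x) / t)
    (nhdsWithin 0 (Set.Ioi 0)) (nhds d)

/-- `u` is a `μ`-homogeneous solution of the thin obstacle problem in `ℝⁿ`,
with thin space `{xᵢ = 0}`. -/
structure IsTOPSol {n : ℕ} (μ : ℝ) (u : (Fin n → ℝ) → ℝ) (i : Fin n) : Prop where
  cont : Continuous u
  symm : ∀ x, u (Function.update x i (-(x i))) = u x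
  homog : ∀ r : ℝ, 0 < r → ∀ x, u (r • x) = r ^ μ * u x
  smooth : ContDiffOn ℝ 2 u (contactSet u i)ᶜ
  harm : ∀ x ∈ (contactSet u i)ᶜ, lap u x = 0
  nonneg : ∀ x, x i = 0 → 0 ≤ u x
  upper : ∀ x, x i = 0 → ∃ d, d ≤ 0 ∧ HasUpperDeriv u i x d


/-- The closed cone in the thin space consisting of `2m` evenly spaced slits of
angular half-width `σπ/m`. -/
def slitCone (m : ℕ) (σ : ℝ) : Set (Fin 3 → ℝ) :=
  {x | ∃ r : ℝ, 0 ≤ r ∧ ∃ θ : ℝ, (∃ k : ℤ, |θ - 2 * π * k / m| ≤ σ * π / m) ∧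
      x = ![r * Real.cos θ, r * Real.sin θ, 0]}


namespace TO

/-- Gamma quotient. -/
noncomputable def uu (x : ℝ) : ℝ := Gamma (x + 1/2) / Gamma x

/-- The multiplier sequence. -/
noncomputable def cc (μ : ℝ) (k : ℕ) : ℝ := 2 * uu ((k + μ + 1) / 2) * uu ((k - μ) / 2)

lemma uu_mul {x : ℝ} (hx : ∀ n : ℕ, 2 * x ≠ -n) : uu x * uu (x + 1/2) = x := by
  have h1 : Gamma (x + 1/2) ≠ 0 := Gamma_ne_zero fun n h => hx (2*n+1) (by push_cast; linarith)
  have h2 : Gamma x ≠ 0 := Gamma_ne_zero fun n h => hx (2*n) (by push_cast; linarith)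
  have h0 : x ≠ 0 := fun h => hx 0 (by simp [h])
  have h3 : Gamma (x + 1/2 + 1/2) = x * Gamma x := by
    rw [← Gamma_add_one h0]; congr 1; ring
  unfold uu
  rw [h3, div_mul_div_comm, mul_comm, mul_div_mul_right _ _ h1, mul_div_assoc, div_self h2, mul_one]

section
variable {m : ℕ} {μ : ℝ} (h1 : (m:ℝ) < μ) (h2 : μ < m + 1)
include h1 h2

lemma mu_ne (n : ℕ) : μ ≠ n := by
  intro h
  rw [h] at h1 h2
  have a : m < n := by exact_mod_cast h1
  have b : n < m + 1 := by exact_mod_cast h2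
  omega

lemma cc_mul (k : ℕ) : cc μ k * cc μ (k+1) = (k + μ + 1) * (k - μ) := by
  have hm : (0:ℝ) ≤ m := Nat.cast_nonneg m
  have hk : (0:ℝ) ≤ k := Nat.cast_nonneg k
  have a := @uu_mul ((k + μ + 1)/2) (fun n h => by
    have : (0:ℝ) ≤ n := Nat.cast_nonneg n
    linarith)
  have b := @uu_mul ((k - μ)/2) (fun n h => mu_ne h1 h2 (k + n) (by push_cast; linarith))
  unfold cc
  have e1 : (((k+1:ℕ):ℝ) + μ + 1)/2 = (k + μ + 1)/2 + 1/2 := by push_cast; ring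
  have e2 : (((k+1:ℕ):ℝ) - μ)/2 = (k - μ)/2 + 1/2 := by push_cast; ring
  rw [e1, e2]
  calc _ = 4 * (uu ((k + μ + 1)/2) * uu ((k + μ + 1)/2 + 1/2)) * (uu ((k - μ)/2) * uu ((k - μ)/2 + 1/2)) := by ring
    _ = _ := by rw [a, b]; ring

lemma cc_ne (k : ℕ) : cc μ k ≠ 0 := by
  have hm : (0:ℝ) ≤ m := Nat.cast_nonneg m
  have hk : (0:ℝ) ≤ k := Nat.cast_nonneg k
  have := cc_mul h1 h2 k
  intro h
  rw [h, zero_mul] at this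
  have h3 : (k:ℝ) - μ ≠ 0 := fun h => mu_ne h1 h2 k (by linarith)
  have h4 : (k:ℝ) + μ + 1 ≠ 0 := by have := h1; intro h; linarith
  exact mul_ne_zero h4 h3 this.symm
end
end TO
namespace TO
lemma uu_pos {x : ℝ} (hx : 0 < x) : 0 < uu x := by
  unfold uu
  exact div_pos (Gamma_pos_of_pos (by linarith)) (Gamma_pos_of_pos hx)

lemma uu_sq_le {x : ℝ} (hx : 0 < x) : uu x ^ 2 ≤ x := by
  have h := Real.Gamma_mul_add_mul_le_rpow_Gamma_mul_rpow_Gamma (s := x) (t := x + 1) (a := 1/2) (b := 1/2) hx (by linarith) (by norm_num) (by norm_num) (by norm_num)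
  have e : (1/2 * x + 1/2 * (x+1):ℝ) = x + 1/2 := by ring
  have hG : 0 < Gamma x := Gamma_pos_of_pos hx
  rw [e, Gamma_add_one hx.ne', ← Real.sqrt_eq_rpow, ← Real.sqrt_eq_rpow] at h
  have hG2 : 0 < Gamma (x + 1/2) := Gamma_pos_of_pos (by linarith)
  have h' : Gamma (x+1/2) ^ 2 ≤ Gamma x * (x * Gamma x) := by
    calc _ ≤ (√(Gamma x) * √(x * Gamma x))^2 := by gcongr
      _ = _ := by rw [mul_pow, Real.sq_sqrt hG.le, Real.sq_sqrt (by positivity)]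
  unfold uu
  rw [div_pow, div_le_iff₀ (by positivity)]
  linarith [h']

lemma cc_contOn (m : ℕ) (k : ℕ) : ContinuousOn (fun μ => cc μ k) (Ioo (m:ℝ) (m+1)) := by
  intro μ hμ
  apply ContinuousAt.continuousWithinAt
  have hm : (0:ℝ) ≤ m := Nat.cast_nonneg m
  have hk : (0:ℝ) ≤ k := Nat.cast_nonneg k
  have key : ∀ x : ℝ, (∀ n : ℕ, 2 * x ≠ -n) → ContinuousAt uu x := by
    intro x hx
    have g1 : ∀ n : ℕ, x + 1/2 ≠ -n := fun n h => hx (2*n+1) (by push_cast; linarith)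
    have g2 : ∀ n : ℕ, x ≠ -n := fun n h => hx (2*n) (by push_cast; linarith)
    unfold uu
    refine ContinuousAt.div ?_ (Real.differentiableAt_Gamma g2).continuousAt (Gamma_ne_zero g2)
    exact ContinuousAt.comp (f := fun x : ℝ => x + 1/2) (Real.differentiableAt_Gamma g1).continuousAt (by fun_prop)
  unfold cc
  refine ContinuousAt.mul (ContinuousAt.mul continuousAt_const ?_) ?_
  · refine ContinuousAt.comp (g := uu) (f := fun μ : ℝ => (k + μ + 1)/2) (key _ ?_) (by fun_prop)
    intro n h
    have : (0:ℝ) ≤ n := Nat.cast_nonneg n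
    linarith [hμ.1]
  · refine ContinuousAt.comp (g := uu) (f := fun μ : ℝ => (k - μ)/2) (key _ ?_) (by fun_prop)
    exact (fun n h => mu_ne hμ.1 hμ.2 (k + n) (by push_cast; linarith))

section
variable {m : ℕ} {μ : ℝ} (h1 : (m:ℝ) < μ) (h2 : μ < m + 1)
include h1 h2

omit h1 in
lemma mu_lt {k : ℕ} (hk : m + 1 ≤ k) : μ < k := by
  have : ((m+1:ℕ):ℝ) ≤ k := by exact_mod_cast hk
  push_cast at this; linarith

lemma cc_pos {k : ℕ} (hk : m + 1 ≤ k) : 0 < cc μ k := by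
  have hm : (0:ℝ) ≤ m := Nat.cast_nonneg m
  have := mu_lt h2 hk
  unfold cc
  have a := @uu_pos ((k + μ + 1)/2) (by linarith)
  have b := @uu_pos ((k - μ)/2) (by linarith)
  positivity

lemma cc_sq_le {k : ℕ} (hk : m + 1 ≤ k) : cc μ k ^ 2 ≤ (k + μ + 1) * (k - μ) := by
  have hm : (0:ℝ) ≤ m := Nat.cast_nonneg m
  have := mu_lt h2 hk
  have a := @uu_sq_le ((k + μ + 1)/2) (by linarith)
  have b := @uu_sq_le ((k - μ)/2) (by linarith)
  unfold cc
  calc _ = 4 * (uu ((k + μ + 1)/2)^2 * uu ((k - μ)/2)^2) := by ring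
    _ ≤ 4 * (((k + μ + 1)/2) * ((k - μ)/2)) := by
        gcongr
        linarith
    _ = _ := by ring

lemma cc_m_neg : cc μ m < 0 := by
  have hm : (0:ℝ) ≤ m := Nat.cast_nonneg m
  have a := cc_mul h1 h2 m
  have b := cc_pos h1 h2 (le_refl (m+1))
  by_contra h
  push Not at h
  have : 0 ≤ cc μ m * cc μ (m+1) := by positivity
  nlinarith

lemma cc_sign (j : ℕ) (hj : j ≤ m) : (Even j → cc μ (m - j) < 0) ∧ (Odd j → 0 < cc μ (m - j)) := by
  have hm : (0:ℝ) ≤ m := Nat.cast_nonneg m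
  induction j with
  | zero => simp [cc_m_neg h1 h2]
  | succ j ih =>
    have ih := ih (by omega)
    have e : m - (j+1) + 1 = m - j := by omega
    have a := cc_mul h1 h2 (m - (j+1))
    rw [e] at a
    have hk : ((m - (j+1) : ℕ) : ℝ) ≤ m := by exact_mod_cast Nat.sub_le _ _
    have hk0 : (0:ℝ) ≤ ((m - (j+1) : ℕ) : ℝ) := Nat.cast_nonneg _
    have hneg : cc μ (m - (j+1)) * cc μ (m-j) < 0 := by rw [a]; nlinarith
    constructor
    · intro he
      have := ih.2 (by rwa [Nat.even_add_one, Nat.not_even_iff_odd] at he)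
      by_contra h; push Not at h
      nlinarith [mul_nonneg h this.le]
    · intro he
      have := ih.1 (by rwa [Nat.odd_add_one, Nat.not_odd_iff_even] at he)
      by_contra h; push Not at h
      nlinarith [mul_nonneg_of_nonpos_of_nonpos h this.le]

lemma cc_zero_pos (hodd : Odd m) : 0 < cc μ 0 := by
  simpa using (cc_sign h1 h2 m le_rfl).2 hodd

end
end TO

namespace TO
/-- Completely monotone sequences: closed cone generated by geometric sequences. -/
inductive CM : (ℕ → ℝ) → Prop
  | geom (c r : ℝ) (hc : 0 ≤ c) (hr : 0 ≤ r) (hr1 : r ≤ 1) : CM (fun i => c * r ^ i)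
  | add (a b : ℕ → ℝ) (ha : CM a) (hb : CM b) : CM (fun i => a i + b i)
  | lim (F : ℕ → ℕ → ℝ) (g : ℕ → ℝ) (hF : ∀ n, CM (F n))
      (h : ∀ i, Tendsto (fun n => F n i) atTop (nhds (g i))) : CM g

lemma CM.const {c : ℝ} (hc : 0 ≤ c) : CM (fun _ => c) := by
  simpa using CM.geom c 1 hc zero_le_one le_rfl

lemma CM.geom_mul {c r : ℝ} (hc : 0 ≤ c) (hr : 0 ≤ r) (hr1 : r ≤ 1) {b : ℕ → ℝ} (hb : CM b) :
    CM (fun i => c * r ^ i * b i) := by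
  induction hb with
  | geom c' r' hc' hr' hr1' =>
    have := CM.geom (c * c') (r * r') (by positivity) (by positivity) (mul_le_one₀ hr1 hr' hr1')
    convert this using 2 with i
    rw [mul_pow]; ring
  | add a b _ _ iha ihb =>
    convert CM.add _ _ iha ihb using 2 with i
    ring
  | lim F g _ h ih =>
    exact CM.lim _ _ ih (fun i => (h i).const_mul _)

lemma CM.mul {a b : ℕ → ℝ} (ha : CM a) (hb : CM b) : CM (fun i => a i * b i) := by
  induction ha with
  | geom c r hc hr hr1 => exact CM.geom_mul hc hr hr1 hb
  | add a a' _ _ iha ihb =>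
    convert CM.add _ _ iha ihb using 2 with i
    ring
  | lim F g _ h ih =>
    exact CM.lim _ _ ih (fun i => (h i).mul_const _)

lemma CM.shift {a : ℕ → ℝ} (ha : CM a) (s t : ℕ) : CM (fun i => a (s + t * i)) := by
  induction ha with
  | geom c r hc hr hr1 =>
    have := CM.geom (c * r^s) (r^t) (by positivity) (by positivity) (pow_le_one₀ hr hr1)
    convert this using 2 with i
    show c * r ^ (s + t * i) = _
    rw [pow_add, pow_mul]; ring
  | add a a' _ _ iha ihb => exact CM.add _ _ iha ihb
  | lim F g _ h ih => exact CM.lim _ _ ih (fun i => h _)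

lemma CM.nonneg {a : ℕ → ℝ} (ha : CM a) : ∀ i, 0 ≤ a i := by
  induction ha with
  | geom c r hc hr hr1 => intro i; positivity
  | add a a' _ _ iha ihb => intro i; exact add_nonneg (iha i) (ihb i)
  | lim F g _ h ih => intro i; exact ge_of_tendsto' (h i) (fun n => ih n i)

lemma CM.le_zero {a : ℕ → ℝ} (ha : CM a) : ∀ i, a i ≤ a 0 := by
  induction ha with
  | geom c r hc hr hr1 =>
    intro i
    have := pow_le_one₀ hr hr1 (n := i)
    simp only [pow_zero]; gcongr
  | add a a' _ _ iha ihb => intro i; exact add_le_add (iha i) (ihb i)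
  | lim F g _ h ih => intro i; exact le_of_tendsto_of_tendsto' (h i) (h 0) (fun n => ih n i)

lemma CM.sum {F : ℕ → ℕ → ℝ} (hF : ∀ n, CM (F n)) (N : ℕ) :
    CM (fun i => ∑ n ∈ Finset.range N, F n i) := by
  induction N with
  | zero => simpa using CM.const le_rfl
  | succ N ih =>
    simp only [Finset.sum_range_succ]
    exact CM.add _ _ ih (hF N)

lemma CM.hasSum {F : ℕ → ℕ → ℝ} {g : ℕ → ℝ} (hF : ∀ n, CM (F n)) (h : ∀ i, HasSum (fun n => F n i) (g i)) :
    CM g :=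
  CM.lim _ _ (CM.sum hF) (fun i => (h i).tendsto_sum_nat)

lemma tendsto_one_sub_exp (a : ℝ) :
    Tendsto (fun p : ℕ => (1 - exp (-(a * (1 / ((p:ℝ)+1))))) / (1 / ((p:ℝ)+1))) atTop (nhds a) := by
  have h1 : HasDerivAt (fun s : ℝ => 1 - exp (-(a * s))) a 0 := by
    have := ((((hasDerivAt_id (0:ℝ)).const_mul a).neg).exp).const_sub 1
    simpa using this
  have h2 := h1.tendsto_slope_zero_right
  have h3 : Tendsto (fun p : ℕ => 1 / ((p:ℝ)+1)) atTop (nhdsWithin 0 (Ioi 0)) := by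
    apply tendsto_nhdsWithin_of_tendsto_nhds_of_eventually_within
    · exact tendsto_one_div_add_atTop_nhds_zero_nat
    · exact Eventually.of_forall fun p => by simp only [mem_Ioi]; positivity
  refine (h2.comp h3).congr fun p => ?_
  simp only [Function.comp, smul_eq_mul, zero_add, mul_zero, neg_zero, exp_zero, sub_self, sub_zero]
  exact (div_eq_inv_mul _ _).symm

lemma CM.inv {y : ℝ} (hy : 0 < y) : CM (fun i => 1 / ((i:ℝ) + y)) := by
  -- the approximants
  have key : ∀ p : ℕ, CM (fun i => (1 - exp (-(1 * (1 / ((p:ℝ)+1))))) / (1 - exp (-(((i:ℝ)+y) * (1 / ((p:ℝ)+1)))))) := by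
    intro p
    set s : ℝ := 1 / ((p:ℝ)+1) with hs
    have hs0 : 0 < s := by positivity
    have hq : exp (-(1*s)) < 1 := by rw [Real.exp_lt_one_iff]; linarith
    refine CM.hasSum (F := fun n i => ((1 - exp (-(1*s))) * exp (-(n * y * s))) * (exp (-(n * s)))^i) ?_ ?_
    · intro n
      refine CM.geom _ _ (mul_nonneg (by linarith) (exp_pos _).le) (exp_pos _).le ?_
      rw [Real.exp_le_one_iff]
      have : (0:ℝ) ≤ n * s := by positivity
      linarith
    · intro i
      have hlt : exp (-(((i:ℝ)+y) * s)) < 1 := by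
        rw [Real.exp_lt_one_iff]
        have : 0 < ((i:ℝ)+y) * s := by positivity
        linarith
      have := (hasSum_geometric_of_lt_one (exp_pos _).le hlt).mul_left (1 - exp (-(1*s)))
      rw [div_eq_mul_inv]
      have hfun : (fun n : ℕ => ((1 - exp (-(1*s))) * exp (-(n * y * s))) * (exp (-(n * s)))^i) =
          fun n : ℕ => (1 - rexp (-(1 * s))) * rexp (-((↑i + y) * s)) ^ n := by
        funext n
        rw [← Real.exp_nat_mul, ← Real.exp_nat_mul, mul_assoc, ← Real.exp_add]
        congr 2
        ring
      show HasSum (fun n : ℕ => ((1 - exp (-(1*s))) * exp (-(n * y * s))) * (exp (-(n * s)))^i) _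
      rw [hfun]
      exact this
  refine CM.lim _ _ key fun i => ?_
  have hne : (i:ℝ) + y ≠ 0 := by positivity
  refine ((tendsto_one_sub_exp 1).div (tendsto_one_sub_exp ((i:ℝ)+y)) hne).congr fun p => ?_
  simp only [Pi.div_apply]
  rw [div_div_div_cancel_right₀]
  positivity

section
variable {m : ℕ} {μ : ℝ} (h1 : (m:ℝ) < μ) (h2 : μ < m + 1)
include h1 h2

/-- `R_k - 1` as a sequence. -/
lemma CM_R : CM (fun i => 2 * (μ^2+μ) / ((((m+1+i:ℕ):ℝ)+2)*(((m+1+i:ℕ):ℝ)+μ+1)*(((m+1+i:ℕ):ℝ)-μ))) := by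
  have hm : (0:ℝ) ≤ m := Nat.cast_nonneg m
  have a := (((CM.const (c := 2*(μ^2+μ)) (by nlinarith)).mul (CM.inv (y := m+3) (by linarith))).mul
    (CM.inv (y := m+2+μ) (by linarith))).mul (CM.inv (y := m+1-μ) (by linarith))
  convert a using 2 with i
  have : (0:ℝ) ≤ i := Nat.cast_nonneg i
  push_cast
  rw [mul_one_div, mul_one_div, mul_one_div, div_div, div_div]
  congr 1
  ring

lemma x_rec {k : ℕ} (hk : m + 1 ≤ k) : (k:ℝ) / cc μ k =
    ((k+2:ℕ):ℝ) / cc μ (k+2) * (1 + 2 * (μ^2+μ) / (((k:ℝ)+2)*((k:ℝ)+μ+1)*((k:ℝ)-μ))) := by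
  have hm : (0:ℝ) ≤ m := Nat.cast_nonneg m
  have a := cc_mul h1 h2 k
  have b := cc_mul h1 h2 (k+1)
  have h3 := mu_lt h2 hk
  have n0 := cc_ne h1 h2 k
  have n1 := cc_ne h1 h2 (k+1)
  have n2 := cc_ne h1 h2 (k+2)
  have e1 : (k:ℝ) - μ ≠ 0 := by linarith
  have e2 : (k:ℝ) + μ + 1 ≠ 0 := by linarith
  have e3 : (k:ℝ) + 2 ≠ 0 := by linarith
  have c0 : cc μ k = (k + μ + 1) * (k - μ) / cc μ (k+1) := by rw [eq_div_iff n1, a]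
  have c2 : cc μ (k+2) = (k + 1 + μ + 1) * (k + 1 - μ) / cc μ (k+1) := by
    rw [eq_div_iff n1, mul_comm, show k+2 = k+1+1 by ring, b]; push_cast; ring
  have e4 : (k:ℝ) + 1 - μ ≠ 0 := by linarith
  have e5 : (k:ℝ) + 1 + μ + 1 ≠ 0 := by linarith
  rw [c0, c2]
  push_cast
  field_simp
  ring

lemma x_mul (k : ℕ) : (k:ℝ) / cc μ k * (((k+1:ℕ):ℝ) / cc μ (k+1)) = 1 + (μ^2+μ) / ((k+μ+1)*(k-μ)) := by
  have hm : (0:ℝ) ≤ m := Nat.cast_nonneg m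
  have hk : (0:ℝ) ≤ k := Nat.cast_nonneg k
  have e1 : (k:ℝ) - μ ≠ 0 := fun h => mu_ne h1 h2 k (by linarith)
  have e2 : (k:ℝ) + μ + 1 ≠ 0 := by linarith
  rw [div_mul_div_comm, cc_mul h1 h2 k]
  push_cast
  field_simp
  ring

lemma x_anti {k : ℕ} (hk : m + 1 ≤ k) (I : ℕ) : ((k+2*I:ℕ):ℝ) / cc μ (k+2*I) ≤ (k:ℝ) / cc μ k := by
  have hm : (0:ℝ) ≤ m := Nat.cast_nonneg m
  induction I with
  | zero => simp
  | succ I ih =>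
    refine le_trans ?_ ih
    have hk' : m + 1 ≤ k + 2*I := by omega
    rw [x_rec h1 h2 hk', show k + 2*(I+1) = k+2*I+2 by ring]
    have := cc_pos h1 h2 (show m+1 ≤ k+2*I+2 by omega)
    have h3 := mu_lt h2 hk'
    refine le_mul_of_one_le_right (by positivity) ?_
    have : 0 ≤ 2 * (μ^2+μ) / ((((k+2*I:ℕ):ℝ)+2)*(((k+2*I:ℕ):ℝ)+μ+1)*(((k+2*I:ℕ):ℝ)-μ)) := by
      apply div_nonneg (by nlinarith)
      apply mul_nonneg (mul_nonneg _ _) <;> linarith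
    linarith

lemma x_ge_one {k : ℕ} (hk : m + 1 ≤ k) : 1 ≤ (k:ℝ) / cc μ k := by
  have hm : (0:ℝ) ≤ m := Nat.cast_nonneg m
  have hpos := cc_pos h1 h2 hk
  have hsq : 1 ≤ ((k:ℝ) / cc μ k)^2 := by
    have l1 : Tendsto (fun I : ℕ => 1 / (1 + 1 / ((k+2*I:ℕ):ℝ))) atTop (nhds (1/(1+0))) := by
      have : Tendsto (fun I : ℕ => k + 2*I) atTop atTop := tendsto_atTop_mono (fun I => by show I ≤ _; omega) tendsto_id
      have := tendsto_one_div_atTop_nhds_zero_nat (𝕜 := ℝ) |>.comp this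
      exact tendsto_const_nhds.div (tendsto_const_nhds.add this) (by norm_num)
    simp only [add_zero, div_one] at l1
    refine le_of_tendsto' l1 fun I => ?_
    have hk' : m + 1 ≤ k + 2*I := by omega
    have a := x_anti h1 h2 hk I
    have b := cc_sq_le h1 h2 hk'
    have hp := cc_pos h1 h2 hk'
    have h3 := mu_lt h2 hk'
    have hn : (0:ℝ) < ((k+2*I:ℕ):ℝ) := by linarith
    refine le_trans ?_ (pow_le_pow_left₀ (by positivity) a 2)
    rw [div_pow, div_le_div_iff₀ (by positivity) (by positivity), one_mul]
    refine b.trans ?_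
    set n : ℝ := ((k+2*I:ℕ):ℝ)
    have : n^2 * (1 + 1/n) = n^2 + n := by field_simp
    rw [this]; nlinarith
  exact (one_le_sq_iff₀ (by positivity)).1 hsq

lemma x_le {k : ℕ} (hk : m + 1 ≤ k) : (k:ℝ) / cc μ k ≤ 1 + (μ^2+μ) / ((k+μ+1)*(k-μ)) := by
  have hpos := cc_pos h1 h2 hk
  rw [← x_mul h1 h2 k]
  exact le_mul_of_one_le_right (by positivity) (x_ge_one h1 h2 (by omega))

lemma tendsto_aux : Tendsto (fun k : ℕ => (k:ℝ) * ((μ^2+μ) / ((k+μ+1)*(k-μ)))) atTop (nhds 0) := by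
  have t1 : Tendsto (fun k : ℕ => (k:ℝ)) atTop atTop := tendsto_natCast_atTop_atTop
  have hm : (0:ℝ) ≤ m := Nat.cast_nonneg m
  have l1 : Tendsto (fun k : ℕ => (μ^2+μ) / ((k:ℝ)-μ)) atTop (nhds 0) :=
    tendsto_const_nhds.div_atTop (tendsto_atTop_add_const_right _ (-μ) t1)
  refine squeeze_zero' ?_ ?_ l1
  · filter_upwards [eventually_ge_atTop (m+1)] with k hk
    have h3 := mu_lt h2 hk
    have a : 0 ≤ (μ^2+μ) := by nlinarith
    have b : 0 < ((k:ℝ)+μ+1)*(k-μ) := mul_pos (by linarith) (by linarith)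
    positivity
  · filter_upwards [eventually_ge_atTop (m+1)] with k hk
    have h3 := mu_lt h2 hk
    have a : 0 ≤ (μ^2+μ) := by nlinarith
    have b : 0 < (k:ℝ)-μ := by linarith
    have c : 0 < (k:ℝ)+μ+1 := by linarith
    rw [mul_div_assoc', div_le_div_iff₀ (by positivity) b]
    nlinarith [mul_nonneg a b.le, mul_nonneg (mul_nonneg a b.le) c.le]

lemma x_tendsto : Tendsto (fun k : ℕ => (k:ℝ) / cc μ k) atTop (nhds 1) := by
  have l := tendsto_aux h1 h2
  have l2 := l.const_add 1
  rw [add_zero] at l2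
  refine tendsto_of_tendsto_of_tendsto_of_le_of_le' tendsto_const_nhds l2 ?_ ?_
  · filter_upwards [eventually_ge_atTop (m+1)] with k hk using x_ge_one h1 h2 hk
  · filter_upwards [eventually_ge_atTop (m+1)] with k hk
    refine (x_le h1 h2 hk).trans ?_
    have h3 := mu_lt h2 hk
    have hm : (0:ℝ) ≤ m := Nat.cast_nonneg m
    have : (1:ℝ) ≤ k := by exact_mod_cast (show 1 ≤ k by omega)
    have a : 0 ≤ (μ^2+μ) := by nlinarith
    have b : 0 < ((k:ℝ)+μ+1)*(k-μ) := mul_pos (by linarith) (by linarith)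
    have c : 0 ≤ (μ^2+μ) / (((k:ℝ)+μ+1)*(k-μ)) := by positivity
    nlinarith

lemma cc_le {k : ℕ} (hk : m + 1 ≤ k) : cc μ k ≤ k := by
  have := x_ge_one h1 h2 hk
  rwa [one_le_div (cc_pos h1 h2 hk)] at this

lemma e_tendsto : Tendsto (fun k : ℕ => (k:ℝ) - cc μ k) atTop (nhds 0) := by
  refine squeeze_zero' ?_ ?_ (tendsto_aux h1 h2)
  · filter_upwards [eventually_ge_atTop (m+1)] with k hk
    linarith [cc_le h1 h2 hk]
  · filter_upwards [eventually_ge_atTop (m+1)] with k hk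
    have a := x_le h1 h2 hk
    have b := cc_le h1 h2 hk
    have hp := cc_pos h1 h2 hk
    rw [div_le_iff₀ hp] at a
    set X := (μ^2+μ) / (((k:ℝ)+μ+1)*(k-μ))
    have c : 0 ≤ X := by
      by_contra h; push Not at h
      nlinarith
    nlinarith

lemma e_rec (k : ℕ) :
    ((k:ℝ) - cc μ k) = 2 * (((k+1:ℕ):ℝ) / cc μ (k+1) - 1) + (((k+2:ℕ):ℝ) - cc μ (k+2)) := by
  have a := cc_mul h1 h2 k
  have b := cc_mul h1 h2 (k+1)
  have n1 := cc_ne h1 h2 (k+1)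
  rw [show k + 1 + 1 = k+2 by ring] at b
  push_cast at *
  field_simp
  linarith

lemma CM_x : CM (fun i => ((m+1+i:ℕ):ℝ) / cc μ (m+1+i) - 1) := by
  have hR := CM_R h1 h2
  set s : ℕ → ℝ := (fun i => 2 * (μ^2+μ) / ((((m+1+i:ℕ):ℝ)+2)*(((m+1+i:ℕ):ℝ)+μ+1)*(((m+1+i:ℕ):ℝ)-μ))) with hs
  have hP : ∀ I : ℕ, CM (fun i => ∏ n ∈ Finset.range I, (1 + s (i + 2*n)) - 1) := by
    intro I
    induction I with
    | zero => simpa using CM.const le_rfl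
    | succ I ih =>
      have sh : CM (fun i => s (i + 2*I)) := by
        convert hR.shift (2*I) 1 using 2 with i
        rw [one_mul, add_comm]
      have := CM.add _ _ (CM.mul ih (CM.add _ _ (CM.const zero_le_one) sh)) sh
      convert this using 2 with i
      rw [Finset.prod_range_succ]; ring
  have hrec : ∀ (I i : ℕ), ((m+1+i:ℕ):ℝ) / cc μ (m+1+i) =
      (((m+1+i+2*I:ℕ):ℝ) / cc μ (m+1+i+2*I)) * ∏ n ∈ Finset.range I, (1 + s (i + 2*n)) := by
    intro I i
    induction I with
    | zero => simp
    | succ I ih =>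
      rw [ih, x_rec h1 h2 (show m + 1 ≤ m+1+i+2*I by omega), Finset.prod_range_succ,
        show m+1+i+2*(I+1) = m+1+i+2*I+2 by ring]
      simp only [hs]
      rw [show m+1+(i+2*I) = m+1+i+2*I by ring]
      ring
  refine CM.lim _ _ hP fun i => ?_
  have t : Tendsto (fun I : ℕ => m+1+i + 2*I) atTop atTop := tendsto_atTop_mono (fun I => by show I ≤ _; omega) tendsto_id
  have l := (x_tendsto h1 h2).comp t
  have l2 : Tendsto (fun I : ℕ => (((m+1+i:ℕ):ℝ) / cc μ (m+1+i)) / (((m+1+i+2*I:ℕ):ℝ) / cc μ (m+1+i+2*I))) atTop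
    (nhds ((((m+1+i:ℕ):ℝ) / cc μ (m+1+i)) / 1)) := tendsto_const_nhds.div l one_ne_zero
  rw [div_one] at l2
  refine (l2.congr fun I => ?_).sub_const 1
  have hp := cc_pos h1 h2 (show m+1 ≤ m+1+i+2*I by omega)
  have : (((m+1+i+2*I:ℕ):ℝ) / cc μ (m+1+i+2*I)) ≠ 0 := by positivity
  rw [hrec I i, mul_div_assoc, mul_comm, div_mul_cancel₀ _ this]

lemma CM_e0 : CM (fun i => ((m+i:ℕ):ℝ) - cc μ (m+i)) := by
  have hX := CM_x h1 h2
  have hS : ∀ I : ℕ, CM (fun i => ∑ n ∈ Finset.range I, 2 * (((m+1+(i+2*n):ℕ):ℝ) / cc μ (m+1+(i+2*n)) - 1)) := by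
    refine CM.sum fun n => CM.mul (CM.const zero_le_two) ?_
    convert hX.shift (2*n) 1 using 2 with i
    rw [one_mul, add_comm i]
  have hrec : ∀ (I i : ℕ), ((m+i:ℕ):ℝ) - cc μ (m+i) =
      ∑ n ∈ Finset.range I, 2 * (((m+1+(i+2*n):ℕ):ℝ) / cc μ (m+1+(i+2*n)) - 1) +
        (((m+i+2*I:ℕ):ℝ) - cc μ (m+i+2*I)) := by
    intro I i
    induction I with
    | zero => simp
    | succ I ih =>
      rw [ih, e_rec h1 h2 (m+i+2*I), Finset.sum_range_succ,
        show m+i+2*(I+1) = m+i+2*I+2 by ring, show m+1+(i+2*I) = m+i+2*I+1 by ring]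
      ring
  refine CM.lim _ _ hS fun i => ?_
  have t : Tendsto (fun I : ℕ => m+i + 2*I) atTop atTop := tendsto_atTop_mono (fun I => by show I ≤ _; omega) tendsto_id
  have l := ((e_tendsto h1 h2).comp t).const_sub (((m+i:ℕ):ℝ) - cc μ (m+i))
  rw [sub_zero] at l
  refine l.congr fun I => ?_
  have := hrec I i
  simp only [Function.comp]
  linarith

/-- The sequence `e_{(i+1)m}` is completely monotone. -/
lemma CM_e : CM (fun i => (((i+1)*m:ℕ):ℝ) - cc μ ((i+1)*m)) := by
  convert (CM_e0 h1 h2).shift 0 m using 2 with i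
  rw [show m + (0 + m*i) = (i+1)*m by ring]

lemma cc_ratio : Tendsto (fun k : ℕ => cc μ (k+1) / cc μ k) atTop (nhds 1) := by
  have l := x_tendsto h1 h2
  have l1 := l.div ((tendsto_add_atTop_iff_nat 1).2 l) one_ne_zero
  have l2 : Tendsto (fun k : ℕ => ((k+1:ℕ):ℝ) / k) atTop (nhds 1) := by
    have := (tendsto_one_div_atTop_nhds_zero_nat (𝕜 := ℝ)).const_add 1
    rw [add_zero] at this
    refine this.congr' ?_
    filter_upwards [eventually_ge_atTop 1] with k hk
    have : (k:ℝ) ≠ 0 := by positivity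
    push_cast; field_simp
  have := l1.mul l2
  rw [div_one, one_mul] at this
  refine this.congr' ?_
  filter_upwards [eventually_ge_atTop 1] with k hk
  have : (k:ℝ) ≠ 0 := by positivity
  have n1 := cc_ne h1 h2 (k+1)
  have n0 := cc_ne h1 h2 k
  have : ((k+1:ℕ):ℝ) ≠ 0 := by positivity
  simp only [Pi.div_apply]
  field_simp
end
end TO

namespace TO

section
variable {m : ℕ} {μ : ℝ} (h1 : (m:ℝ) < μ) (h2 : μ < m + 1)
include h1 h2

lemma cc_even (hodd : Odd m) (j : ℕ) (hj : 2 * j + 1 ≤ m) : cc μ (2*j) ≤ cc μ 0 ∧ cc μ 0 ≤ 2^j * cc μ (2*j) := by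
  have hm : (0:ℝ) ≤ m := Nat.cast_nonneg m
  induction j with
  | zero => simp
  | succ j ih =>
    have ih := ih (by omega)
    have a := cc_mul h1 h2 (2*j)
    have b := cc_mul h1 h2 (2*j+1)
    have hneg : cc μ (2*j+1) < 0 := by
      have := (cc_sign h1 h2 (m - (2*j+1)) (by omega)).1 (by
        obtain ⟨q, hq⟩ := hodd; exact ⟨q - j, by omega⟩)
      rwa [show m - (m - (2*j+1)) = 2*j+1 by omega] at this
    have hj' : (2*(j:ℝ) + 3) ≤ m := by exact_mod_cast (show 2*j+3 ≤ m by omega)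
    have hj0 : (0:ℝ) ≤ j := Nat.cast_nonneg j
    rw [show 2*j+1+1 = 2*(j+1) by ring] at b
    push_cast at a b
    set n := - cc μ (2*j+1) with hn
    have hnp : 0 < n := by linarith
    have a' : cc μ (2*j) * n = (2*j+μ+1)*(μ-2*j) := by rw [hn]; linarith
    have b' : cc μ (2*(j+1)) * n = (2*j+1+μ+1)*(μ-(2*j+1)) := by rw [hn]; linarith
    have c1 : cc μ (2*(j+1)) ≤ cc μ (2*j) := by
      refine le_of_mul_le_mul_right ?_ hnp
      rw [a', b']; nlinarith
    have c2 : cc μ (2*j) ≤ 2 * cc μ (2*(j+1)) := by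
      refine le_of_mul_le_mul_right ?_ hnp
      rw [mul_assoc, a', b']; nlinarith
    refine ⟨c1.trans ih.1, ih.2.trans ?_⟩
    rw [pow_succ, mul_assoc]
    gcongr

lemma cc_bounds (hodd : Odd m) : cc μ (m-1) ≤ cc μ 0 ∧ cc μ 0 ≤ 2^m * cc μ (m-1) := by
  obtain ⟨q, hq⟩ := hodd
  have := cc_even h1 h2 ⟨q, hq⟩ q (by omega)
  rw [show m - 1 = 2 * q by omega]
  refine ⟨this.1, this.2.trans ?_⟩
  have : 0 < cc μ (2*q) := by
    have := (cc_sign h1 h2 1 (by omega)).2 odd_one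
    rwa [show m - 1 = 2*q by omega] at this
  gcongr
  · norm_num
  · omega

lemma cc_b (hodd : Odd m) : cc μ (m-1) * (-cc μ m) = (m+μ)*(μ+1-m) := by
  obtain ⟨q, hq⟩ := hodd
  have := cc_mul h1 h2 (m-1)
  have hc : ((m-1:ℕ):ℝ) = m - 1 := by push_cast [show 1 ≤ m by omega]; ring
  rw [show m - 1 + 1 = m by omega, hc] at this
  linarith
end

lemma mu1_ex (m : ℕ) (hodd : Odd m) :
    2 * (-cc ((m:ℝ) + 1/8) m) < cc ((m:ℝ)+1/8) 0 := by
  have hm1 : (1:ℝ) ≤ m := by exact_mod_cast hodd.pos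
  set μ : ℝ := (m:ℝ) + 1/8 with hμ
  have h1 : (m:ℝ) < μ := by linarith
  have h2 : μ < m + 1 := by linarith
  have a := (cc_bounds h1 h2 hodd).1
  have b := cc_b h1 h2 hodd
  have hb : 0 < -cc μ m := by linarith [cc_m_neg h1 h2]
  refine lt_of_lt_of_le ?_ a
  have c := cc_mul h1 h2 m
  have d := cc_mul h1 h2 (m+1)
  have e := cc_sq_le h1 h2 (show m+1 ≤ m+1+1 by omega)
  have p1 := cc_pos h1 h2 (show m+1 ≤ m+1 by omega)
  have p2 := cc_pos h1 h2 (show m+1 ≤ m+1+1 by omega)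
  refine lt_of_mul_lt_mul_right ?_ hb.le
  rw [b]
  set B := -cc μ m
  set x := cc μ (m+1)
  set y := cc μ (m+1+1)
  have c' : B * x = (2*m+9/8)/8 := by simp only [B]; rw [neg_mul, c, hμ]; ring
  push_cast at d e
  have d' : x * y = (2*m+17/8)*(7/8) := by rw [d, hμ]; ring
  have e' : y^2 ≤ (2*m+25/8)*(15/8) := by refine e.trans (le_of_eq ?_); rw [hμ]; ring
  have r : (m + μ)*(μ+1-m) = (2*m+1/8)*(9/8) := by rw [hμ]; ring
  rw [r]
  -- B * ((2m+17/8)(7/8)) = (2m+9/8)/8 * y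
  have f : B * ((2*m+17/8)*(7/8)) = (2*m+9/8)/8 * y := by rw [← d', ← c']; ring
  have g : B^2 * ((2*m+17/8)*(7/8))^2 ≤ ((2*m+9/8)/8)^2 * ((2*m+25/8)*(15/8)) := by
    rw [← mul_pow, f, mul_pow]; gcongr
  have key : 2 * (((2*(m:ℝ)+9/8)/8)^2 * ((2*m+25/8)*(15/8))) < (2*m+1/8)*(9/8) * ((2*m+17/8)*(7/8))^2 := by
    have : ∃ k : ℝ, (m:ℝ) = k + 1 ∧ 0 ≤ k := ⟨m-1, by ring, by linarith⟩
    obtain ⟨k, hk, hk0⟩ := this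
    rw [hk, ← sub_pos]
    ring_nf
    positivity
  have hpos : 0 < ((2*(m:ℝ)+17/8)*(7/8))^2 := by positivity
  refine lt_of_mul_lt_mul_right ?_ hpos.le
  nlinarith

lemma mu2_aux {n δ B x P : ℝ} (hm1 : 1 ≤ n) (hδ0 : 0 < δ) (hP : 1 ≤ P) (hδm : δ * P = 1/32) (hb : 0 < B)
    (c' : B * x = (2*n+2-δ)*(1-δ)) (e' : x^2 ≤ (2*n+3-δ)*δ) : P * ((2*n+1-δ)*(2-δ)) < B / 2 * B := by
  have hδ1 : δ ≤ 1/32 := by nlinarith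
  have g : ((2*n+2-δ)*(1-δ))^2 ≤ B^2 * ((2*n+3-δ)*δ) := by
    rw [← c', mul_pow]; gcongr
  have k1 : (2*n+1)^2*(7/8) ≤ ((2*n+2-δ)*(1-δ))^2 := by
    have : (2*n+1)*(31/32) ≤ (2*n+2-δ)*(1-δ) := by nlinarith
    have h3 := pow_le_pow_left₀ (by positivity) this 2
    nlinarith
  have k2 : B^2 * ((2*n+3-δ)*δ) ≤ B^2 * ((2*n+3)*δ) := by
    gcongr; linarith
  have k3 : (2*n+1)*(7/8)*3/5 ≤ B^2*δ := by
    have h5 : (2*n+3) ≤ (5/3)*(2*n+1) := by linarith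
    have h7 : (2*n+1)^2*(7/8) ≤ B^2*(((5/3)*(2*n+1))*δ) := (k1.trans (g.trans k2)).trans (by gcongr)
    have h8 : (2*n+1)*((2*n+1)*(7/8)) ≤ (2*n+1)*(B^2*δ*(5/3)) := by linarith
    have := le_of_mul_le_mul_left h8 (by linarith)
    linarith
  have k4 : (2*n+1)*(7/8)*3/5*P ≤ B^2*δ*P := by gcongr
  have k4' : B^2*δ*P = B^2/32 := by rw [mul_assoc, hδm]; ring
  have k5 : (2*n+1-δ)*(2-δ) ≤ (2*n+1)*2 := by nlinarith
  have k6 : P*((2*n+1-δ)*(2-δ)) ≤ P*((2*n+1)*2) := by gcongr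
  have k7 : (0:ℝ) < P*(2*n+1) := by positivity
  nlinarith

lemma mu2_ex' (m : ℕ) (hodd : Odd m) {δ : ℝ} (hδ0 : 0 < δ) (hδm : δ * 2^m = 1/32) :
    cc ((m:ℝ) + 1 - δ) 0 < (-cc ((m:ℝ) + 1 - δ) m) / 2 := by
  have hm1 : (1:ℝ) ≤ m := by exact_mod_cast hodd.pos
  have hp : (1:ℝ) ≤ 2^m := one_le_pow₀ (by norm_num)
  have hδ1 : δ ≤ 1/32 := by nlinarith
  obtain ⟨μ, hμ⟩ : ∃ μ : ℝ, μ = (m:ℝ) + 1 - δ := ⟨_, rfl⟩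
  rw [← hμ]
  have h1 : (m:ℝ) < μ := by linarith
  have h2 : μ < m + 1 := by linarith
  have a := (cc_bounds h1 h2 hodd).2
  have b := cc_b h1 h2 hodd
  have hb : 0 < -cc μ m := by linarith [cc_m_neg h1 h2]
  refine lt_of_le_of_lt a ?_
  have c := cc_mul h1 h2 m
  have e := cc_sq_le h1 h2 (show m+1 ≤ m+1 by omega)
  refine lt_of_mul_lt_mul_right ?_ hb.le
  rw [mul_assoc, b]
  have r : (m + μ)*(μ+1-m) = (2*m+1-δ)*(2-δ) := by rw [hμ]; ring
  rw [r]
  push_cast at e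
  refine mu2_aux (x := cc μ (m+1)) hm1 hδ0 hp hδm hb ?_ ?_
  · rw [neg_mul, c, hμ]; ring
  · refine e.trans (le_of_eq ?_); rw [hμ]; ring

lemma mu2_ex (m : ℕ) (hodd : Odd m) :
    cc ((m:ℝ) + 1 - 1/2^(m+5)) 0 < (-cc ((m:ℝ) + 1 - 1/2^(m+5)) m) / 2 := by
  refine mu2_ex' m hodd (by positivity) ?_
  rw [pow_add]; field_simp; norm_num

/-- Functionals on CM sequences. -/
lemma CM.func {s : ℕ → ℝ} (hs : ∀ i, |s i| ≤ 1) {t : ℝ} (ht : 0 ≤ t) (ht1 : t < 1) {D : ℝ}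
    (hg : ∀ r, 0 ≤ r → r ≤ 1 → -D ≤ ∑' i : ℕ, r^i * (t^(i+1) * s i)) {ε : ℕ → ℝ} (hε : CM ε) :
    Summable (fun i => ε i * (t^(i+1) * s i)) ∧ - (D * ε 0) ≤ ∑' i, ε i * (t^(i+1) * s i) := by
  have hsum : Summable (fun i : ℕ => t^(i+1)) := by
    simpa [pow_succ] using (summable_geometric_of_lt_one ht ht1).mul_right t
  have hbd : ∀ (B : ℝ) (x : ℝ) (i : ℕ), 0 ≤ x → x ≤ B → ‖x * (t^(i+1) * s i)‖ ≤ B * t^(i+1) := by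
    intro B x i h0 hB
    rw [norm_mul, norm_mul, Real.norm_eq_abs, Real.norm_eq_abs, Real.norm_eq_abs, abs_of_nonneg h0, abs_of_nonneg (by positivity)]
    calc x * (t^(i+1) * |s i|) ≤ B * (t^(i+1) * 1) := by
          gcongr
          · exact h0.trans hB
          · exact hs i
      _ = _ := by ring
  have hsm : ∀ ε : ℕ → ℝ, CM ε → Summable (fun i => ε i * (t^(i+1) * s i)) := by
    intro ε hε
    exact Summable.of_norm_bounded (hsum.mul_left (ε 0)) (fun i => hbd _ _ i (hε.nonneg i) (hε.le_zero i))
  refine ⟨hsm ε hε, ?_⟩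
  induction hε with
  | geom c r hc hr hr1 =>
    have := hg r hr hr1
    simp only [mul_assoc, tsum_mul_left, pow_zero, mul_one]
    nlinarith
  | add a b ha hb iha ihb =>
    simp only [add_mul]
    rw [(hsm a ha).tsum_add (hsm b hb)]
    linarith
  | lim F g hF h ih =>
    have h0 := h 0
    obtain ⟨B, hB⟩ := h0.bddAbove_range
    have l : Tendsto (fun n => ∑' i, F n i * (t^(i+1) * s i)) atTop (nhds (∑' i, g i * (t^(i+1) * s i))) := by
      refine tendsto_tsum_of_dominated_convergence (bound := fun i => B * t^(i+1)) (hsum.mul_left B) ?_ ?_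
      · intro i; exact (h i).mul_const _
      · refine Eventually.of_forall fun n i => hbd _ _ i ((hF n).nonneg i) (((hF n).le_zero i).trans (hB ⟨n, rfl⟩))
    exact le_of_tendsto_of_tendsto' (h0.const_mul D).neg l ih

lemma poisson {q : ℝ} (hq : 0 ≤ q) (hq1 : q < 1) (ψ : ℝ) :
    HasSum (fun i : ℕ => q^i * cos (((i+1:ℕ):ℝ) * ψ)) ((cos ψ - q) / (1 - 2*q*cos ψ + q^2)) := by
  have hz : ‖(q:ℂ) * Complex.exp (ψ * Complex.I)‖ < 1 := by
    rw [norm_mul, Complex.norm_exp_ofReal_mul_I, mul_one, Complex.norm_real, Real.norm_eq_abs, abs_of_nonneg hq]; exact hq1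
  have h := ((hasSum_geometric_of_norm_lt_one hz).mul_left (Complex.exp (ψ * Complex.I)))
  have h' := Complex.hasSum_re h
  have hfun : (fun i : ℕ => (Complex.exp (ψ * Complex.I) * ((q:ℂ) * Complex.exp (ψ * Complex.I))^i).re) = (fun i : ℕ => q^i * cos (((i+1:ℕ):ℝ) * ψ)) := by
    funext i
    rw [mul_pow, ← Complex.exp_nat_mul, mul_left_comm, ← Complex.exp_add, ← Complex.ofReal_pow, Complex.re_ofReal_mul]
    congr 1
    rw [show (ψ * Complex.I + i * (ψ * Complex.I) : ℂ) = (((i+1:ℕ):ℝ) * ψ : ℝ) * Complex.I by push_cast; ring,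
      Complex.exp_ofReal_mul_I_re]
  rw [hfun] at h'
  convert h' using 1
  rw [Complex.exp_mul_I, ← Complex.ofReal_cos, ← Complex.ofReal_sin]
  have hs := Real.sin_sq_add_cos_sq ψ
  rw [Complex.mul_re, Complex.inv_re, Complex.inv_im, Complex.normSq_apply]
  simp only [Complex.add_re, Complex.add_im, Complex.mul_re, Complex.mul_im, Complex.sub_re, Complex.sub_im, Complex.one_re, Complex.one_im,
    Complex.ofReal_re, Complex.ofReal_im, Complex.I_re, Complex.I_im]
  ring_nf
  rw [Real.sin_sq]
  ring

lemma poisson_den {q : ℝ} (hq : 0 ≤ q) (hq1 : q < 1) (ψ : ℝ) : 0 < 1 - 2*q*cos ψ + q^2 := by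
  nlinarith [Real.cos_le_one ψ, Real.neg_one_le_cos ψ, sq_nonneg (1-q), mul_nonneg hq (sub_nonneg.2 (Real.cos_le_one ψ)), mul_pos (sub_pos.2 hq1) (sub_pos.2 hq1)]

lemma CM.K1 {ε : ℕ → ℝ} (hε : CM ε) {t : ℝ} (ht : 0 ≤ t) (ht1 : t < 1) {φ c : ℝ} (hφ : φ ∈ Icc 0 π) (hc : c ∈ Icc 0 π) :
    0 ≤ ∑' i : ℕ, ε i * (t^(i+1) * (sin (((i+1:ℕ):ℝ) * φ) * sin (((i+1:ℕ):ℝ) * c))) := by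
  have := (CM.func (s := fun i => sin (((i+1:ℕ):ℝ) * φ) * sin (((i+1:ℕ):ℝ) * c)) (D := 0) (t := t) ?_ ht ht1 ?_ hε).2
  · simpa using this
  · intro i
    rw [abs_mul]
    exact mul_le_one₀ (Real.abs_sin_le_one _) (abs_nonneg _) (Real.abs_sin_le_one _)
  · intro r hr hr1
    have hq : 0 ≤ r * t := by positivity
    have hq1 : r * t < 1 := by nlinarith
    have a := poisson hq hq1 (φ - c)
    have b := poisson hq hq1 (φ + c)
    have h := ((a.sub b).mul_left (t/2)).tsum_eq
    have hfun : (fun i : ℕ => r^i * (t^(i+1) * (sin (((i+1:ℕ):ℝ) * φ) * sin (((i+1:ℕ):ℝ) * c)))) =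
      fun i : ℕ => t/2 * ((r*t)^i * cos (((i+1:ℕ):ℝ) * (φ - c)) - (r*t)^i * cos (((i+1:ℕ):ℝ) * (φ + c))) := by
      funext i
      rw [mul_sub (((i+1:ℕ):ℝ)), mul_add (((i+1:ℕ):ℝ)), Real.cos_sub, Real.cos_add, mul_pow, pow_succ]; ring
    rw [hfun, h, neg_zero]
    have d1 := poisson_den hq hq1 (φ - c)
    have d2 := poisson_den hq hq1 (φ + c)
    have hX : cos (φ + c) ≤ cos (φ - c) := by
      rw [Real.cos_sub, Real.cos_add]
      have := mul_nonneg (Real.sin_nonneg_of_mem_Icc hφ) (Real.sin_nonneg_of_mem_Icc hc)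
      linarith
    refine mul_nonneg (by linarith) (sub_nonneg.2 ?_)
    rw [div_le_div_iff₀ d2 d1]
    nlinarith [mul_nonneg (sub_nonneg.2 hX) (mul_nonneg (sub_nonneg.2 hq1.le) (show 0 ≤ 1 + r*t by linarith))]

lemma CM.K2 {ε : ℕ → ℝ} (hε : CM ε) {t : ℝ} (ht : 0 ≤ t) (ht1 : t < 1) (ψ : ℝ) :
    -ε 0 ≤ ∑' i : ℕ, ε i * (t^(i+1) * cos (((i+1:ℕ):ℝ) * ψ)) := by
  have := (CM.func (s := fun i => cos (((i+1:ℕ):ℝ) * ψ)) (D := 1) (t := t) ?_ ht ht1 ?_ hε).2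
  · simpa using this
  · intro i
    exact Real.abs_cos_le_one _
  · intro r hr hr1
    have hq : 0 ≤ r * t := by positivity
    have hq1 : r * t < 1 := by nlinarith
    have a := poisson hq hq1 ψ
    have h := (a.mul_left t).tsum_eq
    have hfun : (fun i : ℕ => r^i * (t^(i+1) * cos (((i+1:ℕ):ℝ) * ψ))) =
      fun i : ℕ => t * ((r*t)^i * cos (((i+1:ℕ):ℝ) * ψ)) := by
      funext i
      rw [mul_pow, pow_succ]; ring
    rw [hfun, h]
    have d1 := poisson_den hq hq1 ψ
    rw [mul_div_assoc', le_div_iff₀ d1]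
    have x1 := Real.cos_le_one ψ
    have x2 := Real.neg_one_le_cos ψ
    set q := r * t
    nlinarith [mul_nonneg (sub_nonneg.2 x1) (mul_nonneg (show 0 ≤ 1 - t by linarith) (show 0 ≤ 1 + q by linarith)), mul_nonneg (sub_nonneg.2 x1) (mul_nonneg hq hq), mul_nonneg (show 0 ≤ 1 + cos ψ by linarith) (mul_nonneg ht (sub_nonneg.2 hq1.le)), sq_nonneg (1-q), sq_nonneg (1+q)]
end TO

namespace TO

/-- Fourier cosine coefficients of the step `1_{φ > x}` on `[0,π]`. -/
noncomputable def chi (x : ℝ) (j : ℕ) : ℝ := (1/π) * ∫ φ in x..π, cos (j * φ)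

noncomputable def wt (j : ℕ) : ℝ := if j = 0 then 1 else 2

lemma wt_pos (j : ℕ) : 0 < wt j := by unfold wt; split_ifs <;> norm_num

lemma int_cos_nat {k : ℕ} (hk : k ≠ 0) (a b : ℝ) : ∫ φ in a..b, cos (k * φ) = (sin (k*b) - sin (k*a)) / k := by
  have : (k:ℝ) ≠ 0 := by exact_mod_cast hk
  rw [intervalIntegral.integral_comp_mul_left (fun x => cos x) this, integral_cos, smul_eq_mul]
  field_simp

lemma chi_zero (x : ℝ) : chi x 0 = 1 - x/π := by
  unfold chi
  simp only [Nat.cast_zero, zero_mul, cos_zero, intervalIntegral.integral_const, smul_eq_mul, mul_one]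
  field_simp

lemma chi_succ (x : ℝ) {j : ℕ} (hj : j ≠ 0) : chi x j = - sin (j * x) / (j * π) := by
  unfold chi
  rw [int_cos_nat hj, Real.sin_nat_mul_pi]
  have : (j:ℝ) ≠ 0 := by exact_mod_cast hj
  field_simp
  ring

lemma cos_intble (k a b : ℝ) : IntervalIntegrable (fun φ : ℝ => cos (k * φ)) MeasureTheory.volume a b :=
  Continuous.intervalIntegrable (by fun_prop) _ _

lemma chi_sub (x y : ℝ) (j : ℕ) : chi x j - chi y j = (1/π) * ∫ φ in x..y, cos (j * φ) := by
  unfold chi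
  rw [← mul_sub, ← intervalIntegral.integral_add_adjacent_intervals (cos_intble j x y) (cos_intble j y π), add_sub_cancel_right]

lemma chi_pi (j : ℕ) : chi π j = 0 := by simp [chi]

lemma chi_abs {x : ℝ} (hx : x ∈ Icc 0 π) (j : ℕ) : |chi x j| ≤ 1 - x / π := by
  have hp := Real.pi_pos
  unfold chi
  rw [abs_mul, abs_of_pos (by positivity)]
  have := intervalIntegral.norm_integral_le_of_norm_le_const (a := x) (b := π) (C := 1) (f := fun φ => cos (j * φ)) (fun φ _ => Real.abs_cos_le_one _)
  rw [Real.norm_eq_abs, one_mul, abs_of_nonneg (sub_nonneg.2 hx.2)] at this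
  calc _ ≤ 1/π * (π - x) := by gcongr
    _ = _ := by field_simp

lemma chi_abs' {x : ℝ} (hx : x ∈ Icc 0 π) (j : ℕ) : |chi x j| ≤ 1 := by
  have hp := Real.pi_pos
  refine (chi_abs hx j).trans ?_
  have : 0 ≤ x/π := div_nonneg hx.1 hp.le
  linarith

lemma chi_at_zero {j : ℕ} (hj : j ≠ 0) : chi 0 j = 0 := by rw [chi_succ _ hj]; simp

lemma int_cos_int {n : ℤ} (hn : n ≠ 0) : ∫ φ in (0:ℝ)..π, cos (n * φ) = 0 := by
  have : (n:ℝ) ≠ 0 := by exact_mod_cast hn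
  rw [intervalIntegral.integral_comp_mul_left (fun x => cos x) this, integral_cos, smul_eq_mul, Real.sin_int_mul_pi]
  simp

lemma orth (j k : ℕ) : ∫ φ in (0:ℝ)..π, cos (j * φ) * cos (k * φ) = if j = k then π / wt j else 0 := by
  have e : ∀ φ : ℝ, cos (j * φ) * cos (k * φ) = (1/2) * (cos (((j:ℤ)-(k:ℤ):ℤ) * φ) + cos (((j:ℤ)+(k:ℤ):ℤ) * φ)) := by
    intro φ
    push_cast
    rw [sub_mul, add_mul, Real.cos_sub, Real.cos_add]; ring
  simp only [e]
  rw [intervalIntegral.integral_const_mul, intervalIntegral.integral_add (cos_intble _ _ _) (cos_intble _ _ _)]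
  by_cases h : j = k
  · subst h
    by_cases h0 : j = 0
    · subst h0; simp [wt]; ring
    · rw [int_cos_int (n := (j:ℤ)+j) (by omega)]
      simp [wt, h0]; ring
  · rw [int_cos_int (n := (j:ℤ)+k) (by omega), int_cos_int (n := (j:ℤ)-k) (by omega)]
    simp [h]

lemma series_summable {A : ℕ → ℝ} (hA : Summable fun j => |A j|) (φ : ℝ) : Summable (fun j : ℕ => A j * cos (j * φ)) := by
  refine Summable.of_norm_bounded hA fun j => ?_
  rw [norm_mul, Real.norm_eq_abs, Real.norm_eq_abs]
  exact mul_le_of_le_one_right (abs_nonneg _) (Real.abs_cos_le_one _)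

lemma series_cont {A : ℕ → ℝ} (hA : Summable fun j => |A j|) : Continuous (fun φ : ℝ => ∑' j : ℕ, A j * cos (j * φ)) := by
  refine continuous_tsum (fun j => by fun_prop) hA fun j φ => ?_
  rw [norm_mul, Real.norm_eq_abs, Real.norm_eq_abs]
  exact mul_le_of_le_one_right (abs_nonneg _) (Real.abs_cos_le_one _)

lemma series_int {A : ℕ → ℝ} (hA : Summable fun j => |A j|) {η : ℝ → ℝ} (hη : Continuous η) (a b : ℝ) :
    HasSum (fun j : ℕ => A j * ∫ φ in a..b, cos (j * φ) * η φ) (∫ φ in a..b, (∑' j : ℕ, A j * cos (j * φ)) * η φ) := by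
  have := intervalIntegral.hasSum_integral_of_dominated_convergence (μ := MeasureTheory.volume) (a := a) (b := b)
    (F := fun (j:ℕ) (φ:ℝ) => A j * (cos (j * φ) * η φ)) (f := fun φ => (∑' j : ℕ, A j * cos (j * φ)) * η φ)
    (fun j φ => |A j| * |η φ|) ?_ ?_ ?_ ?_ ?_
  · simpa only [intervalIntegral.integral_const_mul] using this
  · intro j; exact Continuous.aestronglyMeasurable (by fun_prop)
  · intro j
    refine Eventually.of_forall fun φ _ => ?_
    rw [norm_mul, norm_mul, Real.norm_eq_abs, Real.norm_eq_abs, Real.norm_eq_abs]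
    gcongr
    exact mul_le_of_le_one_left (abs_nonneg _) (Real.abs_cos_le_one _)
  · exact Eventually.of_forall fun φ _ => hA.mul_right _
  · simp only [tsum_mul_right]
    exact Continuous.intervalIntegrable (by fun_prop) _ _
  · refine Eventually.of_forall fun φ _ => ?_
    have := (series_summable hA φ).hasSum.mul_right (η φ)
    simpa only [mul_assoc] using this

lemma series_int_one {A : ℕ → ℝ} (hA : Summable fun j => |A j|) (a b : ℝ) :
    HasSum (fun j : ℕ => A j * ∫ φ in a..b, cos (j * φ)) (∫ φ in a..b, (∑' j : ℕ, A j * cos (j * φ))) := by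
  simpa using series_int hA (η := fun _ => 1) continuous_const a b

lemma series_int_cos {A : ℕ → ℝ} (hA : Summable fun j => |A j|) (k : ℕ) :
    ∫ φ in (0:ℝ)..π, (∑' j : ℕ, A j * cos (j * φ)) * cos (k * φ) = A k * (π / wt k) := by
  have := series_int hA (η := fun φ => cos (k * φ)) (by fun_prop) 0 π
  rw [← this.tsum_eq, tsum_eq_single k]
  · rw [orth, if_pos rfl]
  · intro j hj; rw [orth, if_neg hj, mul_zero]

lemma int_ind {x : ℝ} (hx : x ∈ Icc 0 π) {η : ℝ → ℝ} (hη : Continuous η) :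
    ∫ φ in (0:ℝ)..π, (if x < φ then η φ else 0) = ∫ φ in x..π, η φ ∧
    IntervalIntegrable (fun φ => if x < φ then η φ else 0) MeasureTheory.volume 0 π := by
  have e1 : ∫ φ in (0:ℝ)..x, (if x < φ then η φ else 0) = 0 := by
    rw [intervalIntegral.integral_congr_Ioo_of_le hx.1 (g := fun _ => 0)]
    · simp
    · intro φ hφ; simp only; rw [if_neg (not_lt.2 hφ.2.le)]
  have e2 : ∫ φ in x..π, (if x < φ then η φ else 0) = ∫ φ in x..π, η φ := by
    refine intervalIntegral.integral_congr_Ioo_of_le hx.2 ?_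
    intro φ hφ; simp only; rw [if_pos hφ.1]
  have i1 : IntervalIntegrable (fun φ => if x < φ then η φ else 0) MeasureTheory.volume 0 x := by
    refine (intervalIntegrable_congr_uIoo ?_).1 (intervalIntegrable_const (c := (0:ℝ)))
    rw [uIoo_of_le hx.1]
    intro φ hφ; simp only; rw [if_neg (not_lt.2 hφ.2.le)]
  have i2 : IntervalIntegrable (fun φ => if x < φ then η φ else 0) MeasureTheory.volume x π := by
    refine (intervalIntegrable_congr_uIoo ?_).1 (hη.intervalIntegrable x π)
    rw [uIoo_of_le hx.2]
    intro φ hφ; simp only; rw [if_pos hφ.1]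
  refine ⟨?_, i1.trans i2⟩
  rw [← intervalIntegral.integral_add_adjacent_intervals i1 i2, e1, e2, zero_add]

end TO

namespace TO

lemma kkt_struct (h : ℕ) (T w : ℕ → ℝ) (hT : ∀ a ≤ h, 0 ≤ T a) (hTh : T h = 0) (hT0 : 0 < T 0)
    (hw : ∀ a, 0 ≤ w a) (hcomp : ∀ a < h, w a * T a = 0) (hne : ∃ a < h, 0 < w a)
    (hmono : ∀ a, a + 1 < h → w (a+1) = 0 → T (a+1) - T (a+2) ≤ T a - T (a+1)) :
    ∃ c, 0 < c ∧ c < h ∧ (∀ a < c, w a = 0) ∧ (∀ a, c ≤ a → a < h → T a - T (a+1) = 0) ∧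
      (∀ a, a + 1 < c → T (a+1) - T (a+2) ≤ T a - T (a+1)) ∧ 0 ≤ T (c-1) - T c := by
  classical
  have hstep : ∀ c, c < h → T c = 0 → T (c+1) = 0 := by
    intro c hc h0
    by_contra hne
    have hpos : 0 < T (c+1) := lt_of_le_of_ne (hT _ (by omega)) (Ne.symm hne)
    have key : ∀ i, c + 1 + i ≤ h → 0 < T (c+1+i) ∧ T (c+i) - T (c+1+i) < 0 := by
      intro i
      induction i with
      | zero => intro _; simp [h0, hpos]
      | succ i ih =>
        intro hi
        obtain ⟨p1, p2⟩ := ih (by omega)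
        have hw0 : w (c+i+1) = 0 := by
          have := hcomp (c+1+i) (by omega)
          rcases mul_eq_zero.1 this with h | h
          · rwa [show c+i+1 = c+1+i by ring]
          · linarith
        have := hmono (c+i) (by omega) hw0
        rw [show c+1+(i+1) = c+i+2 by ring, show c + (i+1) = c+i+1 by ring]
        rw [show c+1+i = c+i+1 by ring] at p1 p2
        constructor <;> linarith
    have := (key (h - (c+1)) (by omega)).1
    rw [show c+1+(h-(c+1)) = h by omega] at this
    linarith
  have hex : ∃ a, a < h ∧ 0 < w a := hne
  set c := Nat.find hex with hc
  obtain ⟨hch, hwc⟩ := Nat.find_spec hex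
  rw [← hc] at hch hwc
  have hTc : T c = 0 := by
    rcases mul_eq_zero.1 (hcomp c hch) with h | h
    · linarith
    · exact h
  have hc0 : 0 < c := by
    rcases Nat.eq_zero_or_pos c with h | h
    · rw [h] at hTc; linarith
    · exact h
  have hlt : ∀ a < c, w a = 0 := by
    intro a ha
    have := Nat.find_min hex ha
    push Not at this
    exact le_antisymm (this (by omega)) (hw a)
  have hz : ∀ i, c + i ≤ h → T (c+i) = 0 := by
    intro i
    induction i with
    | zero => intro _; exact hTc
    | succ i ih => intro hi; exact hstep (c+i) (by omega) (ih (by omega))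
  refine ⟨c, hc0, hch, hlt, ?_, ?_, ?_⟩
  · intro a ha hah
    have e1 := hz (a - c) (by omega)
    have e2 := hz (a + 1 - c) (by omega)
    rw [show c + (a-c) = a by omega] at e1
    rw [show c + (a+1-c) = a+1 by omega] at e2
    rw [e1, e2, sub_zero]
  · intro a ha; exact hmono a (by omega) (hlt _ ha)
  · rw [hTc, sub_zero]; exact hT _ (by omega)

lemma crossing {E : Type*} [TopologicalSpace E] {D : Set E} (hD : IsCompact D) {a b : ℝ} (hab : a ≤ b)
    {Q : ℝ → E → ℝ} (hQ : ContinuousOn (fun p : ℝ × E => Q p.1 p.2) (Icc a b ×ˢ D))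
    (ha : ∀ w ∈ D, 0 < Q a w) (hb : ∃ w ∈ D, Q b w ≤ 0) :
    ∃ μ ∈ Icc a b, ∃ w ∈ D, Q μ w = 0 ∧ ∀ w' ∈ D, 0 ≤ Q μ w' := by
  have hK : IsCompact (Icc a b ×ˢ D) := isCompact_Icc.prod hD
  -- the sublevel set within the compact set
  have hmin : ∃ p ∈ {p ∈ Icc a b ×ˢ D | Q p.1 p.2 ≤ 0}, ∀ q ∈ {p ∈ Icc a b ×ˢ D | Q p.1 p.2 ≤ 0}, p.1 ≤ q.1 := by
    have hc : IsCompact {p ∈ Icc a b ×ˢ D | Q p.1 p.2 ≤ 0} := by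
      have := isCompact_iff_compactSpace.1 hK
      have hr := continuousOn_iff_continuous_restrict.1 hQ
      have hcl : IsClosed {p : ↥(Icc a b ×ˢ D) | Q p.1.1 p.1.2 ≤ 0} := isClosed_le hr continuous_const
      have := hcl.isCompact.image continuous_subtype_val
      convert this using 1
      ext p
      simp only [mem_setOf_eq, mem_image, Subtype.exists, exists_and_left, exists_prop]
      constructor
      · rintro ⟨h1, h2⟩; exact ⟨p, h2, h1, rfl⟩
      · rintro ⟨q, h2, h1, rfl⟩; exact ⟨h1, h2⟩
    obtain ⟨w, hw, hw0⟩ := hb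
    have hne : {p ∈ Icc a b ×ˢ D | Q p.1 p.2 ≤ 0}.Nonempty := ⟨(b, w), ⟨⟨⟨hab, le_rfl⟩, hw⟩, hw0⟩⟩
    obtain ⟨p, hp, hmin⟩ := hc.exists_isMinOn hne (f := Prod.fst) continuousOn_fst
    exact ⟨p, hp, fun q hq => hmin hq⟩
  obtain ⟨⟨μ, w⟩, ⟨⟨hμ, hw⟩, hle⟩, hmin⟩ := hmin
  simp only at hμ hw hle hmin
  have hpos : ∀ w' ∈ D, 0 ≤ Q μ w' := by
    intro w' hw'
    by_cases hμa : μ = a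
    · rw [hμa]; exact (ha w' hw').le
    have hlt : a < μ := lt_of_le_of_ne hμ.1 (Ne.symm hμa)
    have hcont : ContinuousWithinAt (fun s => Q s w') (Icc a μ) μ := by
      have h1 := hQ (μ, w') ⟨hμ, hw'⟩
      have h2 : ContinuousWithinAt (fun s : ℝ => (s, w')) (Icc a μ) μ := by fun_prop
      exact ContinuousWithinAt.comp (f := fun s : ℝ => (s, w')) h1 h2 (fun s hs => ⟨⟨hs.1, hs.2.trans hμ.2⟩, hw'⟩)
    have hmono := hcont.mono (Ico_subset_Icc_self)
    have hnb : (nhdsWithin μ (Ico a μ)).NeBot := by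
      rw [nhdsWithin_Ico_eq_nhdsLT hlt]; infer_instance
    refine ge_of_tendsto hmono ?_
    filter_upwards [self_mem_nhdsWithin] with s hs
    by_contra hneg
    push Not at hneg
    have := hmin (s, w') ⟨⟨⟨hs.1, (hs.2.le).trans hμ.2⟩, hw'⟩, hneg.le⟩
    simp only at this
    linarith [hs.2]
  exact ⟨μ, hμ, w, hw, le_antisymm hle (hpos w hw), hpos⟩

lemma kkt {h : ℕ} (K : Fin h → Fin h → ℝ) (hK : ∀ c d, K c d = K d c) (w : Fin h → ℝ) (hw : ∀ c, 0 ≤ w c)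
    (h0 : ∑ c, ∑ d, w c * w d * K c d = 0)
    (hpos : ∀ v : Fin h → ℝ, (∀ c, 0 ≤ v c) → 0 ≤ ∑ c, ∑ d, v c * v d * K c d) :
    (∀ c, 0 ≤ ∑ d, K c d * w d) ∧ ∀ c, w c * ∑ d, K c d * w d = 0 := by
  classical
  have hB : ∀ c, 0 ≤ ∑ d, K c d * w d := by
    intro c
    set B := ∑ d, K c d * w d with hBdef
    have hexp : ∀ s : ℝ, ∑ x, ∑ y, (w x + s * (if x = c then 1 else 0)) * (w y + s * (if y = c then 1 else 0)) * K x y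
        = 2 * s * B + s^2 * K c c := by
      intro s
      have : ∀ x y, (w x + s * (if x = c then 1 else 0)) * (w y + s * (if y = c then 1 else 0)) * K x y
         = w x * w y * K x y + (if x = c then s * (w y * K x y) else 0) + (if y = c then s * (w x * K x y) else 0)
          + (if x = c then (if y = c then s^2 * K x y else 0) else 0) := by
        intro x y; split_ifs <;> ring
      simp only [this, Finset.sum_add_distrib, h0]
      have e1 : ∑ x, ∑ y, (if x = c then s * (w y * K x y) else 0) = s * B := by
        rw [Finset.sum_eq_single c]
        · simp only [if_true, hBdef, Finset.mul_sum]
          exact Finset.sum_congr rfl fun y _ => by ring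
        · intro x _ hx; simp [hx]
        · simp
      have e2 : ∑ x, ∑ y, (if y = c then s * (w x * K x y) else 0) = s * B := by
        simp only [Finset.sum_ite_eq', Finset.mem_univ, if_true, hBdef, Finset.mul_sum]
        exact Finset.sum_congr rfl fun y _ => by rw [hK y c]; ring
      have e3 : ∑ x, ∑ y, (if x = c then (if y = c then s^2 * K x y else 0) else 0) = s^2 * K c c := by
        rw [Finset.sum_eq_single c]
        · simp
        · intro x _ hx; simp [hx]
        · simp
      rw [e1, e2, e3]; ring
    by_contra hneg
    push Not at hneg
    have hs : ∀ s : ℝ, 0 ≤ s → 0 ≤ 2 * s * B + s^2 * K c c := by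
      intro s hs
      rw [← hexp s]
      refine hpos _ fun x => ?_
      have := hw x
      split_ifs <;> simp <;> linarith
    have hden : 0 < |K c c| + 1 := by positivity
    have h3 := hs (-B / (|K c c| + 1)) (div_nonneg (by linarith) hden.le)
    set s := -B / (|K c c| + 1) with hsdef
    have hspos : 0 < s := div_pos (by linarith) hden
    have h4 : s * (|K c c| + 1) = -B := by rw [hsdef]; field_simp
    have h5 : s * K c c ≤ -B := by
      have := le_abs_self (K c c)
      nlinarith
    nlinarith
  refine ⟨hB, ?_⟩
  have hsum : ∑ c, w c * ∑ d, K c d * w d = 0 := by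
    rw [← h0]
    refine Finset.sum_congr rfl fun c _ => ?_
    rw [Finset.mul_sum]
    exact Finset.sum_congr rfl fun d _ => by ring
  intro c
  exact (Finset.sum_eq_zero_iff_of_nonneg (fun c _ => mul_nonneg (hw c) (hB c))).1 hsum c (Finset.mem_univ _)
end TO

namespace TO

noncomputable def psi (h c : ℕ) : ℝ := (c:ℝ) * π / h

lemma psi_mem {h c : ℕ} (hc : c ≤ h) : psi h c ∈ Icc 0 π := by
  have hp := Real.pi_pos
  unfold psi
  refine ⟨by positivity, ?_⟩
  have : (c:ℝ) ≤ h := by exact_mod_cast hc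
  rcases Nat.eq_zero_or_pos h with h0 | h0
  · subst h0; simp; exact hp.le
  · rw [div_le_iff₀ (by positivity)]; nlinarith

lemma psi_le {h c : ℕ} : psi h c ≤ psi h (c+1) := by
  have hp := Real.pi_pos
  unfold psi
  gcongr; omega

lemma psi_sub {h : ℕ} (c : ℕ) : psi h (c+1) - psi h c = π / h := by
  unfold psi
  push_cast
  ring

lemma psi_self {h : ℕ} (hh : 0 < h) : psi h h = π := by
  unfold psi
  have : (h:ℝ) ≠ 0 := by positivity
  field_simp

lemma psi_div {h : ℕ} (c : ℕ) : psi h c / π = c / h := by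
  have hp := Real.pi_pos
  unfold psi
  field_simp

/-- Kernel of the quadratic form. -/
noncomputable def KK (h : ℕ) (C : ℝ) (A : ℕ → ℝ) (c d : ℕ) : ℝ :=
  C * (1 - ((max c d : ℕ) : ℝ) / h) - ∑' j, A j * (chi (psi h c) j * chi (psi h d) j)

/-- Fourier coefficients of the step function with jumps `w`. -/
noncomputable def FF (h : ℕ) (w : ℕ → ℝ) (j : ℕ) : ℝ := ∑ d ∈ Finset.range h, w d * chi (psi h d) j

noncomputable def TT (h : ℕ) (C : ℝ) (A w : ℕ → ℝ) (c : ℕ) : ℝ := π * ∑ d ∈ Finset.range h, KK h C A c d * w d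

section
variable {h : ℕ} (hh : 0 < h) {C : ℝ} {A w : ℕ → ℝ} (hA : Summable fun j => |A j|) (hw : ∀ a, 0 ≤ w a)

include hw in
lemma FF_abs (j : ℕ) : |FF h w j| ≤ FF h w 0 := by
  unfold FF
  refine (Finset.abs_sum_le_sum_abs _ _).trans (Finset.sum_le_sum fun d hd => ?_)
  rw [abs_mul, abs_of_nonneg (hw d), chi_zero]
  have := chi_abs (psi_mem (Finset.mem_range.1 hd).le) j
  have := hw d
  gcongr

include hA in
lemma KK_summable {x y : ℝ} (hx : x ∈ Icc 0 π) (hy : y ∈ Icc 0 π) : Summable fun j => A j * (chi x j * chi y j) := by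
  refine Summable.of_norm_bounded hA fun j => ?_
  rw [norm_mul, norm_mul]
  simp only [Real.norm_eq_abs]
  exact mul_le_of_le_one_right (abs_nonneg _) (mul_le_one₀ (chi_abs' hx j) (abs_nonneg _) (chi_abs' hy j))

include hA in
lemma TT_eq {c : ℕ} (hc : c ≤ h) : TT h C A w c =
    π * (C * ∑ d ∈ Finset.range h, w d * (1 - ((max c d : ℕ) : ℝ) / h) - ∑' j, (A j * FF h w j) * chi (psi h c) j) := by
  unfold TT KK
  congr 1
  simp only [sub_mul, Finset.sum_sub_distrib]
  congr 1
  · rw [Finset.mul_sum]; exact Finset.sum_congr rfl fun d _ => by ring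
  · have : ∀ d ∈ Finset.range h, Summable fun j => A j * (chi (psi h c) j * chi (psi h d) j) * w d :=
      fun d hd => (KK_summable hA (psi_mem hc) (psi_mem (Finset.mem_range.1 hd).le)).mul_right _
    simp only [← tsum_mul_right]
    rw [← Summable.tsum_finsetSum this]
    refine tsum_congr fun j => ?_
    unfold FF
    rw [Finset.mul_sum, Finset.sum_mul]
    exact Finset.sum_congr rfl fun d _ => by ring

/-- The smooth part. -/
noncomputable def gg (h : ℕ) (A w : ℕ → ℝ) (φ : ℝ) : ℝ := ∑' j : ℕ, (A j * FF h w j) * cos (j * φ)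

include hw hA in
lemma AF_summable : Summable fun j => |A j * FF h w j| := by
  refine Summable.of_norm_bounded (hA.mul_right (FF h w 0)) fun j => ?_
  rw [Real.norm_eq_abs, abs_abs, abs_mul]
  gcongr
  exact FF_abs hw j

include hw hA in
lemma gg_abs (φ : ℝ) : |gg h A w φ| ≤ (∑' j, |A j|) * FF h w 0 := by
  have h1 := AF_summable (h := h) hA hw
  rw [← tsum_mul_right]
  unfold gg
  rw [← Real.norm_eq_abs]
  refine tsum_of_norm_bounded (hA.mul_right _).hasSum fun j => ?_
  rw [norm_mul, norm_mul]
  simp only [Real.norm_eq_abs]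
  calc |A j| * |FF h w j| * |cos (j*φ)| ≤ |A j| * FF h w 0 * 1 := by
        gcongr
        · exact mul_nonneg (abs_nonneg _) ((abs_nonneg _).trans (FF_abs hw j))
        · exact FF_abs hw j
        · exact Real.abs_cos_le_one _
    _ = _ := by ring

include hh hA hw in
lemma TT_sub {a : ℕ} (ha : a < h) : TT h C A w a - TT h C A w (a+1) =
    (π/h) * C * ∑ d ∈ Finset.range (a+1), w d - ∫ φ in (psi h a)..(psi h (a+1)), gg h A w φ := by
  have hp := Real.pi_pos
  have hs := AF_summable (h := h) hA hw
  have hsum : ∀ c ≤ h, Summable fun j => (A j * FF h w j) * chi (psi h c) j := by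
    intro c hc
    refine Summable.of_norm_bounded hs fun j => ?_
    rw [norm_mul]
    exact mul_le_of_le_one_right (norm_nonneg _) (chi_abs' (psi_mem hc) j)
  rw [TT_eq hA ha.le, TT_eq hA ha, ← mul_sub, sub_sub_sub_comm, ← mul_sub]
  rw [← Finset.sum_sub_distrib, ← Summable.tsum_sub (hsum _ ha.le) (hsum _ ha)]
  unfold gg
  rw [← (series_int_one hs _ _).tsum_eq]
  have e1 : ∑ d ∈ Finset.range h, (w d * (1 - ((max a d : ℕ) : ℝ) / h) - w d * (1 - ((max (a+1) d : ℕ) : ℝ) / h))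
      = (1/h) * ∑ d ∈ Finset.range (a+1), w d := by
    have : ∀ d ∈ Finset.range h, (w d * (1 - ((max a d : ℕ) : ℝ) / h) - w d * (1 - ((max (a+1) d : ℕ) : ℝ) / h))
        = if d ∈ Finset.range (a+1) then (1/h) * w d else 0 := by
      intro d hd
      by_cases hda : d < a + 1
      · rw [if_pos (Finset.mem_range.2 hda), max_eq_left (by omega), max_eq_left (by omega)]
        push_cast; ring
      · rw [if_neg (by simpa using hda), max_eq_right (by omega), max_eq_right (by omega)]
        ring
    rw [Finset.sum_congr rfl this, Finset.sum_ite_mem, Finset.inter_eq_right.2, Finset.mul_sum]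
    intro d hd
    rw [Finset.mem_range] at *; omega
  rw [e1]
  have e2 : ∀ j, (A j * FF h w j) * chi (psi h a) j - (A j * FF h w j) * chi (psi h (a+1)) j
      = (1/π) * ((A j * FF h w j) * ∫ φ in (psi h a)..(psi h (a+1)), cos (j * φ)) := by
    intro j
    rw [← mul_sub, chi_sub]; ring
  simp only [e2, tsum_mul_left]
  field_simp

lemma sum_parts (x : ℕ → ℝ) (n : ℕ) : ∑ a ∈ Finset.range n, (∑ d ∈ Finset.range (a+1), w d) * (x a - x (a+1))
    + (∑ d ∈ Finset.range n, w d) * x n = ∑ a ∈ Finset.range n, w a * x a := by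
  induction n with
  | zero => simp
  | succ n ih =>
    rw [Finset.sum_range_succ, Finset.sum_range_succ _ n, Finset.sum_range_succ _ n, ← ih]
    ring

include hh hA hw in
lemma fourier_step (hF0 : FF h w 0 = 1) (j : ℕ) :
    |∑ a ∈ Finset.range h, ((TT h C A w a - TT h C A w (a+1)) * h / π) * (chi (psi h a) j - chi (psi h (a+1)) j)
      - (C - A j / wt j) * FF h w j| ≤ j * π * (2 * ∑' i, |A i|) / h := by
  have hp := Real.pi_pos
  have hh' : (0:ℝ) < h := by exact_mod_cast hh
  set S := ∑' i, |A i| with hS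
  have hs := AF_summable (h := h) hA hw
  have hgc : Continuous (gg h A w) := series_cont hs
  have hgb : ∀ φ, |gg h A w φ| ≤ S := fun φ => by
    have := gg_abs (h := h) hA hw φ; rwa [hF0, mul_one] at this
  have hg : ∫ φ in (0:ℝ)..π, gg h A w φ * cos (j * φ) = (A j * FF h w j) * (π / wt j) := series_int_cos hs j
  have hcells : ∫ φ in (0:ℝ)..π, gg h A w φ * cos (j * φ) =
      ∑ a ∈ Finset.range h, ∫ φ in (psi h a)..(psi h (a+1)), gg h A w φ * cos (j * φ) := by
    rw [intervalIntegral.sum_integral_adjacent_intervals (a := fun a => psi h a)]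
    · rw [psi_self hh]; simp [psi]
    · intro k _; exact Continuous.intervalIntegrable (by fun_prop) _ _
  have hCf : C * FF h w j = ∑ a ∈ Finset.range h, C * ((∑ d ∈ Finset.range (a+1), w d) * (chi (psi h a) j - chi (psi h (a+1)) j)) := by
    rw [← Finset.mul_sum]
    congr 1
    have := sum_parts (w := w) (fun a => chi (psi h a) j) h
    simp only [psi_self hh, chi_pi, mul_zero, add_zero] at this
    exact this.symm
  have hAF : A j / wt j * FF h w j = ∑ a ∈ Finset.range h, (1/π) * ∫ φ in (psi h a)..(psi h (a+1)), gg h A w φ * cos (j * φ) := by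
    rw [← Finset.mul_sum, ← hcells, hg]
    have := wt_pos j
    field_simp
  rw [sub_mul, hCf, hAF, ← Finset.sum_sub_distrib, ← Finset.sum_sub_distrib]
  have hcell : ∀ a ∈ Finset.range h, |((TT h C A w a - TT h C A w (a+1)) * h / π) * (chi (psi h a) j - chi (psi h (a+1)) j) -
      (C * ((∑ d ∈ Finset.range (a+1), w d) * (chi (psi h a) j - chi (psi h (a+1)) j)) -
        (1/π) * ∫ φ in (psi h a)..(psi h (a+1)), gg h A w φ * cos (j * φ))| ≤ j * π * (2 * S) / h / h := by
    intro a ha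
    have ha' := Finset.mem_range.1 ha
    rw [TT_sub hh hA hw ha']
    set γ := ∫ φ in (psi h a)..(psi h (a+1)), gg h A w φ with hγ
    set x := psi h a with hx
    set y := psi h (a+1) with hy
    have hxy : y - x = π / h := psi_sub a
    have hle : x ≤ y := psi_le
    have key : ∫ φ in x..y, (gg h A w φ - γ * h / π) * (cos (j * φ) - cos (j * x)) =
        (∫ φ in x..y, gg h A w φ * cos (j * φ)) - γ * h / π * ∫ φ in x..y, cos (j * φ) := by
      have e : ∀ φ : ℝ, (gg h A w φ - γ * h / π) * (cos (j * φ) - cos (j * x)) =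
        gg h A w φ * cos (j * φ) - γ * h / π * cos (j * φ) - (cos (j*x) * gg h A w φ - cos (j*x) * (γ * h / π)) := fun φ => by ring
      simp only [e]
      rw [intervalIntegral.integral_sub, intervalIntegral.integral_sub, intervalIntegral.integral_sub,
        intervalIntegral.integral_const_mul, intervalIntegral.integral_const_mul, intervalIntegral.integral_const, ← hγ, hxy, smul_eq_mul]
      · field_simp; ring
      all_goals exact Continuous.intervalIntegrable (by fun_prop) _ _
    have hγb : |γ| ≤ S * (π / h) := by
      have := intervalIntegral.norm_integral_le_of_norm_le_const (a := x) (b := y) (C := S) (f := gg h A w) (fun φ _ => hgb φ)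
      rwa [Real.norm_eq_abs, abs_of_nonneg (a := y - x) (by linarith), hxy] at this
    have hbd : |∫ φ in x..y, (gg h A w φ - γ * h / π) * (cos (j * φ) - cos (j * x))| ≤ (2 * S) * (j * (π/h)) * (π / h) := by
      have := intervalIntegral.norm_integral_le_of_norm_le_const (a := x) (b := y) (C := (2 * S) * (j * (π/h)))
        (f := fun φ => (gg h A w φ - γ * h / π) * (cos (j * φ) - cos (j * x))) ?_
      · rwa [Real.norm_eq_abs, abs_of_nonneg (a := y - x) (by linarith), hxy] at this
      · intro φ hφ
        rw [uIoc_of_le hle] at hφ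
        rw [norm_mul, Real.norm_eq_abs, Real.norm_eq_abs]
        have b1 : |gg h A w φ - γ * h / π| ≤ 2 * S := by
          have : |γ * h / π| ≤ S := by
            rw [abs_div, abs_mul, abs_of_pos hh', abs_of_pos hp, div_le_iff₀ hp]
            calc |γ| * h ≤ S * (π/h) * h := by gcongr
              _ = S * π := by field_simp
          calc _ ≤ |gg h A w φ| + |γ * h / π| := abs_sub _ _
            _ ≤ _ := by linarith [hgb φ]
        have b2 : |cos (j * φ) - cos (j * x)| ≤ j * (π/h) := by
          refine (Real.abs_cos_sub_cos_le _ _).trans ?_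
          rw [← mul_sub, abs_mul, Nat.abs_cast, ← hxy]
          gcongr
          rw [abs_of_nonneg (by linarith [hφ.1])]
          linarith [hφ.2]
        have : 0 ≤ S := (abs_nonneg _).trans (hgb 0)
        gcongr
    rw [key] at hbd
    rw [chi_sub]
    have : ((π / h * C * ∑ d ∈ Finset.range (a+1), w d - γ) * h / π) * (1/π * ∫ φ in x..y, cos (j * φ)) -
      (C * ((∑ d ∈ Finset.range (a+1), w d) * (1/π * ∫ φ in x..y, cos (j * φ))) - (1/π) * ∫ φ in x..y, gg h A w φ * cos (j * φ))
      = (1/π) * ((∫ φ in x..y, gg h A w φ * cos (j * φ)) - γ * h / π * ∫ φ in x..y, cos (j * φ)) := by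
      field_simp
      ring
    rw [this, abs_mul, abs_of_pos (by positivity : (0:ℝ) < 1/π)]
    calc _ ≤ 1/π * ((2 * S) * (j * (π/h)) * (π / h)) := by gcongr
      _ = _ := by field_simp
  refine (Finset.abs_sum_le_sum_abs _ _).trans ((Finset.sum_le_sum hcell).trans ?_)
  rw [Finset.sum_const, Finset.card_range, nsmul_eq_mul]
  apply le_of_eq; field_simp
end
end TO

namespace TO
section
variable {h : ℕ} (hh : 0 < h) {C : ℝ} {A w : ℕ → ℝ} (hA : Summable fun j => |A j|) (hw : ∀ a, 0 ≤ w a)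

include hA in
lemma gg_eq (φ : ℝ) : gg h A w φ = ∑ d ∈ Finset.range h, w d * ∑' j : ℕ, A j * chi (psi h d) j * cos (j * φ) := by
  unfold gg
  have hs : ∀ d ∈ Finset.range h, Summable fun j : ℕ => w d * (A j * chi (psi h d) j * cos (j * φ)) := by
    intro d hd
    apply Summable.mul_left
    refine Summable.of_norm_bounded hA fun j => ?_
    rw [norm_mul, norm_mul]
    simp only [Real.norm_eq_abs]
    rw [mul_assoc]
    exact mul_le_of_le_one_right (abs_nonneg _) (mul_le_one₀ (chi_abs' (psi_mem (Finset.mem_range.1 hd).le) j) (abs_nonneg _) (Real.abs_cos_le_one _))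
  simp only [← tsum_mul_left]
  rw [← Summable.tsum_finsetSum hs]
  refine tsum_congr fun j => ?_
  unfold FF
  rw [Finset.mul_sum, Finset.sum_mul]
  exact Finset.sum_congr rfl fun d _ => by ring

include hh in
lemma TT_last : TT h C A w h = 0 := by
  unfold TT KK
  have hh' : (h:ℝ) ≠ 0 := by positivity
  rw [Finset.sum_eq_zero, mul_zero]
  intro d hd
  rw [max_eq_left (Finset.mem_range.1 hd).le, psi_self hh, div_self hh']
  simp [chi_pi]

include hA in
lemma TT_zero : TT h C A w 0 = π * ((C - A 0) * FF h w 0) := by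
  rw [TT_eq hA (Nat.zero_le _), tsum_eq_single 0]
  · unfold FF
    simp only [psi, chi_zero, Nat.zero_max]
    have hp := Real.pi_ne_zero
    have : ∀ d : ℕ, (d:ℝ) * π / h / π = d / h := fun d => by field_simp
    simp only [this]
    simp; ring
  · intro j hj
    simp [psi, chi_at_zero hj]

include hh hA hw in
theorem struct (hF0 : FF h w 0 = 1) (hT : ∀ c < h, 0 ≤ TT h C A w c) (hcomp : ∀ c < h, w c * TT h C A w c = 0)
    (hCA : A 0 < C)
    (hmono : ∀ d < h, MonotoneOn (fun φ : ℝ => ∑' j : ℕ, A j * chi (psi h d) j * cos (j * φ)) (Icc 0 π))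
    {B : ℝ} (hB : ∀ d < h, -(B * (1 - (d:ℝ)/h)) ≤ ∑' j : ℕ, A j * chi (psi h d) j) :
    ∃ c, 0 < c ∧ c < h ∧ (∀ a < c, w a = 0) ∧ ∃ r : ℕ → ℝ, Antitone r ∧ (∀ a, 0 ≤ r a) ∧ (∀ a, r a ≤ B) ∧
      (∀ a, c ≤ a → r a = 0) ∧ ∀ j : ℕ, |∑ a ∈ Finset.range h, r a * (chi (psi h a) j - chi (psi h (a+1)) j)
      - (C - A j / wt j) * FF h w j| ≤ j * π * (2 * ∑' i, |A i|) / h := by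
  have hp := Real.pi_pos
  have hh' : (0:ℝ) < h := by exact_mod_cast hh
  have hgc : Continuous (gg h A w) := series_cont (AF_summable (h := h) hA hw)
  have hgm : MonotoneOn (gg h A w) (Icc 0 π) := by
    intro x hx y hy hxy
    rw [gg_eq hA, gg_eq hA]
    refine Finset.sum_le_sum fun d hd => mul_le_mul_of_nonneg_left ?_ (hw d)
    exact hmono d (Finset.mem_range.1 hd) hx hy hxy
  have hT0 : 0 < TT h C A w 0 := by
    rw [TT_zero hA, hF0]
    have : 0 < C - A 0 := by linarith
    positivity
  have hne : ∃ a < h, 0 < w a := by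
    by_contra hcon
    push Not at hcon
    have : FF h w 0 = 0 := Finset.sum_eq_zero fun d hd => by
      rw [le_antisymm (hcon d (Finset.mem_range.1 hd)) (hw d), zero_mul]
    rw [hF0] at this; norm_num at this
  obtain ⟨c, hc0, hch, hwc, hcons, hanti, hlast⟩ := kkt_struct h (TT h C A w) w (by
      intro a ha
      rcases ha.lt_or_eq with h1 | h1
      · exact hT a h1
      · rw [h1, TT_last hh]) (TT_last hh) hT0 hw hcomp hne (by
      intro a ha hwa
      rw [TT_sub hh hA hw (by omega : a < h), show a + 2 = (a+1)+1 from rfl, TT_sub hh hA hw ha]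
      rw [Finset.sum_range_succ _ (a+1), hwa, add_zero]
      have e : ∫ φ in (psi h (a+1))..(psi h (a+1+1)), gg h A w φ = ∫ φ in (psi h a)..(psi h (a+1)), gg h A w (φ + π/h) := by
        rw [intervalIntegral.integral_comp_add_right]
        congr 1 <;> linarith [psi_sub (h := h) a, psi_sub (h := h) (a+1)]
      rw [e]
      have : ∫ φ in (psi h a)..(psi h (a+1)), gg h A w φ ≤ ∫ φ in (psi h a)..(psi h (a+1)), gg h A w (φ + π/h) := by
        apply intervalIntegral.integral_mono_on psi_le (hgc.intervalIntegrable _ _) (Continuous.intervalIntegrable (by fun_prop) _ _)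
        intro x hx
        have h1 := psi_mem (h := h) (c := a) (by omega)
        have h2 := psi_mem (h := h) (c := a+2) (by omega)
        have h3 := psi_sub (h := h) a
        have h4 : psi h (a+2) - psi h (a+1) = π / h := psi_sub (h := h) (a+1)
        have h5 : 0 < π / h := by positivity
        exact hgm ⟨by linarith [hx.1, h1.1], by linarith [hx.2, h2.2]⟩ ⟨by linarith [hx.1, h1.1], by linarith [hx.2, h2.2]⟩ (by linarith)
      linarith)
  have hw0 : w 0 = 0 := hwc 0 hc0
  have hB0 : (TT h C A w 0 - TT h C A w 1) * h / π ≤ B := by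
    have e := TT_sub (C := C) hh hA hw (a := 0) hh
    rw [zero_add] at e
    rw [e]
    simp only [Finset.sum_range_one, hw0, mul_zero, zero_sub]
    have hg0 : -B ≤ gg h A w 0 := by
      rw [gg_eq hA]
      simp only [mul_zero, cos_zero, mul_one]
      calc -B = ∑ d ∈ Finset.range h, w d * -(B * (1 - (d:ℝ)/h)) := by
            have : FF h w 0 = ∑ d ∈ Finset.range h, w d * (1 - (d:ℝ)/h) := by
              unfold FF; simp only [chi_zero, psi_div]
            rw [hF0] at this
            have e2 : ∀ d : ℕ, w d * -(B * (1 - (d:ℝ)/h)) = -B * (w d * (1 - (d:ℝ)/h)) := fun d => by ring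
            simp only [e2]
            rw [← Finset.mul_sum, ← this, mul_one]
        _ ≤ _ := Finset.sum_le_sum fun d hd => mul_le_mul_of_nonneg_left (hB d (Finset.mem_range.1 hd)) (hw d)
    have hx0 : psi h 0 = 0 := by simp [psi]
    have hx1 : psi h 1 = π / h := by simp [psi]
    have hlow : (π/h) * -B ≤ ∫ φ in (psi h 0)..(psi h 1), gg h A w φ := by
      have := intervalIntegral.integral_mono_on (μ := MeasureTheory.volume) (a := psi h 0) (b := psi h 1) (f := fun _ => -B) (g := gg h A w) psi_le (by simp) (hgc.intervalIntegrable _ _) (by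
        intro x hx
        have h2 := psi_mem (h := h) (c := 1) (by omega)
        rw [hx0] at hx
        exact hg0.trans (hgm ⟨le_rfl, hp.le⟩ ⟨hx.1, hx.2.trans h2.2⟩ hx.1))
      rw [intervalIntegral.integral_const, smul_eq_mul, hx0, hx1, sub_zero] at this
      rw [hx0, hx1]
      exact this
    rw [div_le_iff₀ hp]
    have : B * π = (π / h * B) * h := by field_simp
    rw [this]
    exact mul_le_mul_of_nonneg_right (by linarith) hh'.le
  set r : ℕ → ℝ := fun a => if a < c then (TT h C A w a - TT h C A w (a+1)) * h / π else 0 with hr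
  have hpos' : ∀ i, i < c → 0 ≤ TT h C A w (c-1-i) - TT h C A w (c-1-i+1) := by
    intro i
    induction i with
    | zero => intro _; rw [show c - 1 - 0 + 1 = c by omega]; exact hlast
    | succ i ih =>
      intro hi
      have h1 := ih (by omega)
      have h2 := hanti (c-1-(i+1)) (by omega)
      rw [show c - 1 - (i+1) + 2 = c-1-i+1 by omega, show c - 1 - (i+1) + 1 = c-1-i by omega] at h2
      rw [show c - 1 - (i+1) + 1 = c-1-i by omega]
      linarith
  have hr0 : ∀ a, 0 ≤ r a := by
    intro a
    simp only [hr]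
    split_ifs with ha
    · have := hpos' (c-1-a) (by omega)
      rw [show c-1-(c-1-a) = a by omega] at this
      positivity
    · exact le_rfl
  have hra : Antitone r := by
    apply antitone_nat_of_succ_le
    intro a
    by_cases ha : a + 1 < c
    · simp only [hr]
      rw [if_pos ha, if_pos (by omega)]
      have := hanti a ha
      gcongr
    · have : r (a+1) = 0 := by simp only [hr]; rw [if_neg ha]
      rw [this]; exact hr0 a
  refine ⟨c, hc0, hch, hwc, r, hra, hr0, ?_, ?_, ?_⟩
  · intro a
    refine (hra (Nat.zero_le a)).trans ?_
    simp only [hr]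
    rw [if_pos hc0]; exact hB0
  · intro a ha
    simp only [hr]; rw [if_neg (by omega)]
  · intro j
    have := fourier_step (C := C) hh hA hw hF0 j
    have e : ∀ a ∈ Finset.range h, r a = (TT h C A w a - TT h C A w (a+1)) * h / π := by
      intro a ha
      simp only [hr]
      split_ifs with h1
      · rfl
      · rw [hcons a (by omega) (Finset.mem_range.1 ha)]; simp
    rw [Finset.sum_congr rfl (fun a ha => by rw [e a ha])]
    exact this
end
end TO

namespace TO

noncomputable def CC (m : ℕ) (t : ℝ) : ℝ := m / (1 - t)

noncomputable def AA (m : ℕ) (μ t : ℝ) (j : ℕ) : ℝ :=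
  if j = 0 then CC m t - cc μ 0 else 2 * (t^j * (CC m t + (((j*m:ℕ):ℝ) - cc μ (j*m))))

section
variable {m : ℕ} {μ : ℝ} (h1 : (m:ℝ) < μ) (h2 : μ < m + 1) (hodd : Odd m) {t : ℝ} (ht : 0 < t) (ht1 : t < 1)

lemma AA_zero : AA m μ t 0 = CC m t - cc μ 0 := by simp [AA]

lemma AA_succ (i : ℕ) : AA m μ t (i+1) = 2 * (t^(i+1) * (CC m t + ((((i+1)*m:ℕ):ℝ) - cc μ ((i+1)*m)))) := by
  simp [AA]

include ht1 in
lemma CC_nonneg : 0 ≤ CC m t := div_nonneg (Nat.cast_nonneg _) (by linarith)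

include h1 h2 ht1 in
lemma CM_Ce : CM (fun i => CC m t + ((((i+1)*m:ℕ):ℝ) - cc μ ((i+1)*m))) :=
  CM.add _ _ (CM.const (CC_nonneg ht1)) (CM_e h1 h2)

include h1 h2 ht ht1 in
lemma AA_bound (i : ℕ) : 0 ≤ AA m μ t (i+1) ∧ AA m μ t (i+1) ≤ 2 * (CC m t + ((m:ℝ) - cc μ m)) * t^(i+1) := by
  have a := (CM_Ce h1 h2 ht1).nonneg i
  have b := (CM_Ce h1 h2 ht1).le_zero i
  simp only [zero_add, one_mul] at a b
  rw [AA_succ]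
  have ht' : 0 < t^(i+1) := by positivity
  constructor
  · positivity
  · nlinarith

include h1 h2 ht ht1 in
lemma AA_summable : Summable fun j => |AA m μ t j| := by
  rw [← summable_nat_add_iff 1]
  refine Summable.of_nonneg_of_le (fun i => abs_nonneg _) (fun i => ?_)
    (((summable_nat_add_iff 1).2 (summable_geometric_of_lt_one ht.le ht1)).mul_left (2 * (CC m t + ((m:ℝ) - cc μ m))))
  have := AA_bound h1 h2 ht ht1 i
  rw [abs_of_nonneg this.1]; exact this.2

/-- regularised multiplier -/
noncomputable def ct (m : ℕ) (μ t : ℝ) (j : ℕ) : ℝ := CC m t - AA m μ t j / wt j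

lemma ct_zero : ct m μ t 0 = cc μ 0 := by simp [ct, AA_zero, wt]

lemma ct_succ {j : ℕ} (hj : j ≠ 0) : ct m μ t j = CC m t - t^j * (CC m t + (((j*m:ℕ):ℝ) - cc μ (j*m))) := by
  simp [ct, AA, wt, hj]

include ht1 in
lemma ct_geom {j : ℕ} (hj : j ≠ 0) : ct m μ t j = m * ∑ i ∈ Finset.range j, t^i - t^j * (((j*m:ℕ):ℝ) - cc μ (j*m)) := by
  rw [ct_succ hj, geom_sum_eq ht1.ne]
  have : 1 - t ≠ 0 := by linarith
  have : t - 1 ≠ 0 := by linarith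
  unfold CC
  field_simp
  ring

include ht1 in
lemma ct_one : ct m μ t 1 = m * (1 - t) + t * cc μ m := by
  rw [ct_geom ht1 one_ne_zero]
  simp; ring

include ht ht1 in
lemma ct_ge {j : ℕ} (hj : j ≠ 0) : t^j * cc μ (j*m) ≤ ct m μ t j := by
  rw [ct_geom ht1 hj]
  have : (j:ℝ) * t^j ≤ ∑ i ∈ Finset.range j, t^i := by
    calc (j:ℝ) * t^j = ∑ i ∈ Finset.range j, t^j := by simp
      _ ≤ _ := Finset.sum_le_sum fun i hi => pow_le_pow_of_le_one ht.le ht1.le (Finset.mem_range.1 hi).le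
  have hm : (0:ℝ) ≤ m := Nat.cast_nonneg m
  push_cast
  nlinarith

include h1 h2 hodd ht ht1 in
lemma ct_pos {j : ℕ} (hj : j ≠ 1) : 0 < ct m μ t j := by
  rcases Nat.eq_zero_or_pos j with h0 | h0
  · rw [h0, ct_zero]; exact cc_zero_pos h1 h2 hodd
  · have : m + 1 ≤ j * m := by
      have := hodd.pos
      nlinarith [show 2 ≤ j by omega]
    have := cc_pos h1 h2 this
    exact lt_of_lt_of_le (by positivity) (ct_ge ht ht1 h0.ne')

include h1 h2 ht ht1 in
lemma AA_mono {x : ℝ} (hx : x ∈ Icc 0 π) :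
    MonotoneOn (fun φ : ℝ => ∑' j : ℕ, AA m μ t j * chi x j * cos (j * φ)) (Icc 0 π) := by
  have hp := Real.pi_pos
  have hA := AA_summable h1 h2 ht ht1
  have hder : ∀ φ : ℝ, HasDerivAt (fun φ : ℝ => ∑' j : ℕ, AA m μ t j * chi x j * cos (j * φ))
      (∑' j : ℕ, AA m μ t j * chi x j * (-sin (j * φ) * j)) φ := by
    intro φ
    refine hasDerivAt_tsum (u := fun j => |AA m μ t j|) hA (g := fun (j:ℕ) (φ:ℝ) => AA m μ t j * chi x j * cos (j * φ)) (g' := fun (j:ℕ) (φ:ℝ) => AA m μ t j * chi x j * (-sin (j * φ) * j)) (fun j φ => ?_) (fun j φ => ?_) (y₀ := 0) ?_ φ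
    · have := ((hasDerivAt_id φ).const_mul (j:ℝ)).cos.const_mul (AA m μ t j * chi x j)
      simpa using this
    · rw [norm_mul, norm_mul, Real.norm_eq_abs, mul_assoc]
      apply mul_le_of_le_one_right (abs_nonneg _)
      rcases Nat.eq_zero_or_pos j with h0 | h0
      · subst h0; simp
      · have hj : (0:ℝ) < j := by exact_mod_cast h0
        rw [chi_succ _ h0.ne', Real.norm_eq_abs, Real.norm_eq_abs, ← abs_mul]
        have : -sin (j * x) / (j * π) * (-sin (j * φ) * j) = sin (j*x) * sin (j*φ) / π := by field_simp
        rw [this, abs_div, abs_mul, abs_of_pos hp, div_le_one hp]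
        calc _ ≤ 1 := mul_le_one₀ (Real.abs_sin_le_one _) (abs_nonneg _) (Real.abs_sin_le_one _)
          _ ≤ π := by linarith [Real.pi_gt_three]
    · simp only [mul_zero, cos_zero, mul_one]
      refine Summable.of_norm_bounded hA fun j => ?_
      rw [norm_mul]
      exact mul_le_of_le_one_right (abs_nonneg _) (chi_abs' hx j)
  refine monotoneOn_of_deriv_nonneg (convex_Icc _ _) (fun φ _ => (hder φ).continuousAt.continuousWithinAt)
    (fun φ _ => (hder φ).differentiableAt.differentiableWithinAt) ?_
  intro φ hφ
  rw [(hder φ).deriv]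
  have hφ' : φ ∈ Icc 0 π := interior_subset hφ
  have key := (CM_Ce (t := t) h1 h2 ht1).K1 ht.le ht1 hφ' hx
  have : ∑' j : ℕ, AA m μ t j * chi x j * (-sin (j * φ) * j) = (2/π) * ∑' i : ℕ, (CC m t + ((((i+1)*m:ℕ):ℝ) - cc μ ((i+1)*m))) * (t^(i+1) * (sin (((i+1:ℕ):ℝ) * φ) * sin (((i+1:ℕ):ℝ) * x))) := by
    rw [← tsum_mul_left, ← Function.Injective.tsum_eq (g := fun i : ℕ => i + 1) (add_left_injective 1)]
    · refine tsum_congr fun i => ?_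
      have : ((i+1:ℕ):ℝ) ≠ 0 := by positivity
      rw [AA_succ, chi_succ _ (Nat.succ_ne_zero i)]
      field_simp
    · intro j hj
      rcases j with _ | j
      · simp at hj
      · exact ⟨j, rfl⟩
  rw [this]
  positivity

include h1 h2 ht ht1 in
lemma AA_lower {x : ℝ} (hx : x ∈ Icc 0 π) :
    -((cc μ 0 + 2 * ((m:ℝ) - cc μ m)) * (1 - x/π)) ≤ ∑' j : ℕ, AA m μ t j * chi x j := by
  have hp := Real.pi_pos
  have hA := AA_summable h1 h2 ht ht1
  have hG : ∀ φ : ℝ, -(cc μ 0 + 2 * ((m:ℝ) - cc μ m)) ≤ ∑' j : ℕ, AA m μ t j * cos (j * φ) := by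
    intro φ
    rw [(series_summable hA φ).tsum_eq_zero_add]
    have he := CM.K2 (CM_e h1 h2) ht.le ht1 φ
    have hes := (CM.func (s := fun i => cos (((i+1:ℕ):ℝ) * φ)) (D := 1) (t := t) (fun i => Real.abs_cos_le_one _) ht.le ht1
      (fun r hr hr1 => by simpa using CM.K2 (CM.geom 1 r zero_le_one hr hr1) ht.le ht1 φ) (CM_e h1 h2)).1
    have hP := (poisson ht.le ht1 φ).mul_left (2 * CC m t * t)
    have : ∑' i : ℕ, AA m μ t (i+1) * cos (((i+1:ℕ):ℝ) * φ) = 2 * CC m t * t * ((cos φ - t) / (1 - 2*t*cos φ + t^2))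
       + 2 * ∑' i : ℕ, ((((i+1)*m:ℕ):ℝ) - cc μ ((i+1)*m)) * (t^(i+1) * cos (((i+1:ℕ):ℝ) * φ)) := by
      rw [← hP.tsum_eq, ← tsum_mul_left, ← hP.summable.tsum_add (hes.mul_left 2)]
      refine tsum_congr fun i => ?_
      rw [AA_succ]; ring
    rw [this, AA_zero]
    simp only [Nat.cast_zero, zero_mul, cos_zero, mul_one, zero_add, one_mul] at he ⊢
    have hd := poisson_den ht.le ht1 φ
    have hC : 0 ≤ CC m t := CC_nonneg ht1
    have : 0 ≤ CC m t + 2 * CC m t * t * ((cos φ - t) / (1 - 2*t*cos φ + t^2)) := by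
      have : CC m t + 2 * CC m t * t * ((cos φ - t) / (1 - 2*t*cos φ + t^2)) = CC m t * ((1 - t^2) / (1 - 2*t*cos φ + t^2)) := by
        field_simp; ring
      rw [this]
      have : 0 ≤ 1 - t^2 := by nlinarith
      positivity
    linarith
  have hs := (series_int_one hA x π).mul_left (1/π)
  have e : ∑' j : ℕ, AA m μ t j * chi x j = 1/π * ∫ φ in x..π, ∑' j : ℕ, AA m μ t j * cos (j * φ) := by
    rw [← hs.tsum_eq]
    refine tsum_congr fun j => ?_
    unfold chi; ring
  rw [e]
  have := intervalIntegral.integral_mono_on (μ := MeasureTheory.volume) (a := x) (b := π) (f := fun _ => -(cc μ 0 + 2 * ((m:ℝ) - cc μ m)))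
    (g := fun φ => ∑' j : ℕ, AA m μ t j * cos (j * φ)) hx.2 (by simp) ((series_cont hA).intervalIntegrable _ _) (fun φ _ => hG φ)
  rw [intervalIntegral.integral_const, smul_eq_mul] at this
  rw [one_div, inv_mul_eq_div, le_div_iff₀ hp]
  calc _ = (π - x) * -(cc μ 0 + 2 * ((m:ℝ) - cc μ m)) := by field_simp
    _ ≤ _ := this
end
end TO

namespace TO

noncomputable def ff (h : ℕ) (w : ℕ → ℝ) (φ : ℝ) : ℝ := ∑ d ∈ Finset.range h, w d * (if psi h d < φ then 1 else 0)
noncomputable def NN (h : ℕ) (w : ℕ → ℝ) : ℝ :=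
  ∑ c ∈ Finset.range h, ∑ d ∈ Finset.range h, w c * w d * (1 - ((max c d : ℕ):ℝ)/h)
noncomputable def QQ (h : ℕ) (C : ℝ) (A w : ℕ → ℝ) : ℝ :=
  ∑ c ∈ Finset.range h, ∑ d ∈ Finset.range h, w c * w d * KK h C A c d

lemma ii_sum {ι : Type*} {f : ι → ℝ → ℝ} {a b : ℝ} (s : Finset ι) (hi : ∀ i ∈ s, IntervalIntegrable (f i) MeasureTheory.volume a b) :
    IntervalIntegrable (fun φ => ∑ i ∈ s, f i φ) MeasureTheory.volume a b := by
  have e : (fun φ => ∑ i ∈ s, f i φ) = ∑ i ∈ s, f i := by funext; simp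
  rw [e]; exact IntervalIntegrable.sum s hi

section
variable {h : ℕ} (hh : 0 < h) {C : ℝ} {A w : ℕ → ℝ} (hA : Summable fun j => |A j|)

include hA in
lemma QQ_eq : HasSum (fun j => A j * (FF h w j)^2) (C * NN h w - QQ h C A w) := by
  have hs : ∀ c ∈ Finset.range h, ∀ d ∈ Finset.range h, HasSum (fun j => w c * w d * (A j * (chi (psi h c) j * chi (psi h d) j)))
      (w c * w d * ∑' j, A j * (chi (psi h c) j * chi (psi h d) j)) := fun c hc d hd =>
    (KK_summable hA (psi_mem (Finset.mem_range.1 hc).le) (psi_mem (Finset.mem_range.1 hd).le)).hasSum.mul_left _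
  have h2 := hasSum_sum (fun c hc => hasSum_sum (fun d hd => hs c hc d hd))
  have e1 : ∑ c ∈ Finset.range h, ∑ d ∈ Finset.range h, w c * w d * ∑' j, A j * (chi (psi h c) j * chi (psi h d) j)
      = C * NN h w - QQ h C A w := by
    unfold NN QQ
    rw [Finset.mul_sum, ← Finset.sum_sub_distrib]
    refine Finset.sum_congr rfl fun c _ => ?_
    rw [Finset.mul_sum, ← Finset.sum_sub_distrib]
    refine Finset.sum_congr rfl fun d _ => ?_
    unfold KK; ring
  rw [e1] at h2
  have e2 : (fun j => A j * (FF h w j)^2) = fun j => ∑ c ∈ Finset.range h, ∑ d ∈ Finset.range h, w c * w d * (A j * (chi (psi h c) j * chi (psi h d) j)) := by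
    funext j
    unfold FF
    rw [sq, Finset.sum_mul_sum, Finset.mul_sum]
    refine Finset.sum_congr rfl fun c _ => ?_
    rw [Finset.mul_sum]
    exact Finset.sum_congr rfl fun d _ => by ring
  rw [e2]; exact h2

lemma ff_int {η : ℝ → ℝ} (hη : Continuous η) :
    IntervalIntegrable (fun φ => ff h w φ * η φ) MeasureTheory.volume 0 π ∧
    ∫ φ in (0:ℝ)..π, ff h w φ * η φ = ∑ d ∈ Finset.range h, w d * ∫ φ in (psi h d)..π, η φ := by
  have e : (fun φ => ff h w φ * η φ) = fun φ => ∑ d ∈ Finset.range h, w d * (if psi h d < φ then η φ else 0) := by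
    funext φ
    unfold ff
    rw [Finset.sum_mul]
    refine Finset.sum_congr rfl fun d _ => ?_
    split_ifs <;> ring
  have hi : ∀ d ∈ Finset.range h, IntervalIntegrable (fun φ => w d * (if psi h d < φ then η φ else 0)) MeasureTheory.volume 0 π :=
    fun d hd => (int_ind (psi_mem (Finset.mem_range.1 hd).le) hη).2.const_mul _
  rw [e]
  constructor
  · exact ii_sum _ hi
  · rw [intervalIntegral.integral_finsetSum hi]
    refine Finset.sum_congr rfl fun d hd => ?_
    rw [intervalIntegral.integral_const_mul, (int_ind (psi_mem (Finset.mem_range.1 hd).le) hη).1]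

lemma ff_int_cos (j : ℕ) : ∫ φ in (0:ℝ)..π, ff h w φ * cos (j * φ) = π * FF h w j := by
  have hp := Real.pi_pos
  rw [(ff_int (by fun_prop)).2]
  unfold FF chi
  rw [Finset.mul_sum]
  exact Finset.sum_congr rfl fun d _ => by field_simp

lemma ff_sq : IntervalIntegrable (fun φ => ff h w φ * ff h w φ) MeasureTheory.volume 0 π ∧
    ∫ φ in (0:ℝ)..π, ff h w φ * ff h w φ = π * NN h w := by
  have hp := Real.pi_pos
  have e : (fun φ => ff h w φ * ff h w φ) = fun φ => ∑ c ∈ Finset.range h, ∑ d ∈ Finset.range h, w c * w d * (if psi h (max c d) < φ then 1 else 0) := by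
    funext φ
    unfold ff
    rw [Finset.sum_mul_sum]
    refine Finset.sum_congr rfl fun c _ => Finset.sum_congr rfl fun d _ => ?_
    have hm : Monotone (psi h) := monotone_nat_of_le_succ fun n => psi_le
    have : psi h (max c d) < φ ↔ psi h c < φ ∧ psi h d < φ := by
      rw [hm.map_max, max_lt_iff]
    simp only [this]
    split_ifs <;> simp_all
  have hlt : ∀ c ∈ Finset.range h, ∀ d ∈ Finset.range h, max c d ≤ h := fun c hc d hd =>
    max_le (Finset.mem_range.1 hc).le (Finset.mem_range.1 hd).le
  have hi : ∀ c ∈ Finset.range h, ∀ d ∈ Finset.range h, IntervalIntegrable (fun φ => w c * w d * (if psi h (max c d) < φ then 1 else 0)) MeasureTheory.volume 0 π :=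
    fun c hc d hd => (int_ind (psi_mem (hlt c hc d hd)) (η := fun _ => 1) continuous_const).2.const_mul _
  have hi2 : ∀ c ∈ Finset.range h, IntervalIntegrable (fun φ => ∑ d ∈ Finset.range h, w c * w d * (if psi h (max c d) < φ then 1 else 0)) MeasureTheory.volume 0 π := by
    intro c hc
    exact ii_sum _ (hi c hc)
  rw [e]
  constructor
  · exact ii_sum _ hi2
  · rw [intervalIntegral.integral_finsetSum hi2]
    unfold NN
    rw [Finset.mul_sum]
    refine Finset.sum_congr rfl fun c hc => ?_
    rw [intervalIntegral.integral_finsetSum (hi c hc), Finset.mul_sum]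
    refine Finset.sum_congr rfl fun d hd => ?_
    rw [intervalIntegral.integral_const_mul, (int_ind (psi_mem (hlt c hc d hd)) (η := fun _ => 1) continuous_const).1,
      intervalIntegral.integral_const, smul_eq_mul, mul_one]
    have := psi_div (h := h) (max c d)
    rw [div_eq_iff hp.ne'] at this
    rw [this]; ring

lemma ff_dist (α : ℕ → ℝ) (n : ℕ) : ∫ φ in (0:ℝ)..π, (ff h w φ - ∑ j ∈ Finset.range n, α j * cos (j * φ))^2 =
    π * (NN h w - 2 * ∑ j ∈ Finset.range n, α j * FF h w j + ∑ j ∈ Finset.range n, (α j)^2 / wt j) := by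
  set s : ℝ → ℝ := fun φ => ∑ j ∈ Finset.range n, α j * cos (j * φ) with hs
  have hsc : Continuous s := by simp only [hs]; fun_prop
  have e : ∀ φ, (ff h w φ - s φ)^2 = ff h w φ * ff h w φ - ff h w φ * (2 * s φ) + s φ * s φ := fun φ => by ring
  change ∫ φ in (0:ℝ)..π, (ff h w φ - s φ)^2 = _
  simp only [e]
  have i1 : ∫ φ in (0:ℝ)..π, ff h w φ * (2 * s φ) = π * (2 * ∑ j ∈ Finset.range n, α j * FF h w j) := by
    have e2 : ∀ φ, ff h w φ * (2 * s φ) = ∑ j ∈ Finset.range n, 2 * α j * (ff h w φ * cos (j * φ)) := by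
      intro φ; simp only [hs]; rw [Finset.mul_sum, Finset.mul_sum]
      exact Finset.sum_congr rfl fun d _ => by ring
    simp only [e2]
    rw [intervalIntegral.integral_finsetSum (fun j _ => (ff_int (by fun_prop)).1.const_mul _), Finset.mul_sum, Finset.mul_sum]
    refine Finset.sum_congr rfl fun j _ => ?_
    rw [intervalIntegral.integral_const_mul, ff_int_cos]; ring
  have i2 : ∫ φ in (0:ℝ)..π, s φ * s φ = π * ∑ j ∈ Finset.range n, (α j)^2 / wt j := by
    have e2 : ∀ φ, s φ * s φ = ∑ j ∈ Finset.range n, ∑ k ∈ Finset.range n, α j * α k * (cos (j*φ) * cos (k * φ)) := by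
      intro φ; simp only [hs]; rw [Finset.sum_mul_sum]
      exact Finset.sum_congr rfl fun d _ => Finset.sum_congr rfl fun d _ => by ring
    simp only [e2]
    rw [intervalIntegral.integral_finsetSum (fun j _ => Continuous.intervalIntegrable (by fun_prop) _ _), Finset.mul_sum]
    refine Finset.sum_congr rfl fun j hj => ?_
    rw [intervalIntegral.integral_finsetSum (fun j _ => Continuous.intervalIntegrable (by fun_prop) _ _)]
    simp only [intervalIntegral.integral_const_mul, orth]
    simp only [mul_ite, mul_zero]
    rw [Finset.sum_ite_eq, if_pos hj]; ring
  rw [intervalIntegral.integral_add (ff_sq.1.sub (ff_int (by fun_prop)).1) (Continuous.intervalIntegrable (by fun_prop) _ _),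
    intervalIntegral.integral_sub ff_sq.1 (ff_int (by fun_prop)).1, i1, i2, ff_sq.2]
  ring

lemma bessel (n : ℕ) : ∑ j ∈ Finset.range n, wt j * (FF h w j)^2 ≤ NN h w := by
  have hp := Real.pi_pos
  have := ff_dist (h := h) (w := w) (fun j => wt j * FF h w j) n
  have h0 : 0 ≤ ∫ φ in (0:ℝ)..π, (ff h w φ - ∑ j ∈ Finset.range n, wt j * FF h w j * cos (j * φ))^2 :=
    intervalIntegral.integral_nonneg hp.le fun φ _ => sq_nonneg _
  rw [this] at h0
  have h1 := nonneg_of_mul_nonneg_right h0 hp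
  have e1 : ∑ j ∈ Finset.range n, wt j * FF h w j * FF h w j = ∑ j ∈ Finset.range n, wt j * (FF h w j)^2 :=
    Finset.sum_congr rfl fun j _ => by ring
  have e2 : ∑ j ∈ Finset.range n, (wt j * FF h w j)^2 / wt j = ∑ j ∈ Finset.range n, wt j * (FF h w j)^2 :=
    Finset.sum_congr rfl fun j _ => by have := wt_pos j; field_simp
  rw [e1, e2] at h1
  linarith
end
end TO

namespace TO

section
variable {m : ℕ} {μ : ℝ} (h1 : (m:ℝ) < μ) (h2 : μ < m + 1) (hodd : Odd m) {t : ℝ} (ht : 0 < t) (ht1 : t < 1) {h : ℕ} {w : ℕ → ℝ}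

lemma AA_wt (j : ℕ) : AA m μ t j = wt j * (CC m t - ct m μ t j) := by
  have := wt_pos j
  unfold ct; field_simp; ring

include h1 h2 hodd ht ht1 in
lemma Q_pos (hw : ∀ a, 0 ≤ w a) (hF0 : FF h w 0 = 1) (hc : 2 * (-cc μ m) < cc μ 0) : 0 < QQ h (CC m t) (AA m μ t) w := by
  have hA := AA_summable h1 h2 ht ht1
  have hS := (QQ_eq (h := h) (C := CC m t) (w := w) hA).tendsto_sum_nat
  have hC : 0 ≤ CC m t := CC_nonneg ht1
  have hb := cc_m_neg h1 h2
  have key : ∀ n ≥ 2, ∑ j ∈ Finset.range n, AA m μ t j * (FF h w j)^2 ≤ CC m t * NN h w - (cc μ 0 + 2 * cc μ m) := by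
    intro n hn
    have hB := mul_le_mul_of_nonneg_left (bessel (h := h) (w := w) n) hC
    rw [Finset.mul_sum] at hB
    have e : ∑ j ∈ Finset.range n, AA m μ t j * (FF h w j)^2 = ∑ j ∈ Finset.range n, CC m t * (wt j * (FF h w j)^2)
        - ∑ j ∈ Finset.range n, wt j * ct m μ t j * (FF h w j)^2 := by
      rw [← Finset.sum_sub_distrib]
      refine Finset.sum_congr rfl fun j _ => ?_
      rw [AA_wt]; ring
    have e2 : cc μ 0 + 2 * cc μ m ≤ ∑ j ∈ Finset.range n, wt j * ct m μ t j * (FF h w j)^2 := by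
      calc cc μ 0 + 2 * cc μ m ≤ ∑ j ∈ Finset.range 2, wt j * ct m μ t j * (FF h w j)^2 := by
            rw [Finset.sum_range_succ, Finset.sum_range_one, hF0, ct_zero, ct_one ht1]
            have hF1 : (FF h w 1)^2 ≤ 1 := by
              have := FF_abs (h := h) hw 1
              rw [hF0] at this
              rw [← sq_abs]
              exact pow_le_one₀ (abs_nonneg _) this
            have hm : (0:ℝ) ≤ m := Nat.cast_nonneg m
            have h3 : cc μ m ≤ m * (1-t) + t * cc μ m := by nlinarith
            simp only [wt, if_true, one_ne_zero, if_false]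
            have : cc μ m ≤ (m * (1-t) + t * cc μ m) * (FF h w 1)^2 := by
              nlinarith [sq_nonneg (FF h w 1)]
            linarith
        _ ≤ _ := by
            apply Finset.sum_le_sum_of_subset_of_nonneg (Finset.range_mono hn)
            intro j _ hj
            have hj' : j ≠ 1 := by rintro rfl; simp at hj
            have := ct_pos h1 h2 hodd ht ht1 hj'
            have := wt_pos j
            positivity
    linarith
  have := le_of_tendsto hS (eventually_atTop.2 ⟨2, key⟩)
  linarith

/-- Test vector. -/
noncomputable def wtest (h : ℕ) (d : ℕ) : ℝ := if d = 0 then 0 else cos (psi h (d-1)) - cos (psi h d)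

lemma wtest_nonneg (hh : 0 < h) {d : ℕ} (hd : d < h) : 0 ≤ wtest h d := by
  unfold wtest
  split_ifs with h0
  · exact le_rfl
  · have : psi h (d-1) ≤ psi h d := by
      have := psi_le (h := h) (c := d-1); rwa [Nat.sub_add_cancel (by omega)] at this
    have := Real.cos_le_cos_of_nonneg_of_le_pi (psi_mem (h := h) (c := d-1) (by omega)).1 (psi_mem hd.le).2 this
    linarith

lemma wtest_ff (hh : 0 < h) {φ : ℝ} (hφ : 0 < φ) (hφ' : φ ≤ π) : |ff h (wtest h) φ - (1 - cos φ)| ≤ π / h := by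
  have key : ∀ n, ∃ c ≤ n, psi h c < φ ∧ (c = n ∨ φ ≤ psi h (c+1)) ∧
      ∑ d ∈ Finset.range (n+1), wtest h d * (if psi h d < φ then 1 else 0) = 1 - cos (psi h c) := by
    intro n
    induction n with
    | zero =>
      refine ⟨0, le_rfl, by simpa [psi] using hφ, Or.inl rfl, by simp [wtest, psi]⟩
    | succ n ih =>
      obtain ⟨c, hc, hcφ, hor, hsum⟩ := ih
      by_cases hn : psi h (n+1) < φ
      · have hcn : c = n := by
          rcases hor with h3 | h3
          · exact h3
          · exfalso
            have hm : Monotone (psi h) := monotone_nat_of_le_succ fun n => psi_le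
            have := hm (show c + 1 ≤ n + 1 by omega)
            linarith
        subst hcn
        refine ⟨c+1, le_rfl, hn, Or.inl rfl, ?_⟩
        rw [Finset.sum_range_succ, hsum, if_pos hn]
        simp [wtest]
      · refine ⟨c, by omega, hcφ, Or.inr ?_, ?_⟩
        · rcases hor with h3 | h3
          · rw [h3]; linarith
          · exact h3
        · rw [Finset.sum_range_succ, hsum, if_neg hn]; ring
  obtain ⟨c, hc, hcφ, hor, hsum⟩ := key (h-1)
  rw [Nat.sub_add_cancel hh] at hsum
  unfold ff
  rw [hsum]
  have hle : φ ≤ psi h (c+1) := by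
    rcases hor with h3 | h3
    · rw [h3, Nat.sub_add_cancel hh, psi_self hh]; exact hφ'
    · exact h3
  have e : 1 - cos (psi h c) - (1 - cos φ) = cos φ - cos (psi h c) := by ring
  rw [e]
  refine (Real.abs_cos_sub_cos_le _ _).trans ?_
  rw [abs_of_nonneg (sub_nonneg.2 hcφ.le)]
  linarith [psi_sub (h := h) c]

lemma wtest_FF (hh : 0 < h) (j : ℕ) : |FF h (wtest h) j - ((1/π) * ∫ φ in (0:ℝ)..π, (1 - cos φ) * cos (j * φ))| ≤ π / h := by
  have hp := Real.pi_pos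
  have e : FF h (wtest h) j = (1/π) * ∫ φ in (0:ℝ)..π, ff h (wtest h) φ * cos (j * φ) := by
    rw [ff_int_cos]; field_simp
  rw [e, ← mul_sub, ← intervalIntegral.integral_sub (ff_int (by fun_prop)).1 (Continuous.intervalIntegrable (by fun_prop) _ _),
    abs_mul, abs_of_pos (by positivity)]
  have := intervalIntegral.norm_integral_le_of_norm_le_const (a := 0) (b := π) (C := π/h)
    (f := fun φ => ff h (wtest h) φ * cos (j*φ) - (1 - cos φ) * cos (j * φ)) (by
      intro φ hφ
      rw [uIoc_of_le hp.le] at hφ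
      rw [← sub_mul, norm_mul]
      calc _ ≤ π / h * 1 := by
            gcongr
            · exact wtest_ff hh hφ.1 hφ.2
            · exact Real.abs_cos_le_one _
        _ = _ := mul_one _)
  rw [sub_zero, abs_of_pos hp, Real.norm_eq_abs] at this
  calc _ ≤ 1/π * (π/h * π) := by gcongr
    _ = _ := by field_simp

lemma wtest_F0 (hh : 0 < h) : |FF h (wtest h) 0 - 1| ≤ π / h := by
  have := wtest_FF hh 0
  have e : (1/π) * ∫ φ in (0:ℝ)..π, (1 - cos φ) * cos ((0:ℕ) * φ) = 1 := by
    have hp := Real.pi_pos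
    simp
  rwa [e] at this

lemma wtest_F1 (hh : 0 < h) : |FF h (wtest h) 1 - (-1/2)| ≤ π / h := by
  have := wtest_FF hh 1
  have e : (1/π) * ∫ φ in (0:ℝ)..π, (1 - cos φ) * cos ((1:ℕ) * φ) = -1/2 := by
    have hp := Real.pi_pos
    have e2 : ∀ φ : ℝ, (1 - cos φ) * cos ((1:ℕ) * φ) = cos φ - cos ((1:ℕ)*φ) * cos ((1:ℕ)*φ) := fun φ => by simp; ring
    simp only [e2]
    rw [intervalIntegral.integral_sub (Continuous.intervalIntegrable (by fun_prop) _ _) (Continuous.intervalIntegrable (by fun_prop) _ _), orth]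
    simp [wt]; field_simp
  rwa [e] at this

lemma wtest_NN (hh : 0 < h) : NN h (wtest h) ≤ (FF h (wtest h) 0)^2 + 2 * (FF h (wtest h) 1)^2 + (π/h)^2 := by
  have hp := Real.pi_pos
  have e := ff_dist (h := h) (w := wtest h) (fun j => if j = 0 then 1 else -1) 2
  have hb := intervalIntegral.norm_integral_le_of_norm_le_const (a := 0) (b := π) (C := (π/h)^2)
    (f := fun φ => (ff h (wtest h) φ - ∑ j ∈ Finset.range 2, (if j = 0 then (1:ℝ) else -1) * cos (j * φ))^2) (by
      intro φ hφ
      rw [uIoc_of_le hp.le] at hφ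
      rw [norm_pow, Finset.sum_range_succ, Finset.sum_range_one]
      have := wtest_ff hh hφ.1 hφ.2
      simp only [if_true, one_ne_zero, if_false, Nat.cast_zero, zero_mul, cos_zero, mul_one, Nat.cast_one, one_mul, neg_mul, ← sub_eq_add_neg]
      gcongr
      exact this)
  rw [e, sub_zero, abs_of_pos hp, Real.norm_eq_abs] at hb
  have := (le_abs_self _).trans hb
  simp only [Finset.sum_range_succ, Finset.sum_range_zero, if_true, one_ne_zero, if_false, wt] at this
  have h3 : NN h (wtest h) - 2 * (0 + 1 * FF h (wtest h) 0 + -1 * FF h (wtest h) 1) + (0 + 1^2/1 + (-1)^2/2) ≤ (π/h)^2 := by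
    by_contra hcon
    push Not at hcon
    nlinarith
  nlinarith [sq_nonneg (FF h (wtest h) 0 - 1), sq_nonneg (FF h (wtest h) 1 + 1/2)]

include h1 h2 ht ht1 in
lemma Q_test (hh : 0 < h) : QQ h (CC m t) (AA m μ t) (wtest h) ≤ CC m t * (π/h)^2 + cc μ 0 * (FF h (wtest h) 0)^2
    + 2 * (m * (1-t) + t * cc μ m) * (FF h (wtest h) 1)^2 := by
  have hA := AA_summable h1 h2 ht ht1
  have hS := QQ_eq (h := h) (C := CC m t) (w := wtest h) hA
  have hC : 0 ≤ CC m t := CC_nonneg ht1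
  have := sum_le_hasSum (Finset.range 2) (fun j hj => by
    rcases j with _ | j
    · simp at hj
    · have := (AA_bound h1 h2 ht ht1 j).1
      positivity) hS
  rw [Finset.sum_range_succ, Finset.sum_range_one, AA_wt, AA_wt, ct_zero, ct_one ht1] at this
  simp only [wt, if_true, one_ne_zero, if_false] at this
  have h3 := mul_le_mul_of_nonneg_left (wtest_NN (h := h) hh) hC
  nlinarith
end

/-- parameters -/
noncomputable def tp (p : ℕ) : ℝ := 1 - 1/((p:ℝ)+2)
def hN (p : ℕ) : ℕ := (p+2)^3

lemma tp_pos (p : ℕ) : 0 < tp p := by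
  unfold tp
  have : (0:ℝ) ≤ p := Nat.cast_nonneg p
  rw [sub_pos, div_lt_one (by linarith)]; linarith
lemma tp_lt (p : ℕ) : tp p < 1 := by
  unfold tp
  have : (0:ℝ) ≤ p := Nat.cast_nonneg p
  have : 0 < 1/((p:ℝ)+2) := by positivity
  linarith
lemma hN_pos (p : ℕ) : 0 < hN p := by unfold hN; positivity
lemma CC_tp (m p : ℕ) : CC m (tp p) = m * ((p:ℝ)+2) := by
  have : (0:ℝ) ≤ p := Nat.cast_nonneg p
  unfold CC tp
  simp
lemma inv_tend : Tendsto (fun p : ℕ => 1/((p:ℝ)+2)) atTop (nhds 0) := by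
  have := tendsto_const_nhds (x := (1:ℝ)).div_atTop (tendsto_natCast_atTop_atTop (R := ℝ).atTop_add (tendsto_const_nhds (x := (2:ℝ))))
  exact this
lemma tp_tend : Tendsto tp atTop (nhds 1) := by
  have := inv_tend.const_sub 1
  rw [sub_zero] at this
  exact this
lemma hN_inv (p : ℕ) : π / (hN p : ℝ) = π * (1/((p:ℝ)+2))^3 := by
  have : (0:ℝ) ≤ p := Nat.cast_nonneg p
  unfold hN; push_cast; field_simp
lemma hN_tend : Tendsto (fun p => π / (hN p : ℝ)) atTop (nhds 0) := by
  simp only [hN_inv]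
  simpa using (inv_tend.pow 3).const_mul π

lemma Q_test_neg {m : ℕ} {μ : ℝ} (h1 : (m:ℝ) < μ) (h2 : μ < m + 1) (hc : cc μ 0 < (-cc μ m)/2) :
    ∀ᶠ p in atTop, QQ (hN p) (CC m (tp p)) (AA m μ (tp p)) (wtest (hN p)) ≤ 0 ∧ 0 < FF (hN p) (wtest (hN p)) 0 := by
  have a0 : Tendsto (fun p => FF (hN p) (wtest (hN p)) 0) atTop (nhds 1) := by
    rw [tendsto_iff_norm_sub_tendsto_zero]
    exact squeeze_zero (fun _ => norm_nonneg _) (fun p => wtest_F0 (hN_pos p)) hN_tend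
  have a1 : Tendsto (fun p => FF (hN p) (wtest (hN p)) 1) atTop (nhds (-1/2)) := by
    rw [tendsto_iff_norm_sub_tendsto_zero]
    exact squeeze_zero (fun _ => norm_nonneg _) (fun p => wtest_F1 (hN_pos p)) hN_tend
  have a2 : Tendsto (fun p => CC m (tp p) * (π/(hN p:ℝ))^2) atTop (nhds 0) := by
    have : ∀ p : ℕ, CC m (tp p) * (π/(hN p:ℝ))^2 = m * π^2 * (1/((p:ℝ)+2))^5 := by
      intro p
      have : (0:ℝ) ≤ p := Nat.cast_nonneg p
      rw [CC_tp, hN_inv]; field_simp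
    simp only [this]
    simpa using (inv_tend.pow 5).const_mul (m * π^2)
  have a3 : Tendsto (fun p => (m:ℝ) * (1 - tp p) + tp p * cc μ m) atTop (nhds (cc μ m)) := by
    simpa using ((tp_tend.const_sub 1).const_mul (m:ℝ)).add (tp_tend.mul_const (cc μ m))
  have a4 := (a2.add ((a0.pow 2).const_mul (cc μ 0))).add ((a3.const_mul 2).mul (a1.pow 2))
  have hneg : 0 + cc μ 0 * 1^2 + 2 * cc μ m * (-1/2:ℝ)^2 < 0 := by linarith
  filter_upwards [a4.eventually_lt_const hneg, a0.eventually_const_lt one_pos] with p hp1 hp2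
  exact ⟨(Q_test h1 h2 (tp_pos p) (tp_lt p) (hN_pos p)).trans hp1.le, hp2⟩
end TO

namespace TO

lemma KK_cont {m : ℕ} {a b : ℝ} (ha : (m:ℝ) < a) (hb : b < m + 1) {t : ℝ} (ht : 0 < t) (ht1 : t < 1) {h c d : ℕ} (hc : c ≤ h) (hd : d ≤ h) :
    ContinuousOn (fun μ => KK h (CC m t) (AA m μ t) c d) (Icc a b) := by
  have hsub : Icc a b ⊆ Ioo (m:ℝ) (m+1) := fun x hx => ⟨ha.trans_le hx.1, hx.2.trans_lt hb⟩
  unfold KK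
  apply ContinuousOn.sub continuousOn_const
  obtain ⟨L, hL⟩ := (isCompact_Icc (a := a) (b := b)).exists_bound_of_continuousOn ((cc_contOn m m).mono hsub)
  obtain ⟨L0, hL0⟩ := (isCompact_Icc (a := a) (b := b)).exists_bound_of_continuousOn ((cc_contOn m 0).mono hsub)
  have hcont : ∀ j, ContinuousOn (fun μ => AA m μ t j) (Icc a b) := by
    intro j
    unfold AA
    split_ifs
    · exact continuousOn_const.sub ((cc_contOn m 0).mono hsub)
    · exact continuousOn_const.mul (continuousOn_const.mul (continuousOn_const.add (continuousOn_const.sub ((cc_contOn m _).mono hsub))))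
  refine continuousOn_tsum (u := fun j => if j = 0 then |CC m t| + L0 else 2 * (CC m t + ((m:ℝ) + L)) * t^j) (fun j => (hcont j).mul continuousOn_const) ?_ ?_
  · rw [← summable_nat_add_iff 1]
    simp only [Nat.add_eq_zero_iff, one_ne_zero, and_false, if_false]
    exact ((summable_nat_add_iff 1).2 (summable_geometric_of_lt_one ht.le ht1)).mul_left _
  · intro j μ hμ
    have h1 := (hsub hμ).1
    have h2 := (hsub hμ).2
    have b1 : ‖AA m μ t j * (chi (psi h c) j * chi (psi h d) j)‖ ≤ |AA m μ t j| := by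
      rw [norm_mul, norm_mul]
      simp only [Real.norm_eq_abs]
      exact mul_le_of_le_one_right (abs_nonneg _) (mul_le_one₀ (chi_abs' (psi_mem hc) j) (abs_nonneg _) (chi_abs' (psi_mem hd) j))
    refine b1.trans ?_
    rcases j with _ | j
    · rw [AA_zero, if_pos rfl]
      have := hL0 μ hμ
      rw [Real.norm_eq_abs] at this
      exact (abs_sub _ _).trans (by linarith)
    · have := AA_bound h1 h2 ht ht1 j
      rw [abs_of_nonneg this.1, if_neg (Nat.succ_ne_zero j)]
      refine this.2.trans ?_
      have h3 := hL μ hμ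
      rw [Real.norm_eq_abs] at h3
      have := neg_abs_le (cc μ m)
      gcongr
      linarith

/-- Extension of a finite vector by zero. -/
noncomputable def ext0 {h : ℕ} (w : Fin h → ℝ) (a : ℕ) : ℝ := if ha : a < h then w ⟨a, ha⟩ else 0

lemma ext0_fin {h : ℕ} (w : Fin h → ℝ) (i : Fin h) : ext0 w i = w i := by simp [ext0]

lemma ext0_nonneg {h : ℕ} {w : Fin h → ℝ} (hw : ∀ i, 0 ≤ w i) (a : ℕ) : 0 ≤ ext0 w a := by
  unfold ext0; split_ifs <;> simp [hw]

lemma QQ_ext0 {h : ℕ} {C : ℝ} {A : ℕ → ℝ} (w : Fin h → ℝ) : QQ h C A (ext0 w) = ∑ c : Fin h, ∑ d : Fin h, w c * w d * KK h C A c d := by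
  unfold QQ
  simp only [Finset.sum_range, ext0_fin]

lemma FF_ext0 {h : ℕ} (w : Fin h → ℝ) : FF h (ext0 w) 0 = ∑ c : Fin h, w c * (1 - (c:ℕ)/h) := by
  unfold FF
  simp only [Finset.sum_range, ext0_fin, chi_zero, psi_div]

def simplexD (h : ℕ) : Set (Fin h → ℝ) := {w | (∀ c, 0 ≤ w c) ∧ FF h (ext0 w) 0 = 1}

lemma simplexD_compact {h : ℕ} : IsCompact (simplexD h) := by
  apply (isCompact_Icc (a := (0 : Fin h → ℝ)) (b := fun _ => (h:ℝ))).of_isClosed_subset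
  · have : simplexD h = (⋂ c : Fin h, {w | 0 ≤ w c}) ∩ {w : Fin h → ℝ | ∑ c : Fin h, w c * (1 - ((c:ℕ):ℝ)/h) = 1} := by
      ext w; simp [simplexD, FF_ext0]
    rw [this]
    refine IsClosed.inter (isClosed_iInter fun c => ?_) ?_
    · exact isClosed_le continuous_const (continuous_apply c)
    · exact isClosed_eq (by fun_prop) continuous_const
  · rintro w ⟨h0, h1⟩
    refine ⟨h0, fun c => ?_⟩
    have hh : 0 < h := c.pos
    have hh' : (0:ℝ) < h := by exact_mod_cast hh
    rw [FF_ext0] at h1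
    have hge : ∀ d : Fin h, (1:ℝ)/h ≤ 1 - (d:ℕ)/h := by
      intro d
      have : ((d:ℕ):ℝ) + 1 ≤ h := by exact_mod_cast d.2
      rw [div_le_iff₀ hh', sub_mul, div_mul_cancel₀ _ hh'.ne']; linarith
    have := Finset.single_le_sum (f := fun d : Fin h => w d * (1 - (d:ℕ)/h)) (fun d _ => mul_nonneg (h0 d) (le_trans (by positivity) (hge d))) (Finset.mem_univ c)
    rw [h1] at this
    have h4 : w c * (1/h) ≤ 1 := (mul_le_mul_of_nonneg_left (hge c) (h0 c)).trans this
    rw [mul_one_div, div_le_one hh'] at h4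
    exact h4

theorem finite_thm {m : ℕ} (hodd : Odd m) {a b : ℝ} (ha : (m:ℝ) < a) (hb : b < m + 1) (hab : a ≤ b)
    (hca : 2 * (-cc a m) < cc a 0) (hcb : cc b 0 < (-cc b m)/2) :
    ∀ᶠ p in atTop, ∃ μ ∈ Icc a b, ∃ w : ℕ → ℝ, (∀ i, 0 ≤ w i) ∧ FF (hN p) w 0 = 1 ∧
      ∃ c, c ≤ hN p ∧ (∀ i < c, w i = 0) ∧ ∃ r : ℕ → ℝ, Antitone r ∧ (∀ i, 0 ≤ r i) ∧
      (∀ i, r i ≤ cc μ 0 + 2 * ((m:ℝ) - cc μ m)) ∧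
      (∀ i, c ≤ i → r i = 0) ∧ ∀ j : ℕ, |∑ i ∈ Finset.range (hN p), r i * (chi (psi (hN p) i) j - chi (psi (hN p) (i+1)) j)
      - ct m μ (tp p) j * FF (hN p) w j| ≤ j * π * (2 * ∑' i, |AA m μ (tp p) i|) / hN p := by
  filter_upwards [Q_test_neg (ha.trans_le hab) hb hcb] with p hp
  set h := hN p with hh
  have hpos : 0 < h := hN_pos p
  set t := tp p with htp
  have ht : 0 < t := tp_pos p
  have ht1 : t < 1 := tp_lt p
  have hQc : ContinuousOn (fun q : ℝ × (Fin h → ℝ) => QQ h (CC m t) (AA m q.1 t) (ext0 q.2)) (Icc a b ×ˢ simplexD h) := by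
    simp only [QQ_ext0]
    refine continuousOn_finsetSum _ fun c _ => continuousOn_finsetSum _ fun d _ => ?_
    apply ContinuousOn.mul (by fun_prop)
    exact (KK_cont ha hb ht ht1 c.2.le d.2.le).comp continuousOn_fst fun q hq => hq.1
  obtain ⟨μ, hμ, w, hwD, hQ0, hQp⟩ := crossing (simplexD_compact (h := h)) hab (Q := fun μ w => QQ h (CC m t) (AA m μ t) (ext0 w)) hQc
    (fun w hw => Q_pos ha (hab.trans_lt hb) hodd ht ht1 (ext0_nonneg hw.1) hw.2 hca) (by
      set F := FF h (wtest h) 0 with hF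
      refine ⟨fun i => F⁻¹ * wtest h i, ⟨fun i => mul_nonneg (inv_nonneg.2 hp.2.le) (wtest_nonneg hpos i.2), ?_⟩, ?_⟩
      · rw [FF_ext0]
        have : F = ∑ c : Fin h, wtest h c * (1 - (c:ℕ)/h) := by
          rw [hF]; unfold FF; simp only [Finset.sum_range, chi_zero, psi_div]
        simp only [mul_assoc]
        rw [← Finset.mul_sum, ← this, inv_mul_cancel₀ hp.2.ne']
      · simp only [QQ_ext0]
        have e : ∑ c : Fin h, ∑ d : Fin h, F⁻¹ * wtest h c * (F⁻¹ * wtest h d) * KK h (CC m t) (AA m b t) c d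
            = F⁻¹^2 * QQ h (CC m t) (AA m b t) (wtest h) := by
          unfold QQ
          simp only [Finset.sum_range]
          rw [Finset.mul_sum]
          refine Finset.sum_congr rfl fun c _ => ?_
          rw [Finset.mul_sum]
          exact Finset.sum_congr rfl fun d _ => by ring
        rw [e]
        exact mul_nonpos_of_nonneg_of_nonpos (sq_nonneg _) hp.1)
  have h1 : (m:ℝ) < μ := ha.trans_le hμ.1
  have h2 : μ < m + 1 := hμ.2.trans_lt hb
  simp only [QQ_ext0] at hQ0 hQp
  have hsymm : ∀ c d : Fin h, KK h (CC m t) (AA m μ t) c d = KK h (CC m t) (AA m μ t) d c := by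
    intro c d; unfold KK; rw [max_comm]; congr 1; exact tsum_congr fun j => by ring
  obtain ⟨kT, kc⟩ := kkt (fun c d : Fin h => KK h (CC m t) (AA m μ t) c d) hsymm w hwD.1 hQ0 (by
    intro v hv
    by_cases hF : FF h (ext0 v) 0 = 0
    · rw [FF_ext0] at hF
      have hpos' : ∀ d : Fin h, 0 < (1:ℝ) - (d:ℕ)/h := by
        intro d
        have : ((d:ℕ):ℝ) < h := by exact_mod_cast d.2
        rw [sub_pos, div_lt_one (by exact_mod_cast hpos)]; exact this
      have := (Finset.sum_eq_zero_iff_of_nonneg (fun d _ => mul_nonneg (hv d) (hpos' d).le)).1 hF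
      have hv0 : ∀ d, v d = 0 := fun d => (mul_eq_zero.1 (this d (Finset.mem_univ d))).resolve_right (hpos' d).ne'
      simp [hv0]
    · set F := FF h (ext0 v) 0 with hFd
      have := hQp (fun i => F⁻¹ * v i) ⟨fun i => mul_nonneg (inv_nonneg.2 ?_) (hv i), ?_⟩
      · have e : ∑ c : Fin h, ∑ d : Fin h, F⁻¹ * v c * (F⁻¹ * v d) * KK h (CC m t) (AA m μ t) c d
            = F⁻¹^2 * ∑ c : Fin h, ∑ d : Fin h, v c * v d * KK h (CC m t) (AA m μ t) c d := by
          rw [Finset.mul_sum]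
          refine Finset.sum_congr rfl fun c _ => ?_
          rw [Finset.mul_sum]
          exact Finset.sum_congr rfl fun d _ => by ring
        rw [e] at this
        exact nonneg_of_mul_nonneg_right this (by positivity)
      · exact (abs_nonneg _).trans (FF_abs (h := h) (ext0_nonneg hv) 0)
      · rw [FF_ext0]
        have : F = ∑ c : Fin h, v c * (1 - (c:ℕ)/h) := by rw [hFd, FF_ext0]
        simp only [mul_assoc]
        rw [← Finset.mul_sum, ← this, inv_mul_cancel₀ hF])
  have hTT : ∀ c : Fin h, TT h (CC m t) (AA m μ t) (ext0 w) c = π * ∑ d : Fin h, KK h (CC m t) (AA m μ t) c d * w d := by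
    intro c; unfold TT; simp only [Finset.sum_range, ext0_fin]
  obtain ⟨c, hc0, hch, hwc, r, hr⟩ := struct hpos (AA_summable h1 h2 ht ht1) (ext0_nonneg hwD.1) (C := CC m t) hwD.2 (by
      intro c hc
      have := hTT ⟨c, hc⟩
      simp only at this
      rw [this]
      exact mul_nonneg Real.pi_pos.le (kT ⟨c, hc⟩)) (by
      intro c hc
      have := hTT ⟨c, hc⟩
      simp only at this
      rw [this, ← mul_assoc, mul_comm (ext0 w c), mul_assoc]
      have e := ext0_fin w ⟨c, hc⟩
      simp only at e
      have := kc ⟨c, hc⟩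
      rw [e, this, mul_zero]) (by
      rw [AA_zero]; linarith [cc_zero_pos h1 h2 hodd])
      (fun d hd => AA_mono h1 h2 ht ht1 (psi_mem hd.le)) (B := cc μ 0 + 2 * ((m:ℝ) - cc μ m)) (by
      intro d hd
      have := AA_lower h1 h2 ht ht1 (psi_mem hd.le)
      rwa [psi_div] at this)
  exact ⟨μ, hμ, ext0 w, ext0_nonneg hwD.1, hwD.2, c, hch.le, hwc, r, hr⟩
end TO

namespace TO

/-- Helly selection for uniformly bounded antitone functions. -/
lemma helly {B : ℝ} {g : ℕ → ℝ → ℝ} (hg : ∀ p, Antitone (g p)) (h0 : ∀ p x, 0 ≤ g p x) (hB : ∀ p x, g p x ≤ B) :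
    ∃ (s : ℕ → ℕ) (G : ℝ → ℝ), StrictMono s ∧ Antitone G ∧ (∀ x, 0 ≤ G x ∧ G x ≤ B) ∧
      (∀ x, ContinuousAt G x → Tendsto (fun p => g (s p) x) atTop (nhds (G x))) ∧
      (∀ σ, (∀ x, σ < x → ∀ᶠ p in atTop, g (s p) x = 0) → ∀ x, σ < x → G x = 0) := by
  have hcomp : IsCompact (Set.pi univ (fun _ : ℚ => Icc (0:ℝ) B)) := isCompact_univ_pi fun _ => isCompact_Icc
  obtain ⟨F, hF, s, hs, hlim⟩ := hcomp.tendsto_subseq (x := fun p (q:ℚ) => g p q) (fun p q _ => ⟨h0 p q, hB p q⟩)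
  have hlim' : ∀ q : ℚ, Tendsto (fun p => g (s p) q) atTop (nhds (F q)) := fun q => (tendsto_pi_nhds.1 hlim) q
  have hF' : ∀ q, F q ∈ Icc 0 B := fun q => hF q (mem_univ q)
  have hFa : Antitone F := fun q q' hq => le_of_tendsto_of_tendsto' (hlim' q') (hlim' q) fun p => hg _ (by exact_mod_cast hq)
  set G : ℝ → ℝ := fun x => sInf (F '' {q : ℚ | (q:ℝ) ≤ x}) with hG
  have hne : ∀ x : ℝ, (F '' {q : ℚ | (q:ℝ) ≤ x}).Nonempty := fun x => by
    obtain ⟨q, hq⟩ := exists_rat_lt x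
    exact ⟨_, q, hq.le, rfl⟩
  have hbdd : ∀ x : ℝ, BddBelow (F '' {q : ℚ | (q:ℝ) ≤ x}) := fun x => ⟨0, by rintro _ ⟨q, _, rfl⟩; exact (hF' q).1⟩
  have hle : ∀ x (q:ℚ), (q:ℝ) ≤ x → G x ≤ F q := fun x q hq => csInf_le (hbdd x) ⟨q, hq, rfl⟩
  have hge : ∀ (x:ℝ) (q:ℚ), x < (q:ℝ) → F q ≤ G x := fun x q hq => le_csInf (hne x) (by
    rintro _ ⟨q', hq', rfl⟩
    apply hFa
    have : (q':ℝ) ≤ q := hq'.trans hq.le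
    exact_mod_cast this)
  refine ⟨s, G, hs, ?_, ?_, ?_, ?_⟩
  · intro x y hxy
    exact csInf_le_csInf (hbdd y) (hne x) (image_mono fun q hq => le_trans hq hxy)
  · intro x
    obtain ⟨q, hq⟩ := exists_rat_lt x
    exact ⟨le_csInf (hne x) (by rintro _ ⟨q, _, rfl⟩; exact (hF' q).1), (hle x q hq.le).trans (hF' q).2⟩
  · intro x hx
    rw [Metric.tendsto_nhds]
    intro ε hε
    rw [Metric.continuousAt_iff] at hx
    obtain ⟨δ, hδ, hx⟩ := hx ε hε
    obtain ⟨q1, hq1, hq1'⟩ := exists_rat_btwn (show x - δ/2 < x by linarith)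
    obtain ⟨q2, hq2, hq2'⟩ := exists_rat_btwn (show x < x + δ/2 by linarith)
    have a1 := hx (x := x - δ/2) (by rw [Real.dist_eq, show x - δ/2 - x = -(δ/2) by ring, abs_neg, abs_of_pos (by linarith)]; linarith)
    have a2 := hx (x := q2) (by rw [Real.dist_eq, abs_of_pos (by linarith)]; linarith)
    rw [Real.dist_eq, abs_lt] at a1 a2
    have b1 := hge _ q1 hq1
    have b2 := hle _ q2 le_rfl
    filter_upwards [(hlim' q1).eventually_lt_const (show F q1 < G x + ε by linarith), (hlim' q2).eventually_const_lt (show G x - ε < F q2 by linarith)] with p e1 e2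
    have c1 := hg (s p) hq1'.le
    have c2 := hg (s p) hq2.le
    rw [Real.dist_eq, abs_lt]
    constructor <;> linarith
  · intro σ hσ x hx
    obtain ⟨q, hq1, hq2⟩ := exists_rat_btwn hx
    have : F q = 0 := tendsto_nhds_unique (hlim' q) (tendsto_const_nhds.congr' ((hσ q hq1).mono fun p hp => hp.symm))
    apply le_antisymm
    · rw [← this]; exact hle x q hq2.le
    · exact le_csInf (hne x) (by rintro _ ⟨q, _, rfl⟩; exact (hF' q).1)

/-- step function attached to r -/
noncomputable def rt (h : ℕ) (r : ℕ → ℝ) (φ : ℝ) : ℝ := r ⌊φ * h / π⌋₊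

lemma rt_anti {h : ℕ} {r : ℕ → ℝ} (hr : Antitone r) : Antitone (rt h r) := by
  intro x y hxy
  have hp := Real.pi_pos
  apply hr
  apply Nat.floor_mono
  gcongr

lemma rt_int {h : ℕ} (hh : 0 < h) {r : ℕ → ℝ} (hr : Antitone r) (j : ℕ) :
    (1/π) * ∫ φ in (0:ℝ)..π, rt h r φ * cos (j * φ) = ∑ i ∈ Finset.range h, r i * (chi (psi h i) j - chi (psi h (i+1)) j) := by
  have hp := Real.pi_pos
  have hh' : (0:ℝ) < h := by exact_mod_cast hh
  have hii : ∀ a b, IntervalIntegrable (fun φ => rt h r φ * cos (j * φ)) MeasureTheory.volume a b := fun a b =>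
    ((rt_anti hr).intervalIntegrable).mul_continuousOn (by fun_prop)
  have e : ∫ φ in (0:ℝ)..π, rt h r φ * cos (j * φ) = ∑ i ∈ Finset.range h, ∫ φ in (psi h i)..(psi h (i+1)), rt h r φ * cos (j * φ) := by
    rw [intervalIntegral.sum_integral_adjacent_intervals (a := fun a => psi h a)]
    · rw [psi_self hh]; simp [psi]
    · intro k _; exact hii _ _
  rw [e, Finset.mul_sum]
  refine Finset.sum_congr rfl fun i _ => ?_
  rw [chi_sub, intervalIntegral.integral_congr_Ioo_of_le psi_le (g := fun φ => r i * cos (j * φ)), intervalIntegral.integral_const_mul]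
  · ring
  · intro φ hφ
    have hf : ⌊φ * h / π⌋₊ = i := by
      have h1 : (i:ℝ) * π / h < φ := hφ.1
      have h2 : φ < ((i+1:ℕ):ℝ) * π / h := hφ.2
      rw [div_lt_iff₀ hh'] at h1
      rw [lt_div_iff₀ hh'] at h2
      push_cast at h2
      have h0 : 0 ≤ φ * h / π := by
        have : 0 ≤ φ * h := le_trans (by positivity) h1.le
        positivity
      rw [Nat.floor_eq_iff h0]
      constructor
      · rw [le_div_iff₀ hp]; exact h1.le
      · rw [div_lt_iff₀ hp]; exact h2
    simp only [rt, hf]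
end TO

namespace TO

lemma AA_sum_bound {m : ℕ} {a b : ℝ} (ha : (m:ℝ) < a) (hb : b < m + 1) :
    ∃ K, ∀ μ ∈ Icc a b, ∀ p : ℕ, ∑' i, |AA m μ (tp p) i| ≤ K * ((p:ℝ)+2)^2 := by
  have hsub : Icc a b ⊆ Ioo (m:ℝ) (m+1) := fun x hx => ⟨ha.trans_le hx.1, hx.2.trans_lt hb⟩
  obtain ⟨L, hL⟩ := (isCompact_Icc (a := a) (b := b)).exists_bound_of_continuousOn ((cc_contOn m m).mono hsub)
  obtain ⟨L0, hL0⟩ := (isCompact_Icc (a := a) (b := b)).exists_bound_of_continuousOn ((cc_contOn m 0).mono hsub)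
  refine ⟨m + L0 + 2 * (m + m + L), fun μ hμ p => ?_⟩
  have h1 := (hsub hμ).1
  have h2 := (hsub hμ).2
  have ht := tp_pos p
  have ht1 := tp_lt p
  have hA := AA_summable h1 h2 ht ht1
  have b0 := hL0 μ hμ
  have b1 := hL μ hμ
  rw [Real.norm_eq_abs] at b0 b1
  set q : ℝ := (p:ℝ) + 2 with hq
  have hq1 : 1 ≤ q := by have : (0:ℝ) ≤ p := Nat.cast_nonneg p; linarith
  have hC : CC m (tp p) = m * q := CC_tp m p
  have hm : (0:ℝ) ≤ m := Nat.cast_nonneg m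
  have hL0' : 0 ≤ L0 := (abs_nonneg _).trans b0
  have hL' : 0 ≤ L := (abs_nonneg _).trans b1
  rw [hA.tsum_eq_zero_add]
  have hgeo : HasSum (fun i => (2 * (CC m (tp p) + ((m:ℝ) - cc μ m)) * tp p) * tp p ^ i) (2 * (CC m (tp p) + ((m:ℝ) - cc μ m)) * tp p * (1 - tp p)⁻¹) :=
    (hasSum_geometric_of_lt_one ht.le ht1).mul_left _
  have htail : ∑' i, |AA m μ (tp p) (i+1)| ≤ 2 * (CC m (tp p) + ((m:ℝ) - cc μ m)) * tp p * (1 - tp p)⁻¹ := by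
    rw [← hgeo.tsum_eq]
    refine Summable.tsum_le_tsum (fun i => ?_) ((summable_nat_add_iff 1).2 hA) hgeo.summable
    have := AA_bound h1 h2 ht ht1 i
    rw [abs_of_nonneg this.1]
    refine this.2.trans (le_of_eq ?_)
    rw [pow_succ]; ring
  have hinv : (1 - tp p)⁻¹ = q := by unfold tp; rw [sub_sub_cancel, one_div, inv_inv]
  rw [hinv, hC] at htail
  have hz : |AA m μ (tp p) 0| ≤ m * q + L0 := by
    rw [AA_zero, hC]
    refine (abs_sub _ _).trans ?_
    rw [abs_of_nonneg (by positivity)]; linarith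
  have hneg := neg_abs_le (cc μ m)
  have htail2 : ∑' i, |AA m μ (tp p) (i+1)| ≤ 2 * (m * q + (m + L)) * q := by
    refine htail.trans ?_
    have : cc μ m < 0 := cc_m_neg h1 h2
    have hX : 0 ≤ m * q + (m - cc μ m) := by
      have : 0 ≤ m * q := by positivity
      linarith
    calc 2 * (m * q + (m - cc μ m)) * tp p * q ≤ 2 * (m * q + (m - cc μ m)) * 1 * q := by gcongr
      _ ≤ _ := by rw [mul_one]; gcongr; linarith
  have hq2 : q ≤ q^2 := by nlinarith
  have hq3 : 1 ≤ q^2 := by linarith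
  have e1 : m * q ≤ m * q^2 := mul_le_mul_of_nonneg_left hq2 hm
  have e2 : L0 ≤ L0 * q^2 := le_mul_of_one_le_right hL0' hq3
  have e3 : (m + L) * q ≤ (m+L) * q^2 := mul_le_mul_of_nonneg_left hq2 (by linarith)
  have e4 : (m + L0 + 2 * (m + m + L)) * q^2 = m * q^2 + L0 * q^2 + 2 * (m * q * q) + 2 * ((m+L) * q^2) := by ring
  have e5 : 2 * (m * q + (m + L)) * q = 2 * (m*q*q) + 2 * ((m+L)*q) := by ring
  rw [e4]; rw [e5] at htail2
  linarith

/-- cosine coefficients -/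
noncomputable def rh (r : ℝ → ℝ) (j : ℕ) : ℝ := (1/π) * ∫ φ in (0:ℝ)..π, r φ * cos (j * φ)

lemma ct_tend {m : ℕ} {a b : ℝ} (ha : (m:ℝ) < a) (hb : b < m + 1) {μ : ℕ → ℝ} {ν : ℝ} (hμ : ∀ p, μ p ∈ Icc a b) (hν : ν ∈ Icc a b)
    (hlim : Tendsto μ atTop (nhds ν)) {s : ℕ → ℕ} (hs : Tendsto s atTop atTop) (j : ℕ) :
    Tendsto (fun p => ct m (μ p) (tp (s p)) j) atTop (nhds (cc ν (j*m))) := by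
  have hsub : Icc a b ⊆ Ioo (m:ℝ) (m+1) := fun x hx => ⟨ha.trans_le hx.1, hx.2.trans_lt hb⟩
  have hc : ∀ k, Tendsto (fun p => cc (μ p) k) atTop (nhds (cc ν k)) := fun k =>
    ((cc_contOn m k ν (hsub hν)).continuousAt (isOpen_Ioo.mem_nhds (hsub hν))).tendsto.comp hlim
  rcases Nat.eq_zero_or_pos j with h0 | h0
  · subst h0; simpa [ct_zero] using hc 0
  · simp only [ct_geom (tp_lt _) h0.ne']
    have ht : Tendsto (fun p => tp (s p)) atTop (nhds 1) := tp_tend.comp hs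
    have := ((tendsto_finsetSum (Finset.range j) fun i _ => ht.pow i).const_mul (m:ℝ)).sub ((ht.pow j).mul ((hc (j*m)).const_sub (((j*m:ℕ):ℝ))))
    convert this using 2
    simp; ring

theorem limit_thm {m : ℕ} (hodd : Odd m) : ∃ μ : ℝ, (m:ℝ) < μ ∧ μ < m + 1 ∧ ∃ (r : ℝ → ℝ) (B σ : ℝ),
    Antitone r ∧ (∀ x, 0 ≤ r x ∧ r x ≤ B) ∧ (∀ x, σ < x → r x = 0) ∧ σ ∈ Icc 0 π ∧ rh r 0 = cc μ 0 ∧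
    ∀ (α : ℕ → ℝ) (n : ℕ) (δ : ℝ), 0 < δ →
      (∀ c ∈ Icc 0 π, σ - δ < c → 0 ≤ ∫ φ in c..π, ∑ j ∈ Finset.range n, α j * cos (j * φ)) →
      0 ≤ ∑ j ∈ Finset.range n, α j * (rh r j / cc μ (j*m)) := by
  have hpi := Real.pi_pos
  set a : ℝ := (m:ℝ) + 1/8 with ha'
  set b : ℝ := (m:ℝ) + 1 - 1/2^(m+5) with hb'
  have ha : (m:ℝ) < a := by rw [ha']; linarith
  have hpw : (0:ℝ) < 1/2^(m+5) := by positivity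
  have hpw2 : (1:ℝ)/2^(m+5) ≤ 1/32 := by
    have h5 : (32:ℝ) ≤ 2^(m+5) := by
      rw [pow_add]; have : (1:ℝ) ≤ 2^m := one_le_pow₀ (by norm_num)
      linarith
    exact one_div_le_one_div_of_le (by norm_num) h5
  have hb : b < m + 1 := by rw [hb']; linarith
  have hab : a ≤ b := by rw [ha', hb']; linarith
  have hsub : Icc a b ⊆ Ioo (m:ℝ) (m+1) := fun x hx => ⟨ha.trans_le hx.1, hx.2.trans_lt hb⟩
  obtain ⟨P, hP⟩ := eventually_atTop.1 (finite_thm hodd ha hb hab (mu1_ex m hodd) (mu2_ex m hodd))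
  have hP' : ∀ p, _ := fun p => hP (p + P) (Nat.le_add_left _ _)
  choose μ hμ w hw0 hwF c hch hwc r hra hr0 hrB hrc hfour using hP'
  obtain ⟨L, hL⟩ := (isCompact_Icc (a := a) (b := b)).exists_bound_of_continuousOn ((cc_contOn m m).mono hsub)
  obtain ⟨L0, hL0⟩ := (isCompact_Icc (a := a) (b := b)).exists_bound_of_continuousOn ((cc_contOn m 0).mono hsub)
  set B : ℝ := L0 + 2 * (m + L) with hB
  have hrB' : ∀ p i, r p i ≤ B := by
    intro p i
    refine (hrB p i).trans ?_
    have b0 := hL0 _ (hμ p)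
    have b1 := hL _ (hμ p)
    rw [Real.norm_eq_abs] at b0 b1
    have := neg_abs_le (cc (μ p) m)
    have := le_abs_self (cc (μ p) 0)
    linarith
  obtain ⟨⟨ν, σ⟩, hνσ, s1, hs1, hlim1⟩ := ((isCompact_Icc (a := a) (b := b)).prod (isCompact_Icc (a := (0:ℝ)) (b := π))).tendsto_subseq
    (x := fun p => (μ p, psi (hN (p+P)) (c p))) (fun p => ⟨hμ p, psi_mem (hch p)⟩)
  have hν : ν ∈ Icc a b := hνσ.1
  have hσ : σ ∈ Icc 0 π := hνσ.2
  have hlimν : Tendsto (fun p => μ (s1 p)) atTop (nhds ν) := (continuous_fst.tendsto _).comp hlim1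
  have hlimσ : Tendsto (fun p => psi (hN (s1 p+P)) (c (s1 p))) atTop (nhds σ) := (continuous_snd.tendsto _).comp hlim1
  obtain ⟨s2, G, hs2, hGa, hGb, hGc, hGz⟩ := helly (g := fun p => rt (hN (s1 p + P)) (r (s1 p))) (fun p => rt_anti (hra _))
    (fun p x => hr0 _ _) (fun p x => hrB' _ _)
  set s : ℕ → ℕ := fun p => s1 (s2 p) with hs
  have hsm : StrictMono s := hs1.comp hs2
  have hst : Tendsto (fun p => s p + P) atTop atTop := tendsto_atTop_mono (fun p => Nat.le_add_right _ _) hsm.tendsto_atTop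
  have hlimν' : Tendsto (fun p => μ (s p)) atTop (nhds ν) := hlimν.comp hs2.tendsto_atTop
  have hlimσ' : Tendsto (fun p => psi (hN (s p+P)) (c (s p))) atTop (nhds σ) := hlimσ.comp hs2.tendsto_atTop
  have h1 := (hsub hν).1
  have h2 := (hsub hν).2
  -- Fourier coefficients converge
  have hae : ∀ᵐ x, ContinuousAt G x := by
    have := hGa.countable_not_continuousAt
    have := this.measure_zero MeasureTheory.volume
    exact this
  have hrt : ∀ j : ℕ, Tendsto (fun p => (1/π) * ∫ φ in (0:ℝ)..π, rt (hN (s p + P)) (r (s p)) φ * cos (j * φ)) atTop (nhds (rh G j)) := by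
    intro j
    unfold rh
    apply Tendsto.const_mul
    refine intervalIntegral.tendsto_integral_filter_of_dominated_convergence (fun _ => B) ?_ ?_ ?_ ?_
    · refine Eventually.of_forall fun p => ?_
      exact ((rt_anti (hra _)).measurable.mul (by fun_prop)).aestronglyMeasurable
    · refine Eventually.of_forall fun p => Eventually.of_forall fun x _ => ?_
      have h0 : 0 ≤ rt (hN (s p+P)) (r (s p)) x := hr0 _ _
      rw [norm_mul, Real.norm_eq_abs, Real.norm_eq_abs, abs_of_nonneg h0]
      exact (mul_le_of_le_one_right h0 (Real.abs_cos_le_one _)).trans (hrB' _ _)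
    · simp
    · filter_upwards [hae] with x hx _
      exact (hGc x hx).mul_const _
  have herr : ∀ j : ℕ, Tendsto (fun p => (j:ℝ) * π * (2 * ∑' i, |AA m (μ (s p)) (tp (s p + P)) i|) / hN (s p + P)) atTop (nhds 0) := by
    intro j
    obtain ⟨K, hK⟩ := AA_sum_bound ha hb
    have hto : Tendsto (fun p => (j:ℝ) * π * (2 * K) * (1/(((s p + P:ℕ):ℝ)+2))) atTop (nhds 0) := by
      simpa using (inv_tend.comp hst).const_mul ((j:ℝ) * π * (2 * K))
    refine squeeze_zero (fun p => by positivity) (fun p => ?_) hto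
    have := hK (μ (s p)) (hμ _) (s p + P)
    have hq : (0:ℝ) < ((s p + P:ℕ):ℝ)+2 := by positivity
    have hN3 : ((hN (s p + P):ℕ):ℝ) = (((s p + P:ℕ):ℝ)+2)^3 := by unfold hN; push_cast; ring
    rw [hN3]
    calc _ ≤ (j:ℝ) * π * (2 * (K * (((s p + P:ℕ):ℝ)+2)^2)) / (((s p + P:ℕ):ℝ)+2)^3 := by gcongr
      _ = _ := by field_simp
  have hctF : ∀ j, Tendsto (fun p => ct m (μ (s p)) (tp (s p + P)) j * FF (hN (s p + P)) (w (s p)) j) atTop (nhds (rh G j)) := by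
    intro j
    have : Tendsto (fun p => (1/π) * (∫ φ in (0:ℝ)..π, rt (hN (s p + P)) (r (s p)) φ * cos (j * φ)) - ct m (μ (s p)) (tp (s p + P)) j * FF (hN (s p + P)) (w (s p)) j) atTop (nhds 0) := by
      refine squeeze_zero_norm (fun p => ?_) (herr j)
      rw [Real.norm_eq_abs, rt_int (hN_pos _) (hra _)]
      exact hfour (s p) j
    simpa using (hrt j).sub this
  have hF : ∀ j, Tendsto (fun p => FF (hN (s p + P)) (w (s p)) j) atTop (nhds (rh G j / cc ν (j*m))) := by
    intro j
    have hc := ct_tend ha hb (fun p => hμ (s p)) hν hlimν' hst j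
    have hne := cc_ne h1 h2 (j*m)
    refine ((hctF j).div hc hne).congr' ?_
    filter_upwards [hc.eventually_ne hne] with p hp
    simp only [Pi.div_apply]
    exact mul_div_cancel_left₀ _ hp
  refine ⟨ν, h1, h2, G, B, σ, hGa, hGb, ?_, hσ, ?_, ?_⟩
  · apply hGz
    intro x hx
    have := (hlimσ'.eventually_lt_const hx)
    filter_upwards [this] with p hp
    apply hrc
    have hN0 : (0:ℝ) < hN (s p + P) := by exact_mod_cast hN_pos _
    apply Nat.le_floor
    rw [le_div_iff₀ hpi]
    unfold psi at hp
    rw [div_lt_iff₀ hN0] at hp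
    exact hp.le
  · have := hctF 0
    simp only [hwF, mul_one, ct_zero] at this
    have h3 : Tendsto (fun p => cc (μ (s p)) 0) atTop (nhds (cc ν 0)) :=
      ((cc_contOn m 0 ν (hsub hν)).continuousAt (isOpen_Ioo.mem_nhds (hsub hν))).tendsto.comp hlimν'
    exact tendsto_nhds_unique this h3
  · intro α n δ hδ htest
    have hlim : Tendsto (fun p => ∑ j ∈ Finset.range n, α j * FF (hN (s p + P)) (w (s p)) j) atTop (nhds (∑ j ∈ Finset.range n, α j * (rh G j / cc ν (j*m)))) :=
      tendsto_finsetSum _ fun j _ => (hF j).const_mul _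
    refine ge_of_tendsto hlim ?_
    filter_upwards [hlimσ'.eventually_const_lt (show σ - δ < σ by linarith)] with p hp
    have e : ∑ j ∈ Finset.range n, α j * FF (hN (s p + P)) (w (s p)) j =
        ∑ d ∈ Finset.range (hN (s p + P)), w (s p) d * ((1/π) * ∫ φ in (psi (hN (s p + P)) d)..π, ∑ j ∈ Finset.range n, α j * cos (j * φ)) := by
      unfold FF chi
      simp only [Finset.mul_sum]
      rw [Finset.sum_comm]
      refine Finset.sum_congr rfl fun d _ => ?_
      rw [intervalIntegral.integral_finsetSum (fun j _ => Continuous.intervalIntegrable (by fun_prop) _ _), Finset.mul_sum, Finset.mul_sum]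
      refine Finset.sum_congr rfl fun j _ => ?_
      rw [intervalIntegral.integral_const_mul]; ring
    rw [e]
    refine Finset.sum_nonneg fun d hd => ?_
    by_cases hdc : d < c (s p)
    · rw [hwc _ _ hdc, zero_mul]
    · have hm : Monotone (psi (hN (s p + P))) := monotone_nat_of_le_succ fun n => psi_le
      have h3 := hm (not_lt.1 hdc)
      have := htest _ (psi_mem (Finset.mem_range.1 hd).le) (lt_of_lt_of_le hp h3)
      exact mul_nonneg (hw0 _ _) (mul_nonneg (by positivity) this)
end TO

namespace TO

/-- Coefficients of the Legendre series. -/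
noncomputable def al (μ : ℝ) : ℕ → ℝ
  | 0 => 1
  | l+1 => al μ l * (((l:ℝ)-μ)*(l+μ+1)/((l:ℝ)+1)^2)

noncomputable def bl (μ : ℝ) (l : ℕ) : ℝ := l * al μ l

noncomputable def dl (μ : ℝ) (l : ℕ) : ℝ := bl μ (l+1) - bl μ l

lemma bl_succ (μ : ℝ) (l : ℕ) : bl μ (l+1) = al μ l * (((l:ℝ)-μ)*(l+μ+1)/((l:ℝ)+1)) := by
  unfold bl; rw [al]; push_cast
  have : (l:ℝ)+1 ≠ 0 := by positivity
  field_simp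

lemma dl_eq (μ : ℝ) (l : ℕ) : dl μ l = -(μ^2+μ) * al μ l / (l+1) := by
  unfold dl; rw [bl_succ]; unfold bl
  have : (l:ℝ)+1 ≠ 0 := by positivity
  field_simp; ring

section
variable {m : ℕ} {μ : ℝ} (hodd : Odd m) (h1 : (m:ℝ) < μ) (h2 : μ < m+1)
include hodd h1 h2

lemma al_sign (l : ℕ) (hl : l ≤ m + 1) : 0 < (-1)^l * al μ l := by
  induction l with
  | zero => simp [al]
  | succ l ih =>
    have := ih (by omega)
    have hlm : (l:ℝ) ≤ m := by exact_mod_cast (by omega : l ≤ m)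
    have hl0 : (0:ℝ) ≤ l := Nat.cast_nonneg l
    rw [al, pow_succ]
    have e : (-1)^l * -1 * (al μ l * (((l:ℝ)-μ)*(l+μ+1)/((l:ℝ)+1)^2)) = ((-1)^l * al μ l) * ((μ-l)*(l+μ+1)/((l:ℝ)+1)^2) := by ring
    rw [e]
    refine mul_pos this (div_pos (mul_pos (by linarith) ?_) (by positivity))
    have : (0:ℝ) ≤ m := Nat.cast_nonneg m
    linarith

lemma al_pos {l : ℕ} (hl : m + 1 ≤ l) : 0 < al μ l := by
  induction l, hl using Nat.le_induction with
  | base =>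
    have := al_sign hodd h1 h2 (m+1) le_rfl
    rwa [(Odd.add_one hodd).neg_one_pow, one_mul] at this
  | succ l hl ih =>
    rw [al]
    have := mu_lt h2 hl
    have hl0 : (0:ℝ) ≤ l := Nat.cast_nonneg l
    have : (0:ℝ) ≤ m := Nat.cast_nonneg m
    exact mul_pos ih (div_pos (mul_pos (by linarith) (by linarith)) (by positivity))

lemma dl_nonpos {l : ℕ} (hl : m + 1 ≤ l) : dl μ l ≤ 0 := by
  rw [dl_eq]
  have := al_pos hodd h1 h2 hl
  have hm : (0:ℝ) ≤ m := Nat.cast_nonneg m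
  have h0 : 0 < μ := by linarith
  have : 0 ≤ (μ^2+μ) * al μ l / (l+1) := by positivity
  rw [neg_mul, neg_div]; linarith

lemma bl_lim : ∃ b, 0 ≤ b ∧ Tendsto (bl μ) atTop (nhds b) := by
  have ha : Antitone (fun n => bl μ (n + (m+1))) := antitone_nat_of_succ_le fun n => by
    have := dl_nonpos hodd h1 h2 (l := n + (m+1)) (by omega)
    unfold dl at this
    rw [show n + 1 + (m+1) = n + (m+1) + 1 by ring]; linarith
  have h0 : ∀ n, 0 ≤ bl μ (n + (m+1)) := fun n => by
    have := al_pos hodd h1 h2 (l := n + (m+1)) (by omega)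
    unfold bl; positivity
  have := tendsto_atTop_ciInf ha ⟨0, by rintro _ ⟨n, rfl⟩; exact h0 n⟩
  refine ⟨_, ?_, (tendsto_add_atTop_iff_nat (m+1)).1 this⟩
  exact le_ciInf h0

lemma bl_bdd : ∃ C, ∀ l, |bl μ l| ≤ C := by
  obtain ⟨b, -, hb⟩ := bl_lim hodd h1 h2
  obtain ⟨C, hC⟩ := (Metric.isBounded_range_of_tendsto _ hb).exists_norm_le
  exact ⟨C, fun l => hC _ ⟨l, rfl⟩⟩

lemma al_bdd : ∃ C, 0 < C ∧ ∀ l : ℕ, |al μ l| ≤ C / (l+1) := by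
  obtain ⟨C, hC⟩ := bl_bdd hodd h1 h2
  have hC0 : 0 ≤ C := (abs_nonneg _).trans (hC 0)
  refine ⟨2*C+1, by linarith, fun l => ?_⟩
  rw [le_div_iff₀ (by positivity)]
  rcases Nat.eq_zero_or_pos l with h0 | h0
  · subst h0; simp [al]; linarith
  · have := hC l
    unfold bl at this
    have hl : (1:ℝ) ≤ l := by exact_mod_cast h0
    rw [abs_mul, abs_of_nonneg (by positivity)] at this
    nlinarith [abs_nonneg (al μ l)]

lemma dl_summable : Summable (fun l => |dl μ l|) := by
  obtain ⟨C, hC0, hC⟩ := al_bdd hodd h1 h2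
  have hm : (0:ℝ) ≤ m := Nat.cast_nonneg m
  have h0 : 0 < μ := by linarith
  have hs : Summable (fun l : ℕ => (μ^2+μ) * C * (1/((l+1:ℕ):ℝ)^2)) :=
    ((summable_nat_add_iff (f := fun n : ℕ => 1/(n:ℝ)^2) 1).2 (Real.summable_one_div_nat_pow.2 (by norm_num))).mul_left _
  refine Summable.of_nonneg_of_le (fun _ => abs_nonneg _) (fun l => ?_) hs
  rw [dl_eq, abs_div, abs_mul, abs_neg, abs_of_nonneg (a := μ^2+μ) (by positivity), abs_of_nonneg (a := (l:ℝ)+1) (by positivity)]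
  rw [div_le_iff₀ (by positivity)]
  calc (μ^2+μ) * |al μ l| ≤ (μ^2+μ) * (C/(l+1)) := by gcongr; exact hC l
    _ = _ := by push_cast; field_simp

lemma dl_hasSum {b : ℝ} (hb : Tendsto (bl μ) atTop (nhds b)) : HasSum (dl μ) b := by
  refine (Summable.of_abs (dl_summable hodd h1 h2)).hasSum_iff_tendsto_nat.2 ?_
  have : ∀ n, ∑ i ∈ Finset.range n, dl μ i = bl μ n := fun n => by
    unfold dl; rw [Finset.sum_range_sub]; simp [bl]
  simpa [this] using hb

end

/-- power series with coefficients c -/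
noncomputable def ps (c : ℕ → ℝ) (s : ℝ) : ℝ := ∑' l, c l * s^l

noncomputable def dc (c : ℕ → ℝ) (l : ℕ) : ℝ := (l+1) * c (l+1)

/-- coefficient growth -/
def PG (c : ℕ → ℝ) : Prop := ∃ C k, ∀ l : ℕ, |c l| ≤ C * ((l:ℝ)+1)^(k:ℕ)

lemma PG.dC {c : ℕ → ℝ} (h : PG c) : PG (dc c) := by
  obtain ⟨C, k, h⟩ := h
  refine ⟨C * 2^k, k+1, fun l => ?_⟩
  have hC : 0 ≤ C := by have := (abs_nonneg _).trans (h 0); simpa using this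
  unfold TO.dc
  rw [abs_mul, abs_of_nonneg (by positivity)]
  have := h (l+1)
  push_cast at this
  have h3 : ((l:ℝ)+1+1)^k ≤ (2*((l:ℝ)+1))^k := by
    gcongr; have : (0:ℝ) ≤ l := Nat.cast_nonneg l
    linarith
  calc ((l:ℝ)+1) * |c (l+1)| ≤ ((l:ℝ)+1) * (C * (2*((l:ℝ)+1))^k) := by gcongr; exact this.trans (by gcongr)
    _ = _ := by rw [mul_pow]; ring

lemma PG.summ {c : ℕ → ℝ} (h : PG c) {s : ℝ} (hs : |s| < 1) : Summable (fun l => |c l| * |s|^l) := by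
  obtain ⟨C, k, h⟩ := h
  have h1 : Summable (fun l : ℕ => ((l+1:ℕ):ℝ)^k * |s|^(l+1)) :=
    (summable_nat_add_iff (f := fun l : ℕ => (l:ℝ)^k * |s|^l) 1).2 (summable_pow_mul_geometric_of_norm_lt_one k (by simpa using hs))
  rcases eq_or_ne s 0 with h0 | h0
  · subst h0
    refine summable_of_ne_finset_zero (s := {0}) fun l hl => ?_
    simp at hl; simp [hl]
  · have h2 := h1.mul_left (C / |s|)
    refine Summable.of_nonneg_of_le (fun l => by positivity) (fun l => ?_) h2
    have : |s| ≠ 0 := abs_ne_zero.2 h0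
    calc |c l| * |s|^l ≤ C * ((l:ℝ)+1)^k * |s|^l := by gcongr; exact h l
      _ = _ := by push_cast; rw [pow_succ]; field_simp

lemma PG.hasSum {c : ℕ → ℝ} (h : PG c) {s : ℝ} (hs : |s| < 1) : HasSum (fun l => c l * s^l) (ps c s) := by
  refine Summable.hasSum (Summable.of_norm ?_)
  simpa [abs_mul] using h.summ hs

lemma PG.deriv {c : ℕ → ℝ} (h : PG c) {s : ℝ} (hs : |s| < 1) : HasDerivAt (ps c) (ps (dc c) s) s := by
  obtain ⟨q, hq1, hq2⟩ := exists_between hs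
  have hq0 : 0 ≤ q := (abs_nonneg s).trans hq1.le
  have hsq : |q| < 1 := by rwa [abs_of_nonneg hq0]
  have hsum := (summable_nat_add_iff (f := fun l : ℕ => |c l| * (l * q^(l-1))) 1).1 (by
    have := h.dC.summ hsq
    refine this.congr fun l => ?_
    unfold TO.dc
    rw [abs_mul, abs_of_nonneg (a := (l:ℝ)+1) (by positivity), abs_of_nonneg hq0]
    push_cast; try simp only [Nat.add_sub_cancel]
    ring)
  have key := hasDerivAt_tsum_of_isPreconnected (g := fun l s => c l * s^l) (g' := fun l s => c l * (l * s^(l-1))) hsum (isOpen_Ioo (a := -q) (b := q))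
    isPreconnected_Ioo (fun l y _ => by simpa using (hasDerivAt_pow l y).const_mul (c l))
    (fun l y hy => by
      rw [norm_mul, Real.norm_eq_abs, norm_mul, norm_pow, Real.norm_eq_abs, Real.norm_eq_abs, abs_of_nonneg (a := (l:ℝ)) (by positivity)]
      have : |y| ≤ q := abs_le.2 ⟨hy.1.le, hy.2.le⟩
      gcongr) (y₀ := s) (abs_lt.1 hq1) (h.hasSum hs).summable (abs_lt.1 hq1)
  refine key.congr_deriv ?_
  have hs2 : Summable (fun l : ℕ => c l * (l * s^(l-1))) := by
    refine (summable_nat_add_iff 1).1 ((h.dC.hasSum hs).summable.congr fun l => ?_)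
    unfold TO.dc; push_cast; try simp only [Nat.add_sub_cancel]
    ring
  rw [hs2.tsum_eq_zero_add]
  unfold ps TO.dc
  simp only [Nat.cast_zero, zero_mul, mul_zero, zero_add]
  refine tsum_congr fun l => ?_
  push_cast; ring

lemma PG.contDiffOn {c : ℕ → ℝ} (h : PG c) (n : ℕ) : ContDiffOn ℝ n (ps c) (Ioo (-1) 1) := by
  induction n generalizing c with
  | zero => 
    simp only [Nat.cast_zero, contDiffOn_zero]
    exact fun s hs => (h.deriv (abs_lt.2 hs)).continuousAt.continuousWithinAt
  | succ n ih =>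
    push_cast
    rw [contDiffOn_succ_iff_deriv_of_isOpen isOpen_Ioo]
    refine ⟨fun s hs => (h.deriv (abs_lt.2 hs)).differentiableAt.differentiableWithinAt, by simp, ?_⟩
    exact (ih h.dC).congr fun s hs => (h.deriv (abs_lt.2 hs)).deriv

section
variable {m : ℕ} {μ : ℝ} (hodd : Odd m) (h1 : (m:ℝ) < μ) (h2 : μ < m+1)
include hodd h1 h2

lemma al_PG : PG (al μ) := by
  obtain ⟨C, hC0, hC⟩ := al_bdd hodd h1 h2
  refine ⟨C, 0, fun l => (hC l).trans ?_⟩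
  rw [pow_zero, mul_one]
  exact div_le_self hC0.le (by linarith [(Nat.cast_nonneg l : (0:ℝ) ≤ l)])

lemma legendre_ode {s : ℝ} (hs : |s| < 1) :
    s * (1-s) * ps (dc (dc (al μ))) s + (1 - 2*s) * ps (dc (al μ)) s + (μ^2+μ) * ps (al μ) s = 0 := by
  have hP := al_PG hodd h1 h2
  have s0 := hP.hasSum hs
  have s1 := hP.dC.hasSum hs
  have s2 := hP.dC.dC.hasSum hs
  -- shifted sums
  have s1' : HasSum (fun l : ℕ => (l:ℝ) * al μ l * s^l) (s * ps (dc (al μ)) s) := by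
    rw [← hasSum_nat_add_iff' 1]
    simp only [Finset.range_one, Finset.sum_singleton, Nat.cast_zero, zero_mul, sub_zero]
    refine (s1.mul_left s).congr_fun ?_ |> id
    intro l; unfold dc; push_cast; ring
  have s2' : HasSum (fun l : ℕ => (l:ℝ) * (l+1) * al μ (l+1) * s^l) (s * ps (dc (dc (al μ))) s) := by
    rw [← hasSum_nat_add_iff' 1]
    simp only [Finset.range_one, Finset.sum_singleton, Nat.cast_zero, zero_mul, sub_zero]
    refine (s2.mul_left s).congr_fun ?_ |> id
    intro l; unfold dc; push_cast; ring
  have s2'' : HasSum (fun l : ℕ => (l:ℝ) * (l-1) * al μ l * s^l) (s * (s * ps (dc (dc (al μ))) s)) := by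
    rw [← hasSum_nat_add_iff' 1]
    simp only [Finset.range_one, Finset.sum_singleton, Nat.cast_zero, zero_mul, sub_zero]
    refine (s2'.mul_left s).congr_fun ?_ |> id
    intro l; push_cast; ring
  have tot := ((s2'.sub s2'').add (s1.sub (s1'.mul_left 2))).add (s0.mul_left (μ^2+μ))
  have hz : ∀ l : ℕ, (l:ℝ) * (l+1) * al μ (l+1) * s^l - (l:ℝ) * (l-1) * al μ l * s^l + (dc (al μ) l * s^l - 2 * ((l:ℝ) * al μ l * s^l)) + (μ^2+μ) * (al μ l * s^l) = 0 := by
    intro l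
    unfold dc; rw [al]
    have : (l:ℝ)+1 ≠ 0 := by positivity
    field_simp; ring
  have := tot.unique (hasSum_zero.congr_fun hz |> id)
  linarith

/-- H is (1-s) times the derivative of P, as an absolutely convergent series -/
lemma H_eq {s : ℝ} (hs : |s| < 1) : (1-s) * ps (dc (al μ)) s = ps (dl μ) s := by
  have hP := al_PG hodd h1 h2
  have s1 := hP.dC.hasSum hs
  have s1' : HasSum (fun l : ℕ => (l:ℝ) * al μ l * s^l) (s * ps (dc (al μ)) s) := by
    rw [← hasSum_nat_add_iff' 1]
    simp only [Finset.range_one, Finset.sum_singleton, Nat.cast_zero, zero_mul, sub_zero]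
    refine (s1.mul_left s).congr_fun ?_ |> id
    intro l; unfold dc; push_cast; ring
  have := s1.sub s1'
  have h3 : HasSum (fun l => dl μ l * s^l) (ps (dc (al μ)) s - s * ps (dc (al μ)) s) := by
    refine this.congr_fun ?_ |> id
    intro l; unfold dl bl dc; push_cast; ring
  have := h3.tsum_eq
  rw [show ps (dl μ) s = ∑' l, dl μ l * s^l from rfl, this]; ring

lemma H_cont : ContinuousOn (ps (dl μ)) (Icc (-1) 1) := by
  refine continuousOn_tsum (fun l => by fun_prop) (dl_summable hodd h1 h2) (fun l s hs => ?_)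
  rw [norm_mul, norm_pow, Real.norm_eq_abs, Real.norm_eq_abs]
  exact mul_le_of_le_one_right (abs_nonneg _) (pow_le_one₀ (abs_nonneg _) (abs_le.2 hs))

lemma H_one : 0 ≤ ps (dl μ) 1 := by
  obtain ⟨b, hb, hl⟩ := bl_lim hodd h1 h2
  unfold ps
  simp only [one_pow, mul_one]
  rw [(dl_hasSum hodd h1 h2 hl).tsum_eq]; exact hb

end
end TO

namespace TO

/-- Fourier coefficients of cos^{2l}(τ/2) -/
noncomputable def BB (l k : ℕ) : ℝ := ((2*l).choose (l+k) : ℝ) / 4^l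

lemma BB_nonneg (l k : ℕ) : 0 ≤ BB l k := by unfold BB; positivity

lemma BB_zero_of_lt {l k : ℕ} (h : l < k) : BB l k = 0 := by
  unfold BB; rw [Nat.choose_eq_zero_of_lt (by omega)]; simp

lemma BB_ratio (l k : ℕ) : ((l:ℝ)+k+1) * BB l (k+1) = ((l:ℝ)-k) * BB l k := by
  rcases le_or_gt k l with h | h
  · have := Nat.choose_succ_right_eq (2*l) (l+k)
    have h2 : ((2*l - (l+k) : ℕ):ℝ) = (l:ℝ) - k := by
      rw [show 2*l - (l+k) = l - k by omega, Nat.cast_sub h]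
    have h3 : ((2*l).choose (l+k+1) : ℝ) * ((l:ℝ)+k+1) = (2*l).choose (l+k) * ((l:ℝ)-k) := by
      rw [← h2]; exact_mod_cast this
    unfold BB
    rw [show l + (k+1) = l+k+1 by ring]
    field_simp; linarith
  · rw [BB_zero_of_lt h, BB_zero_of_lt (by omega : l < k+1)]; simp

lemma BB_pascal (l k : ℕ) : BB (l+1) (k+1) = 1/2 * BB l (k+1) + 1/4 * BB l k + 1/4 * BB l (k+2) := by
  have h : (2*(l+1)).choose (l+1+(k+1)) = (2*l).choose (l+k) + 2 * (2*l).choose (l+k+1) + (2*l).choose (l+k+2) := by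
    rw [show 2*(l+1) = 2*l+1+1 by ring, show l+1+(k+1) = l+k+1+1 by ring, Nat.choose_succ_succ, Nat.choose_succ_succ (2*l) (l+k), Nat.choose_succ_succ (2*l) (l+k+1)]
    ring
  unfold BB
  rw [h, show l+(k+1) = l+k+1 by ring, show l+(k+2) = l+k+2 by ring]
  push_cast; field_simp; ring

lemma BB_pascal0 (l : ℕ) : BB (l+1) 0 = 1/2 * BB l 0 + 1/2 * BB l 1 := by
  have h : (2*(l+1)).choose (l+1+0) = 2 * (2*l).choose l + 2 * (2*l).choose (l+1) := by
    rcases l with _ | l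
    · simp
    · rw [show 2*(l+1+1) = 2*(l+1)+1+1 by ring, show l+1+1+0 = l+1+1 by ring, Nat.choose_succ_succ, Nat.choose_succ_succ (2*(l+1)) l, Nat.choose_succ_succ (2*(l+1)) (l+1)]
      have : (2*(l+1)).choose l = (2*(l+1)).choose (l+1+1) := by
        rw [← Nat.choose_symm (by omega)]; congr 1; omega
      simp only [Nat.succ_eq_add_one]
      omega
  unfold BB
  rw [h, add_zero]
  push_cast; field_simp; ring

lemma BB_diag (l : ℕ) : BB (l+1) 0 = BB l 0 * ((2*l+1)/(2*l+2)) := by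
  have h1 := BB_ratio l 0
  have h2 := BB_pascal0 l
  simp only [Nat.cast_zero, add_zero, sub_zero, zero_add] at h1
  have : BB l 1 = l * BB l 0 / (l+1) := by
    rw [eq_div_iff (by positivity)]; linarith
  rw [h2, this]; field_simp; ring

lemma BB_sq (l : ℕ) : BB l 0 ^ 2 * (2*l+1) ≤ 1 := by
  induction l with
  | zero => simp [BB]
  | succ l ih =>
    rw [BB_diag]
    have e : (BB l 0 * ((2*l+1)/(2*l+2)))^2 * (2*((l+1:ℕ):ℝ)+1) = BB l 0 ^ 2 * (2*l+1) * ((2*l+1)*(2*l+3)/(2*l+2)^2) := by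
      push_cast; field_simp; ring
    rw [e]
    refine mul_le_one₀ ih (by positivity) ?_
    rw [div_le_one (by positivity)]; nlinarith

lemma BB_le0 (l k : ℕ) : BB l k ≤ BB l 0 := by
  unfold BB
  gcongr
  simpa [Nat.centralBinom] using Nat.choose_le_centralBinom (l+k) l

lemma BB_anti (l k : ℕ) : BB l (k+1) ≤ BB l k := by
  have h1 := BB_ratio l k
  have hx := BB_nonneg l k
  have hy := BB_nonneg l (k+1)
  have : (0:ℝ) ≤ k := Nat.cast_nonneg k
  have : (0:ℝ) ≤ l := Nat.cast_nonneg l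
  by_contra hc
  push Not at hc
  nlinarith

lemma BB_bound (l : ℕ) : BB l 0 ≤ 1 / ((l:ℝ)+1)^(1/2:ℝ) := by
  have h := BB_sq l
  have h0 := BB_nonneg l 0
  have hl : (0:ℝ) ≤ l := Nat.cast_nonneg l
  rw [← Real.sqrt_eq_rpow, le_div_iff₀ (by positivity)]
  rw [← Real.sqrt_sq h0, ← Real.sqrt_mul (sq_nonneg _)]
  rw [Real.sqrt_le_one]
  nlinarith [sq_nonneg (BB l 0)]

section
variable {m : ℕ} {μ : ℝ} (hodd : Odd m) (h1 : (m:ℝ) < μ) (h2 : μ < m+1)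
include hodd h1 h2

lemma aB_summable : Summable (fun l => |al μ l| * BB l 0) := by
  obtain ⟨C, hC0, hC⟩ := al_bdd hodd h1 h2
  have hs : Summable (fun l : ℕ => C * (1/((l+1:ℕ):ℝ)^(3/2:ℝ))) :=
    ((summable_nat_add_iff (f := fun n : ℕ => 1/(n:ℝ)^(3/2:ℝ)) 1).2 (Real.summable_one_div_nat_rpow.2 (by norm_num))).mul_left _
  refine Summable.of_nonneg_of_le (fun l => mul_nonneg (abs_nonneg _) (BB_nonneg l 0)) (fun l => ?_) hs
  have hp : (0:ℝ) < (l:ℝ)+1 := by positivity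
  calc |al μ l| * BB l 0 ≤ C/((l:ℝ)+1) * (1 / ((l:ℝ)+1)^(1/2:ℝ)) := by
        gcongr
        · exact BB_nonneg l 0
        · exact hC l
        · exact BB_bound l
    _ = _ := by
      push_cast
      rw [show (3/2:ℝ) = 1 + 1/2 by norm_num, Real.rpow_add hp, Real.rpow_one]
      field_simp

lemma aBk_summable (k : ℕ) : Summable (fun l => |al μ l * BB l k|) := by
  refine Summable.of_nonneg_of_le (fun l => abs_nonneg _) (fun l => ?_) (aB_summable hodd h1 h2)
  rw [abs_mul, abs_of_nonneg (BB_nonneg l k)]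
  exact mul_le_mul_of_nonneg_left (BB_le0 l k) (abs_nonneg _)

end

noncomputable def Gh (μ : ℝ) (k : ℕ) : ℝ := ∑' l, al μ l * BB l k

section
variable {m : ℕ} {μ : ℝ} (hodd : Odd m) (h1 : (m:ℝ) < μ) (h2 : μ < m+1)
include hodd h1 h2

lemma Gh_hasSum (k : ℕ) : HasSum (fun l => al μ l * BB l k) (Gh μ k) :=
  (Summable.of_abs (aBk_summable hodd h1 h2 k)).hasSum

lemma BB_tend (k : ℕ) : Tendsto (fun l => BB l k) atTop (nhds 0) := by
  have h : Tendsto (fun l : ℕ => 1 / ((l:ℝ)+1)^(1/2:ℝ)) atTop (nhds 0) := by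
    have := (tendsto_rpow_neg_atTop (show (0:ℝ) < 1/2 by norm_num)).comp (tendsto_atTop_add_const_right atTop (1:ℝ) tendsto_natCast_atTop_atTop)
    refine this.congr fun l => ?_
    show ((l:ℝ)+1)^(-(1/2:ℝ)) = _
    rw [Real.rpow_neg (by positivity)]; exact (one_div _).symm
  exact squeeze_zero (fun l => BB_nonneg l k) (fun l => (BB_le0 l k).trans (BB_bound l)) h

lemma Gh_rec (j : ℕ) : ((j:ℝ)+1-μ)*(j+μ+2) * Gh μ (j+2) = ((j:ℝ)-μ)*(j+μ+1) * Gh μ j := by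
  have s := ((Gh_hasSum hodd h1 h2 (j+2)).mul_left (((j:ℝ)+1-μ)*(j+μ+2))).sub ((Gh_hasSum hodd h1 h2 j).mul_left (((j:ℝ)-μ)*(j+μ+1)))
  have ht := s.tendsto_sum_nat
  have hterm : ∀ l, ((j:ℝ)+1-μ)*(j+μ+2) * (al μ l * BB l (j+2)) - ((j:ℝ)-μ)*(j+μ+1) * (al μ l * BB l j) =
      (-4*((j:ℝ)+1)) * (bl μ (l+1) * BB (l+1) (j+1)) - (-4*((j:ℝ)+1)) * (bl μ l * BB l (j+1)) := by
    intro l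
    rw [bl_succ]
    unfold bl
    have r1 := BB_ratio l j
    have r2 := BB_ratio l (j+1)
    have p := BB_pascal l j
    push_cast at r2
    rw [show j+1+1 = j+2 by ring] at r2
    have hl : (l:ℝ)+1 ≠ 0 := by positivity
    have I1 : 4 * ((j:ℝ)+1) * BB (l+1) (j+1) = ((l:ℝ)+1) * (BB l j - BB l (j+2)) := by
      rw [p]; linear_combination r1 + r2
    have e : (-4*((j:ℝ)+1)) * (al μ l * (((l:ℝ)-μ)*(l+μ+1)/((l:ℝ)+1)) * BB (l+1) (j+1)) = - al μ l * (((l:ℝ)-μ)*(l+μ+1)) * (BB l j - BB l (j+2)) := by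
      have : BB (l+1) (j+1) * (4 * ((j:ℝ)+1)) = ((l:ℝ)+1) * (BB l j - BB l (j+2)) := by linarith
      field_simp
      linear_combination (-al μ l * (l - μ) * (l+μ+1)) * this
    rw [e]
    linear_combination (-al μ l * ((l:ℝ)-(j+1))) * r2 - (al μ l * ((l:ℝ)+(j+1))) * r1
  have hsum : ∀ n, ∑ l ∈ Finset.range n, (((j:ℝ)+1-μ)*(j+μ+2) * (al μ l * BB l (j+2)) - ((j:ℝ)-μ)*(j+μ+1) * (al μ l * BB l j)) =
      (-4*((j:ℝ)+1)) * (bl μ n * BB n (j+1)) := by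
    intro n
    rw [Finset.sum_congr rfl fun l _ => hterm l, Finset.sum_range_sub (fun l => (-4*((j:ℝ)+1)) * (bl μ l * BB l (j+1)))]
    simp [bl]
  simp only [hsum] at ht
  obtain ⟨b, -, hb⟩ := bl_lim hodd h1 h2
  have h0 := (hb.mul (BB_tend hodd h1 h2 (j+1))).const_mul (-4*((j:ℝ)+1))
  have := tendsto_nhds_unique ht h0
  simp at this
  linarith

lemma Gh_cc_two (j : ℕ) : cc μ (j+2) * Gh μ (j+2) = cc μ j * Gh μ j := by
  have hr := Gh_rec hodd h1 h2 j
  have c0 := cc_mul h1 h2 j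
  have c1 := cc_mul h1 h2 (j+1)
  push_cast at c1
  apply mul_left_cancel₀ (cc_ne h1 h2 (j+1))
  rw [show j+1+1 = j+2 by ring] at c1
  linear_combination hr + Gh μ (j+2) * c1 - Gh μ j * c0

lemma Gh_pos {k : ℕ} (hk : m + 1 ≤ k) : 0 < Gh μ k := by
  have hs := Gh_hasSum hodd h1 h2 k
  have h0 : ∀ l, 0 ≤ al μ l * BB l k := fun l => by
    rcases lt_or_ge l k with h | h
    · simp [BB_zero_of_lt h]
    · exact mul_nonneg (al_pos hodd h1 h2 (by omega)).le (BB_nonneg _ _)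
  refine hs.summable.tsum_pos h0 k (mul_pos (al_pos hodd h1 h2 hk) ?_)
  unfold BB
  rw [show k + k = 2*k by ring, Nat.choose_self]; positivity

lemma Gh_anti {k : ℕ} (hk : m + 1 ≤ k) : Gh μ (k+1) ≤ Gh μ k := by
  refine (Gh_hasSum hodd h1 h2 (k+1)).summable.tsum_le_tsum (fun l => ?_) (Gh_hasSum hodd h1 h2 k).summable
  rcases lt_or_ge l k with h | h
  · simp [BB_zero_of_lt h, BB_zero_of_lt (show l < k+1 by omega)]
  · exact mul_le_mul_of_nonneg_left (BB_anti l k) (al_pos hodd h1 h2 (by omega)).le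

lemma Gh_cc : ∃ κ, 0 < κ ∧ ∀ k, cc μ k * Gh μ k = κ := by
  have he : ∀ n, cc μ (2*n) * Gh μ (2*n) = cc μ 0 * Gh μ 0 := fun n => by
    induction n with
    | zero => rfl
    | succ n ih => rw [← ih, show 2*(n+1) = 2*n+2 by ring]; exact Gh_cc_two hodd h1 h2 _
  have ho : ∀ n, cc μ (2*n+1) * Gh μ (2*n+1) = cc μ 1 * Gh μ 1 := fun n => by
    induction n with
    | zero => rfl
    | succ n ih => rw [← ih, show 2*(n+1)+1 = 2*n+1+2 by ring]; exact Gh_cc_two hodd h1 h2 _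
  have hstep : ∀ k, m+1 ≤ k → cc μ (k+1) * Gh μ (k+1) ≤ cc μ (k+1) / cc μ k * (cc μ k * Gh μ k) := fun k hk => by
    have := cc_pos h1 h2 hk
    have h3 := cc_pos h1 h2 (show m+1 ≤ k+1 by omega)
    rw [show cc μ (k+1) / cc μ k * (cc μ k * Gh μ k) = cc μ (k+1) * Gh μ k by field_simp]
    exact mul_le_mul_of_nonneg_left (Gh_anti hodd h1 h2 hk) h3.le
  have hrat := cc_ratio h1 h2
  have t2 : Tendsto (fun n : ℕ => 2*n) atTop atTop := tendsto_atTop_mono (fun n => by simp only [id]; omega) tendsto_id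
  have t3 : Tendsto (fun n : ℕ => 2*n+1) atTop atTop := tendsto_atTop_mono (fun n => by simp only [id]; omega) tendsto_id
  have le1 : cc μ 1 * Gh μ 1 ≤ cc μ 0 * Gh μ 0 := by
    have := (hrat.comp t2).mul_const (cc μ 0 * Gh μ 0)
    rw [one_mul] at this
    refine ge_of_tendsto this ?_
    filter_upwards [eventually_ge_atTop (m+1)] with n hn
    have := hstep (2*n) (by omega)
    rwa [ho, he] at this
  have le2 : cc μ 0 * Gh μ 0 ≤ cc μ 1 * Gh μ 1 := by
    have := (hrat.comp t3).mul_const (cc μ 1 * Gh μ 1)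
    rw [one_mul] at this
    refine ge_of_tendsto this ?_
    filter_upwards [eventually_ge_atTop (m+1)] with n hn
    have := hstep (2*n+1) (by omega)
    rwa [ho, show 2*n+1+1 = 2*(n+1) by ring, he] at this
  refine ⟨cc μ 0 * Gh μ 0, ?_, fun k => ?_⟩
  · rw [← he (m+1)]
    exact mul_pos (cc_pos h1 h2 (by omega)) (Gh_pos hodd h1 h2 (by omega))
  · rcases Nat.even_or_odd' k with ⟨n, rfl | rfl⟩
    · exact he n
    · rw [ho]; exact le_antisymm le1 le2

end

/-- trigonometric integrals -/
lemma BB_int (l k : ℕ) : ∫ τ in (-π)..π, ((1 + cos τ)/2)^l * cos (k*τ) = 2 * π * BB l k := by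
  have hpi := Real.pi_pos
  have hI : ∀ (l k : ℕ), IntervalIntegrable (fun τ => ((1 + cos τ)/2)^l * cos (k*τ)) MeasureTheory.volume (-π) π :=
    fun l k => Continuous.intervalIntegrable (by fun_prop) _ _
  induction l generalizing k with
  | zero =>
    rcases k with _ | k
    · simp [BB]; ring
    · have hk : ((k+1:ℕ):ℝ) ≠ 0 := by positivity
      simp only [pow_zero, one_mul]
      rw [intervalIntegral.integral_comp_mul_left _ hk, BB_zero_of_lt (by omega : 0 < k+1)]
      rw [integral_cos]
      have : ((k+1:ℕ):ℝ) * -π = -(((k+1:ℕ):ℝ) * π) := by ring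
      rw [this, Real.sin_neg, Real.sin_nat_mul_pi]; simp
  | succ l ih =>
    rcases k with _ | k
    · have e : ∀ τ, ((1 + cos τ)/2)^(l+1) * cos ((0:ℕ)*τ) = 1/2 * (((1 + cos τ)/2)^l * cos ((0:ℕ)*τ)) + 1/2 * (((1 + cos τ)/2)^l * cos ((1:ℕ)*τ)) := by
        intro τ; simp; ring
      simp only [e]
      rw [intervalIntegral.integral_add ((hI l 0).const_mul _) ((hI l 1).const_mul _), intervalIntegral.integral_const_mul, intervalIntegral.integral_const_mul, ih, ih, BB_pascal0]
      ring
    · have e : ∀ τ, ((1 + cos τ)/2)^(l+1) * cos ((k+1:ℕ)*τ) = 1/2 * (((1 + cos τ)/2)^l * cos ((k+1:ℕ)*τ)) + 1/4 * (((1 + cos τ)/2)^l * cos ((k:ℕ)*τ)) + 1/4 * (((1 + cos τ)/2)^l * cos ((k+2:ℕ)*τ)) := by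
        intro τ
        have a1 : cos ((k:ℕ)*τ) = cos ((k+1:ℕ)*τ) * cos τ + sin ((k+1:ℕ)*τ) * sin τ := by
          rw [← Real.cos_sub]; congr 1; push_cast; ring
        have a2 : cos ((k+2:ℕ)*τ) = cos ((k+1:ℕ)*τ) * cos τ - sin ((k+1:ℕ)*τ) * sin τ := by
          rw [← Real.cos_add]; congr 1; push_cast; ring
        rw [a1, a2]; ring
      simp only [e]
      rw [intervalIntegral.integral_add (((hI l (k+1)).const_mul _).add ((hI l k).const_mul _)) ((hI l (k+2)).const_mul _),
        intervalIntegral.integral_add ((hI l (k+1)).const_mul _) ((hI l k).const_mul _), intervalIntegral.integral_const_mul, intervalIntegral.integral_const_mul, intervalIntegral.integral_const_mul, ih, ih, ih, BB_pascal]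
      ring
end TO

namespace TO

abbrev E3 := Fin 3 → ℝ

section
variable {S : Set ℝ} {W : Set (E3 × ℝ)} {R : ℝ → ℝ} {B : ℝ}

/-- parametric integral -/
noncomputable def pint {G : Type} [NormedAddCommGroup G] [NormedSpace ℝ G] (S : Set ℝ) (R : ℝ → ℝ) (F : E3 × ℝ → G) (x : E3) : G :=
  ∫ θ in S, R θ • F (x, θ)

/-- derivative in the first variable -/
noncomputable def F1 {G : Type} [NormedAddCommGroup G] [NormedSpace ℝ G] (F : E3 × ℝ → G) (p : E3 × ℝ) : E3 →L[ℝ] G :=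
  (fderiv ℝ F p).comp (ContinuousLinearMap.inl ℝ E3 ℝ)

/-- good base points -/
def UU (S : Set ℝ) (W : Set (E3 × ℝ)) : Set E3 := {x | ∀ θ ∈ S, (x, θ) ∈ W}

variable (hS : IsCompact S) (hW : IsOpen W)
include hS hW

lemma tube {x0 : E3} (hx : x0 ∈ UU S W) : ∃ ε > 0, ∀ x ∈ Metric.closedBall x0 ε, x ∈ UU S W := by
  obtain ⟨u, v, hu, hv, h0, hSv, huv⟩ := generalized_tube_lemma (isCompact_singleton (x := x0)) hS hW (by
    rintro ⟨a, b⟩ ⟨ha, hb⟩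
    rw [mem_singleton_iff] at ha
    simp only at ha hb
    rw [ha]; exact hx b hb)
  obtain ⟨ε, hε, hb⟩ := Metric.nhds_basis_closedBall.mem_iff.1 (hu.mem_nhds (h0 rfl))
  exact ⟨ε, hε, fun x hx θ hθ => huv ⟨hb hx, hSv hθ⟩⟩

lemma UU_open : IsOpen (UU S W) := by
  rw [Metric.isOpen_iff]
  intro x hx
  obtain ⟨ε, hε, h⟩ := tube hS hW hx
  exact ⟨ε, hε, fun y hy => h y (Metric.ball_subset_closedBall hy)⟩

lemma tube_bd {G : Type} [NormedAddCommGroup G] [NormedSpace ℝ G] {F : E3 × ℝ → G} (hF : ContinuousOn F W) {x0 : E3} (hx : x0 ∈ UU S W) :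
    ∃ ε > 0, ∃ C, ∀ x ∈ Metric.closedBall x0 ε, x ∈ UU S W ∧ ∀ θ ∈ S, ‖F (x, θ)‖ ≤ C := by
  obtain ⟨ε, hε, h⟩ := tube hS hW hx
  obtain ⟨C, hC⟩ := ((isCompact_closedBall x0 ε).prod hS).exists_bound_of_continuousOn (hF.mono (by
    rintro ⟨a, b⟩ ⟨ha, hb⟩; exact h a ha b hb))
  exact ⟨ε, hε, C, fun x hx => ⟨h x hx, fun θ hθ => hC (x, θ) ⟨hx, hθ⟩⟩⟩

variable (hR : Measurable R) (hB : ∀ θ, |R θ| ≤ B)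
include hR hB

omit hW hB in
lemma pint_meas {G : Type} [NormedAddCommGroup G] [NormedSpace ℝ G] {F : E3 × ℝ → G} (hF : ContinuousOn F W) {x : E3} (hx : x ∈ UU S W) :
    MeasureTheory.AEStronglyMeasurable (fun θ => R θ • F (x, θ)) (MeasureTheory.volume.restrict S) := by
  refine MeasureTheory.AEStronglyMeasurable.smul hR.aestronglyMeasurable ?_
  refine ContinuousOn.aestronglyMeasurable ?_ hS.measurableSet
  exact hF.comp (by fun_prop) (fun θ hθ => hx θ hθ)

lemma pint_cont {G : Type} [NormedAddCommGroup G] [NormedSpace ℝ G] {F : E3 × ℝ → G} (hF : ContinuousOn F W) {x0 : E3} (hx : x0 ∈ UU S W) :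
    ContinuousAt (pint S R F) x0 := by
  obtain ⟨ε, hε, C, h⟩ := tube_bd hS hW hF hx
  refine MeasureTheory.continuousAt_of_dominated (bound := fun _ => B * C) ?_ ?_ ?_ ?_
  · filter_upwards [Metric.closedBall_mem_nhds x0 hε] with x hx
    exact pint_meas hS hR hF (h x hx).1
  · filter_upwards [Metric.closedBall_mem_nhds x0 hε] with x hx
    filter_upwards [MeasureTheory.ae_restrict_mem hS.measurableSet] with θ hθ
    rw [norm_smul, Real.norm_eq_abs]
    exact mul_le_mul (hB θ) ((h x hx).2 θ hθ) (norm_nonneg _) ((abs_nonneg _).trans (hB θ))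
  · exact MeasureTheory.integrableOn_const hS.measure_lt_top.ne
  · filter_upwards [MeasureTheory.ae_restrict_mem hS.measurableSet] with θ hθ
    have h3 := hF.continuousAt (hW.mem_nhds (hx θ hθ))
    have h4 : ContinuousAt (fun x : E3 => (x, θ)) x0 := by fun_prop
    exact (ContinuousAt.comp (f := fun x : E3 => (x, θ)) h3 h4).const_smul _

lemma pint_deriv {G : Type} [NormedAddCommGroup G] [NormedSpace ℝ G] [CompleteSpace G] {F : E3 × ℝ → G} (hF : ContDiffOn ℝ 1 F W) {x0 : E3} (hx : x0 ∈ UU S W) :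
    HasFDerivAt (pint S R F) (pint S R (F1 F) x0) x0 := by
  have hF0 := hF.continuousOn
  have hF1 : ContinuousOn (F1 F) W :=
    (hF.continuousOn_fderiv_of_isOpen hW le_rfl).clm_comp continuousOn_const
  obtain ⟨ε, hε, C, h⟩ := tube_bd hS hW hF1 hx
  obtain ⟨ε', hε', C', h'⟩ := tube_bd hS hW hF0 hx
  unfold pint
  refine hasFDerivAt_integral_of_dominated_of_fderiv_le (𝕜 := ℝ) (F := fun (x : E3) θ => R θ • F (x, θ)) (F' := fun (x : E3) θ => R θ • F1 F (x, θ)) (bound := fun _ => B * C) (Metric.closedBall_mem_nhds x0 hε) ?_ ?_ ?_ ?_ ?_ ?_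
  · filter_upwards [Metric.closedBall_mem_nhds x0 hε] with x hx
    exact pint_meas hS hR hF0 (h x hx).1
  · refine MeasureTheory.Integrable.mono' (g := fun _ => B * C') (MeasureTheory.integrableOn_const hS.measure_lt_top.ne) (pint_meas hS hR hF0 hx) ?_
    filter_upwards [MeasureTheory.ae_restrict_mem hS.measurableSet] with θ hθ
    rw [norm_smul, Real.norm_eq_abs]
    exact mul_le_mul (hB θ) ((h' x0 (Metric.mem_closedBall_self hε'.le)).2 θ hθ) (norm_nonneg _) ((abs_nonneg _).trans (hB θ))
  · exact pint_meas hS hR hF1 hx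
  · filter_upwards [MeasureTheory.ae_restrict_mem hS.measurableSet] with θ hθ x hx
    rw [norm_smul, Real.norm_eq_abs]
    exact mul_le_mul (hB θ) ((h x hx).2 θ hθ) (norm_nonneg _) ((abs_nonneg _).trans (hB θ))
  · exact MeasureTheory.integrableOn_const hS.measure_lt_top.ne
  · filter_upwards [MeasureTheory.ae_restrict_mem hS.measurableSet] with θ hθ x hx
    have hd := ((hF.contDiffAt (hW.mem_nhds ((h x hx).1 θ hθ))).differentiableAt (by simp)).hasFDerivAt
    have hi : HasFDerivAt (fun x : E3 => (x, θ)) (ContinuousLinearMap.inl ℝ E3 ℝ) x := hasFDerivAt_prodMk_left x θ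
    exact (hd.comp x hi).const_smul (R θ)

lemma pint_contDiff {G : Type} [NormedAddCommGroup G] [NormedSpace ℝ G] [CompleteSpace G] {F : E3 × ℝ → G} (n : ℕ) (hF : ContDiffOn ℝ n F W) :
    ContDiffOn ℝ n (pint S R F) (UU S W) := by
  induction n generalizing G with
  | zero =>
    simp only [Nat.cast_zero, contDiffOn_zero] at hF ⊢
    exact fun x hx => (pint_cont hS hW hR hB hF hx).continuousWithinAt
  | succ n ih =>
    push_cast at hF ⊢
    have h1 : ContDiffOn ℝ 1 F W := hF.of_le (by simp)
    rw [contDiffOn_succ_iff_fderiv_of_isOpen (UU_open hS hW)]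
    refine ⟨fun x hx => (pint_deriv hS hW hR hB h1 hx).differentiableAt.differentiableWithinAt, by simp, ?_⟩
    have hF1 : ContDiffOn ℝ n (F1 F) W :=
      (hF.fderiv_of_isOpen hW le_rfl).clm_comp contDiffOn_const
    exact (ih hF1).congr fun x hx => (pint_deriv hS hW hR hB h1 hx).fderiv

lemma F1_int {G : Type} [NormedAddCommGroup G] [NormedSpace ℝ G] {F : E3 × ℝ → G} (hF : ContDiffOn ℝ 1 F W) {x0 : E3} (hx : x0 ∈ UU S W) :
    MeasureTheory.Integrable (fun θ => R θ • F1 F (x0, θ)) (MeasureTheory.volume.restrict S) := by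
  have hF1 : ContinuousOn (F1 F) W :=
    (hF.continuousOn_fderiv_of_isOpen hW le_rfl).clm_comp continuousOn_const
  obtain ⟨ε, hε, C, h⟩ := tube_bd hS hW hF1 hx
  refine MeasureTheory.Integrable.mono' (g := fun _ => B * C) (MeasureTheory.integrableOn_const hS.measure_lt_top.ne) (pint_meas hS hR hF1 hx) ?_
  filter_upwards [MeasureTheory.ae_restrict_mem hS.measurableSet] with θ hθ
  rw [norm_smul, Real.norm_eq_abs]
  exact mul_le_mul (hB θ) ((h x0 (Metric.mem_closedBall_self hε.le)).2 θ hθ) (norm_nonneg _) ((abs_nonneg _).trans (hB θ))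

lemma pint_pd {F : E3 × ℝ → ℝ} (hF : ContDiffOn ℝ 1 F W) {x0 : E3} (hx : x0 ∈ UU S W) (i : Fin 3) :
    pd i (pint S R F) x0 = pint S R (fun p => F1 F p (Pi.single i 1)) x0 := by
  unfold pd
  rw [(pint_deriv hS hW hR hB hF hx).fderiv]
  unfold pint
  rw [ContinuousLinearMap.integral_apply (F1_int hS hW hR hB hF hx)]
  rfl

end
end TO

namespace TO

noncomputable def rho (x : E3) : ℝ := √(x 0 ^2 + x 1 ^2 + x 2 ^2)
noncomputable def ev (θ : ℝ) : Fin 3 → ℝ := ![cos θ, sin θ, 0]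
noncomputable def qq (x : E3) (θ : ℝ) : ℝ := x 0 * cos θ + x 1 * sin θ
noncomputable def ss (x : E3) (θ : ℝ) : ℝ := 1/2 + qq x θ / (2 * rho x)
def WW : Set (E3 × ℝ) := {p | 0 < rho p.1 ∧ qq p.1 p.2 < rho p.1}
/-- homogeneous zonal function -/
noncomputable def zz (ν : ℝ) (F : ℝ → ℝ) (p : E3 × ℝ) : ℝ := rho p.1 ^ ν * F (ss p.1 p.2)

lemma rho_cont : Continuous rho := by unfold rho; fun_prop

lemma qq_cont : Continuous (fun p : E3 × ℝ => qq p.1 p.2) := by unfold qq; fun_prop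

lemma WW_open : IsOpen WW := by
  refine (isOpen_lt continuous_const (rho_cont.comp continuous_fst)).inter (isOpen_lt qq_cont (rho_cont.comp continuous_fst))

lemma rho_sq (x : E3) : rho x ^ 2 = x 0 ^2 + x 1 ^2 + x 2 ^2 := by
  unfold rho; exact Real.sq_sqrt (by positivity)

lemma rho_nonneg (x : E3) : 0 ≤ rho x := Real.sqrt_nonneg _

lemma qq_sq_le (x : E3) (θ : ℝ) : qq x θ ^ 2 ≤ x 0 ^2 + x 1 ^2 := by
  have e : x 0 ^2 + x 1 ^2 - qq x θ ^2 = (x 0 * sin θ - x 1 * cos θ)^2 := by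
    unfold qq
    have h := Real.sin_sq_add_cos_sq θ
    linear_combination (-(x 0^2) - x 1 ^2) * h
  nlinarith [sq_nonneg (x 0 * sin θ - x 1 * cos θ)]

lemma abs_qq_le (x : E3) (θ : ℝ) : |qq x θ| ≤ rho x := by
  refine abs_le_of_sq_le_sq ?_ (rho_nonneg x)
  rw [rho_sq]; nlinarith [qq_sq_le x θ, sq_nonneg (x 2)]

lemma ss_nonneg (x : E3) (θ : ℝ) : 0 ≤ ss x θ ∧ ss x θ ≤ 1 := by
  unfold ss
  rcases (rho_nonneg x).eq_or_lt with h | h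
  · rw [← h]; norm_num
  · have := abs_le.1 (abs_qq_le x θ)
    have a : -(1/2) ≤ qq x θ / (2 * rho x) := by rw [le_div_iff₀ (by positivity)]; linarith
    have b : qq x θ / (2 * rho x) ≤ 1/2 := by rw [div_le_iff₀ (by positivity)]; linarith
    constructor <;> linarith

lemma ss_mem {p : E3 × ℝ} (hp : p ∈ WW) : ss p.1 p.2 ∈ Ioo (-1:ℝ) 1 := by
  have h0 := (ss_nonneg p.1 p.2).1
  refine ⟨by linarith, ?_⟩
  have : qq p.1 p.2 / (2 * rho p.1) < 1/2 := by rw [div_lt_iff₀ (by linarith [hp.1])]; linarith [hp.2]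
  unfold ss; linarith

lemma ss_lt {p : E3 × ℝ} (hp : p ∈ WW) : |ss p.1 p.2| < 1 := abs_lt.2 (ss_mem hp)

lemma rho_contDiff (n : ℕ) : ContDiffOn ℝ n (fun p : E3 × ℝ => rho p.1) WW := by
  unfold rho
  refine ContDiffOn.sqrt (by fun_prop) ?_
  intro p hp
  rw [← rho_sq]
  exact (pow_pos hp.1 2).ne'

lemma zz_contDiff {ν : ℝ} {F : ℝ → ℝ} (n : ℕ) (hF : ContDiffOn ℝ n F (Ioo (-1) 1)) : ContDiffOn ℝ n (zz ν F) WW := by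
  have hr := rho_contDiff n
  unfold zz
  refine ContDiffOn.mul (hr.rpow_const_of_ne fun p hp => hp.1.ne') ?_
  refine hF.comp (f := fun p : E3 × ℝ => ss p.1 p.2) (t := Ioo (-1) 1) ?_ (fun p hp => ss_mem hp)
  unfold ss
  refine contDiffOn_const.add (ContDiffOn.div ?_ (contDiffOn_const.mul hr) fun p hp => by
    have := hp.1
    positivity)
  unfold qq
  fun_prop

lemma rho_line (x : E3) (i : Fin 3) (t : ℝ) : rho (x + t • (Pi.single i 1 : E3)) = √(rho x ^2 + 2 * t * x i + t^2) := by
  rw [rho_sq]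
  unfold rho
  congr 1
  fin_cases i <;> simp [Pi.single_apply] <;> ring

lemma qq_line (x : E3) (i : Fin 3) (t θ : ℝ) : qq (x + t • (Pi.single i 1 : E3)) θ = qq x θ + t * ev θ i := by
  unfold qq ev
  fin_cases i <;> simp [Pi.single_apply] <;> ring

lemma zz_line {ν : ℝ} {F : ℝ → ℝ} {f' : ℝ} {p : E3 × ℝ} (hp : p ∈ WW) (hF : HasDerivAt F f' (ss p.1 p.2)) (i : Fin 3) :
    HasDerivAt (fun t : ℝ => zz ν F (p.1 + t • (Pi.single i 1 : E3), p.2))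
      (rho p.1 ^ (ν-2) * p.1 i * (ν * F (ss p.1 p.2) - (ss p.1 p.2 - 1/2) * f') + rho p.1 ^ (ν-1) * (ev p.2 i / 2) * f') 0 := by
  obtain ⟨x, θ⟩ := p
  have hr : 0 < rho x := hp.1
  have h1 : HasDerivAt (fun t : ℝ => rho (x + t • (Pi.single i 1 : E3))) (x i / rho x) 0 := by
    simp only [rho_line]
    have ha : HasDerivAt (fun t : ℝ => rho x ^2 + 2 * t * x i + t^2) (2 * x i) 0 := by
      have this : HasDerivAt (fun t : ℝ => rho x ^2 + 2 * t * x i + t^2) _ 0 := (((hasDerivAt_id (0:ℝ)).const_mul 2).mul_const (x i)).const_add (rho x ^2) |>.add (hasDerivAt_pow 2 (0:ℝ))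
      exact this.congr_deriv (by simp)
    have := ha.sqrt (by simp; exact hr.ne')
    convert this using 1
    simp [Real.sqrt_sq hr.le]
    field_simp
  have hx0 : x + (0:ℝ) • (Pi.single i 1 : E3) = x := by simp
  have h2 : HasDerivAt (fun t : ℝ => rho (x + t • (Pi.single i 1 : E3)) ^ ν) (x i / rho x * ν * rho x ^ (ν-1)) 0 := by
    have := h1.rpow_const (p := ν) (Or.inl (by rw [hx0]; exact hr.ne'))
    rwa [hx0] at this
  have hq : HasDerivAt (fun t : ℝ => qq (x + t • (Pi.single i 1 : E3)) θ) (ev θ i) 0 := by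
    simp only [qq_line]
    simpa using ((hasDerivAt_id (0:ℝ)).mul_const (ev θ i)).const_add (qq x θ)
  have h3 : HasDerivAt (fun t : ℝ => ss (x + t • (Pi.single i 1 : E3)) θ) (ev θ i / (2 * rho x) - qq x θ * x i / (2 * rho x ^3)) 0 := by
    have := (hq.div (h1.const_mul 2) (by rw [hx0]; positivity)).const_add (1/2)
    rw [hx0] at this
    refine this.congr_deriv ?_
    field_simp
  have h4 := HasDerivAt.comp (h₂ := F) (h := fun t : ℝ => ss (x + t • (Pi.single i 1 : E3)) θ) (0:ℝ) (by rw [hx0]; exact hF) h3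
  have h5 := h2.mul h4
  simp only [Function.comp, hx0] at h5
  refine h5.congr_deriv ?_
  have e1 : rho x ^ (ν-1) = rho x ^ (ν-2) * rho x := by
    rw [← Real.rpow_add_one hr.ne']; congr 1; ring
  have e0 : rho x ^ ν = rho x ^ (ν-2) * rho x ^2 := by
    rw [← Real.rpow_natCast, ← Real.rpow_add hr]; congr 1; push_cast; ring
  have es : ss x θ - 1/2 = qq x θ / (2 * rho x) := by unfold ss; ring
  simp only []
  rw [e1, e0, es]
  field_simp
  ring

lemma F1_line {F : E3 × ℝ → ℝ} {p : E3 × ℝ} (hF : DifferentiableAt ℝ F p) {i : Fin 3} {d : ℝ}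
    (h : HasDerivAt (fun t : ℝ => F (p.1 + t • (Pi.single i 1 : E3), p.2)) d 0) : F1 F p (Pi.single i 1) = d := by
  have h1 : HasDerivAt (fun t : ℝ => (p.1 + t • (Pi.single i 1 : E3), p.2)) ((Pi.single i 1 : E3), (0:ℝ)) 0 := by
    have := ((hasDerivAt_id (0:ℝ)).smul_const (Pi.single i 1 : E3)).const_add p.1
    rw [one_smul] at this
    exact this.prodMk (hasDerivAt_const (0:ℝ) p.2)
  have h2 : HasFDerivAt F (fderiv ℝ F p) (p.1 + (0:ℝ) • (Pi.single i 1 : E3), p.2) := by simpa using hF.hasFDerivAt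
  have := h2.comp_hasDerivAt (0:ℝ) h1
  exact this.unique h

/-- the gradient components -/
noncomputable def gi (μ : ℝ) (P P' : ℝ → ℝ) (i : Fin 3) (p : E3 × ℝ) : ℝ :=
  p.1 i * zz (μ-2) (fun s => μ * P s - (s - 1/2) * P' s) p + ev p.2 i / 2 * zz (μ-1) P' p

section
variable {μ : ℝ} {P P' P'' : ℝ → ℝ} (hP : ∀ s ∈ Ioo (-1:ℝ) 1, HasDerivAt P (P' s) s) (hP' : ∀ s ∈ Ioo (-1:ℝ) 1, HasDerivAt P' (P'' s) s)
  (hPc : ContDiffOn ℝ 2 P (Ioo (-1) 1)) 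
  (hode : ∀ s ∈ Ioo (-1:ℝ) 1, s * (1-s) * P'' s + (1-2*s) * P' s + (μ^2+μ) * P s = 0)
include hP hPc

lemma grad_eq {p : E3 × ℝ} (hp : p ∈ WW) (i : Fin 3) : F1 (zz μ P) p (Pi.single i 1) = gi μ P P' i p := by
  refine F1_line (((zz_contDiff 2 hPc).contDiffAt (WW_open.mem_nhds hp)).differentiableAt (by simp)) ?_
  refine (zz_line hp (hP _ (ss_mem hp)) i).congr_deriv ?_
  unfold gi zz; ring

include hP' hode

lemma lap_eq {p : E3 × ℝ} (hp : p ∈ WW) : ∑ i : Fin 3, F1 (fun p => F1 (zz μ P) p (Pi.single i 1)) p (Pi.single i 1) = 0 := by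
  have hF2 : ∀ i : Fin 3, DifferentiableAt ℝ (fun p => F1 (zz μ P) p (Pi.single i 1)) p := by
    intro i
    have h1 : ContDiffOn ℝ 1 (F1 (zz μ P)) WW :=
      ((zz_contDiff 2 hPc).fderiv_of_isOpen WW_open (by norm_num)).clm_comp contDiffOn_const
    exact ((h1.clm_apply contDiffOn_const).contDiffAt (WW_open.mem_nhds hp)).differentiableAt (by simp)
  have hs := ss_mem hp
  have hr : 0 < rho p.1 := hp.1
  set s := ss p.1 p.2 with hsdef
  set G : ℝ → ℝ := fun s => μ * P s - (s - 1/2) * P' s with hG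
  have hGd : HasDerivAt G (μ * P' s - (P' s + (s-1/2) * P'' s)) s := by
    have this : HasDerivAt G _ s := ((hP s hs).const_mul μ).sub (((hasDerivAt_id s).sub_const (1/2)).mul (hP' s hs))
    exact this.congr_deriv (by simp)
  have hline : ∀ i : Fin 3, F1 (fun p => F1 (zz μ P) p (Pi.single i 1)) p (Pi.single i 1) =
      zz (μ-2) G p + p.1 i * (rho p.1 ^ (μ-2-2) * p.1 i * ((μ-2) * G s - (s-1/2) * (μ * P' s - (P' s + (s-1/2) * P'' s))) + rho p.1 ^ (μ-2-1) * (ev p.2 i/2) * (μ * P' s - (P' s + (s-1/2) * P'' s)))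
      + ev p.2 i / 2 * (rho p.1 ^ (μ-1-2) * p.1 i * ((μ-1) * P' s - (s-1/2) * P'' s) + rho p.1 ^ (μ-1-1) * (ev p.2 i/2) * P'' s) := by
    intro i
    refine F1_line (hF2 i) ?_
    have hx : HasDerivAt (fun t : ℝ => (p.1 + t • (Pi.single i 1 : E3)) i) 1 0 := by
      simpa using (hasDerivAt_id (0:ℝ)).const_add (p.1 i)
    have hd := (hx.mul (zz_line (ν := μ-2) hp hGd i)).add ((zz_line (ν := μ-1) hp (hP' _ hs) i).const_mul (ev p.2 i / 2))
    have hev : (fun t : ℝ => F1 (zz μ P) (p.1 + t • (Pi.single i 1 : E3), p.2) (Pi.single i 1)) =ᶠ[nhds 0]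
        (fun t : ℝ => gi μ P P' i (p.1 + t • (Pi.single i 1 : E3), p.2)) := by
      have hc : Continuous (fun t : ℝ => (p.1 + t • (Pi.single i 1 : E3), p.2)) := by fun_prop
      have : ∀ᶠ t in nhds (0:ℝ), (p.1 + t • (Pi.single i 1 : E3), p.2) ∈ WW :=
        hc.continuousAt.eventually_mem (WW_open.mem_nhds (by simpa using hp))
      filter_upwards [this] with t ht
      exact grad_eq hP hPc ht i
    refine HasDerivAt.congr_of_eventuallyEq ?_ hev
    have hd' : HasDerivAt (fun t : ℝ => gi μ P P' i (p.1 + t • (Pi.single i 1 : E3), p.2)) _ 0 := hd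
    refine hd'.congr_deriv ?_
    simp [← hsdef]
  simp only [hline]
  rw [Fin.sum_univ_three]
  have e1 : rho p.1 ^ (μ-2-1) = rho p.1 ^ (μ-2-2) * rho p.1 := by
    rw [← Real.rpow_add_one hr.ne']; congr 1; ring
  have e1' : rho p.1 ^ (μ-1-2) = rho p.1 ^ (μ-2-2) * rho p.1 := by
    rw [← Real.rpow_add_one hr.ne']; congr 1; ring
  have e0 : rho p.1 ^ (μ-2) = rho p.1 ^ (μ-2-2) * rho p.1 ^2 := by
    rw [← Real.rpow_natCast (rho p.1) 2, ← Real.rpow_add hr]; congr 1; push_cast; ring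
  have e0' : rho p.1 ^ (μ-1-1) = rho p.1 ^ (μ-2-2) * rho p.1 ^2 := by
    rw [← e0]; congr 1; ring
  have hzz : zz (μ-2) G p = rho p.1 ^ (μ-2-2) * rho p.1 ^2 * G s := by unfold zz; rw [e0]
  rw [hzz, e1, e1', e0']
  have hq : p.1 0 * cos p.2 + p.1 1 * sin p.2 = 2 * rho p.1 * (s - 1/2) := by
    rw [hsdef]; unfold ss qq; field_simp; ring
  have hR := rho_sq p.1
  have hcs := Real.sin_sq_add_cos_sq p.2
  have ho := hode s hs
  simp only [ev, Matrix.cons_val_zero, Matrix.cons_val_one, Matrix.cons_val]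
  set X := rho p.1 ^ (μ-2-2)
  set ρ := rho p.1
  set a := P s
  set b := P' s
  set c := P'' s
  rw [show G s = μ * a - (s-1/2) * b from rfl]
  set g := μ * b - (b + (s-1/2)*c)
  linear_combination (-(X * ((μ-2) * (μ * a - (s-1/2) * b) - (s-1/2) * g))) * hR + (X * ρ * g / 2 + X * ρ / 2 * ((μ-1) * b - (s-1/2) * c)) * hq
    + (X * ρ^2 * c / 4) * hcs + X * ρ^2 * ho
end
end TO

namespace TO

lemma polar (x : E3) : ∃ α : ℝ, ∀ θ, qq x θ = √(x 0^2 + x 1^2) * cos (θ - α) := by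
  refine ⟨Complex.arg ⟨x 0, x 1⟩, fun θ => ?_⟩
  have h1 := Complex.norm_mul_cos_arg ⟨x 0, x 1⟩
  have h2 := Complex.norm_mul_sin_arg ⟨x 0, x 1⟩
  have hn : ‖(⟨x 0, x 1⟩ : ℂ)‖ = √(x 0^2 + x 1^2) := by
    rw [Complex.norm_def, Complex.normSq_mk]; congr 1; ring
  rw [hn] at h1 h2
  simp only at h1 h2
  rw [Real.cos_sub]
  unfold qq
  linear_combination (-cos θ) * h1 - sin θ * h2

lemma ss_polar (x : E3) : ∃ α : ℝ, ∀ θ, ∀ l : ℕ, ss x θ ^ l ≤ ((1 + cos (θ - α))/2)^l + (1/2)^l := by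
  obtain ⟨α, hα⟩ := polar x
  refine ⟨α, fun θ l => ?_⟩
  have hss := ss_nonneg x θ
  have hc : 0 ≤ (1 + cos (θ-α))/2 := by linarith [Real.neg_one_le_cos (θ-α)]
  have hle : √(x 0^2 + x 1^2) ≤ rho x := by
    unfold rho; exact Real.sqrt_le_sqrt (by nlinarith [sq_nonneg (x 2)])
  rcases le_total (cos (θ-α)) 0 with h | h
  · have : ss x θ ≤ 1/2 := by
      unfold ss
      have : qq x θ / (2 * rho x) ≤ 0 := by
        refine div_nonpos_of_nonpos_of_nonneg ?_ (by linarith [rho_nonneg x])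
        rw [hα]; exact mul_nonpos_of_nonneg_of_nonpos (Real.sqrt_nonneg _) h
      linarith
    have h3 := pow_le_pow_left₀ hss.1 this l
    have := pow_nonneg hc l
    linarith
  · have : ss x θ ≤ (1 + cos (θ-α))/2 := by
      unfold ss
      have : qq x θ / (2 * rho x) ≤ cos (θ-α) / 2 := by
        rw [hα]
        rcases (rho_nonneg x).eq_or_lt with h0 | h0
        · rw [← h0]; simp; linarith
        · rw [div_le_div_iff₀ (by positivity) (by norm_num)]
          nlinarith
      linarith
    have h3 := pow_le_pow_left₀ hss.1 this l
    have : (0:ℝ) ≤ (1/2)^l := by positivity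
    linarith

lemma ss_cont (x : E3) : Continuous (fun θ => ss x θ) := by unfold ss qq; fun_prop

lemma Icc_int (f : ℝ → ℝ) : ∫ θ in Icc (-π) π, f θ = ∫ θ in (-π)..π, f θ := by
  rw [intervalIntegral.integral_of_le (by linarith [Real.pi_pos]), MeasureTheory.integral_Icc_eq_integral_Ioc]

lemma shift_int {f : ℝ → ℝ} (hf : Function.Periodic f (2*π)) (α : ℝ) : ∫ θ in (-π)..π, f (θ - α) = ∫ θ in (-π)..π, f θ := by
  rw [intervalIntegral.integral_comp_sub_right]
  have := hf.intervalIntegral_add_eq (-π - α) (-π)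
  convert this using 2 <;> ring

lemma int_ss_le (x : E3) (l : ℕ) : ∫ θ in Icc (-π) π, ss x θ ^ l ≤ 2 * π * (BB l 0 + (1/2)^l) := by
  obtain ⟨α, hα⟩ := ss_polar x
  rw [Icc_int]
  have hpi := Real.pi_pos
  have h1 : ∫ θ in (-π)..π, ss x θ ^ l ≤ ∫ θ in (-π)..π, (((1 + cos (θ - α))/2)^l + (1/2)^l) := by
    refine intervalIntegral.integral_mono_on (by linarith) ?_ ?_ (fun θ _ => hα θ l)
    · exact ((ss_cont x).pow l).intervalIntegrable _ _
    · exact Continuous.intervalIntegrable (by fun_prop) _ _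
  have h2 := shift_int (f := fun θ => ((1 + cos θ)/2)^l) (by intro t; simp) α
  have h3 := BB_int l 0
  simp only [Nat.cast_zero, zero_mul, Real.cos_zero, mul_one] at h3
  rw [intervalIntegral.integral_add (Continuous.intervalIntegrable (by fun_prop) _ _) (Continuous.intervalIntegrable (by fun_prop) _ _), h2, h3, intervalIntegral.integral_const] at h1
  refine h1.trans (le_of_eq ?_)
  rw [smul_eq_mul]; ring

section
variable {m : ℕ} {μ : ℝ} (hodd : Odd m) (h1 : (m:ℝ) < μ) (h2 : μ < m + 1) {R : ℝ → ℝ} {B : ℝ} (hR : Measurable R) (hB : ∀ θ, |R θ| ≤ B)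

noncomputable def Tm (R : ℝ → ℝ) (l : ℕ) (x : E3) : ℝ := ∫ θ in Icc (-π) π, R θ * ss x θ ^ l
noncomputable def Mj (μ B : ℝ) (l : ℕ) : ℝ := |al μ l| * (B * (2 * π * (BB l 0 + (1/2)^l)))
noncomputable def Uf (μ : ℝ) (R : ℝ → ℝ) : E3 → ℝ := pint (Icc (-π) π) R (zz μ (ps (al μ)))

include hR hB

lemma R_int {f : ℝ → ℝ} (hf : Continuous f) : MeasureTheory.IntegrableOn (fun θ => R θ * f θ) (Icc (-π) π) := by
  have hi : MeasureTheory.IntegrableOn f (Icc (-π) π) := hf.continuousOn.integrableOn_compact isCompact_Icc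
  exact hi.bdd_mul hR.aestronglyMeasurable (c := B) (Eventually.of_forall hB)

lemma int_norm_le (x : E3) (l : ℕ) : ∫ θ in Icc (-π) π, ‖al μ l * (R θ * ss x θ ^ l)‖ ≤ Mj μ B l := by
  have hi : MeasureTheory.IntegrableOn (fun θ => al μ l * (R θ * ss x θ ^ l)) (Icc (-π) π) :=
    (R_int hR hB ((ss_cont x).pow l)).const_mul _
  have : ∫ θ in Icc (-π) π, ‖al μ l * (R θ * ss x θ ^ l)‖ ≤ ∫ θ in Icc (-π) π, |al μ l| * (B * ss x θ ^ l) := by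
    refine MeasureTheory.integral_mono hi.norm ?_ ?_
    · exact ((((ss_cont x).pow l).const_smul B).const_smul |al μ l|).continuousOn.integrableOn_compact isCompact_Icc
    · intro θ
      simp only [norm_mul, Real.norm_eq_abs]
      have hs : 0 ≤ ss x θ ^ l := pow_nonneg (ss_nonneg x θ).1 l
      rw [abs_of_nonneg hs]
      gcongr
      exact hB θ
  refine this.trans ?_
  rw [MeasureTheory.integral_const_mul, MeasureTheory.integral_const_mul]
  unfold Mj
  have hB0 : 0 ≤ B := (abs_nonneg _).trans (hB 0)
  gcongr
  exact int_ss_le x l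

lemma Tm_le (x : E3) (l : ℕ) : |al μ l * Tm R l x| ≤ Mj μ B l := by
  refine le_trans ?_ (int_norm_le hR hB x l)
  unfold Tm
  rw [← MeasureTheory.integral_const_mul, ← Real.norm_eq_abs]
  exact MeasureTheory.norm_integral_le_integral_norm _

include hodd h1 h2

omit hR hB in
lemma Mj_summable : Summable (Mj μ B) := by
  have h := aB_summable hodd h1 h2
  obtain ⟨C, hC, hb⟩ := al_bdd hodd h1 h2
  have h3 : Summable (fun l => |al μ l| * (1/2:ℝ)^l) := by
    refine Summable.of_nonneg_of_le (fun l => by positivity) (fun l => ?_) ((summable_geometric_of_lt_one (r := (1/2:ℝ)) (by norm_num) (by norm_num)).mul_left C)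
    gcongr
    refine (hb l).trans (div_le_self hC.le ?_)
    have : (0:ℝ) ≤ l := Nat.cast_nonneg l
    linarith
  refine ((h.add h3).mul_left (B * (2*π))).congr fun l => ?_
  unfold Mj; ring

lemma v_hasSum (x : E3) : HasSum (fun l => al μ l * Tm R l x) (∫ θ in Icc (-π) π, R θ * ps (al μ) (ss x θ)) := by
  have := MeasureTheory.hasSum_integral_of_summable_integral_norm (μ := MeasureTheory.volume.restrict (Icc (-π) π)) (F := fun l θ => al μ l * (R θ * ss x θ ^ l))
    (fun l => (R_int hR hB ((ss_cont x).pow l)).const_mul _)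
    (Summable.of_nonneg_of_le (fun l => MeasureTheory.integral_nonneg fun θ => norm_nonneg _) (int_norm_le hR hB x) (Mj_summable hodd h1 h2))
  have e1 : (fun l => al μ l * Tm R l x) = fun l => ∫ θ in Icc (-π) π, al μ l * (R θ * ss x θ ^ l) := by
    funext l; rw [MeasureTheory.integral_const_mul]; rfl
  have e2 : (fun θ => R θ * ps (al μ) (ss x θ)) = fun θ => ∑' l, al μ l * (R θ * ss x θ ^ l) := by
    funext θ
    unfold ps
    rw [← tsum_mul_left]
    congr 1; funext l; ring
  rw [e1, e2]
  exact this

omit hodd h1 h2 hR hB in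
lemma Uf_eq (x : E3) : Uf μ R x = rho x ^ μ * ∫ θ in Icc (-π) π, R θ * ps (al μ) (ss x θ) := by
  unfold Uf pint zz
  rw [← MeasureTheory.integral_const_mul]
  congr 1; funext θ
  simp only [smul_eq_mul]; ring

lemma Uf_tsum (x : E3) : Uf μ R x = rho x ^ μ * ∑' l, al μ l * Tm R l x := by
  rw [Uf_eq, (v_hasSum hodd h1 h2 hR hB x).tsum_eq]

omit hodd h1 h2 in
lemma Tm_cont (l : ℕ) {x : E3} (hx : 0 < rho x) : ContinuousAt (Tm R l) x := by
  refine pint_cont (S := Icc (-π) π) (W := {p : E3 × ℝ | 0 < rho p.1}) (F := fun p => ss p.1 p.2 ^ l) isCompact_Icc (isOpen_lt continuous_const (rho_cont.comp continuous_fst)) hR hB ?_ (fun θ _ => hx)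
  refine ContinuousOn.pow ?_ l
  unfold ss
  refine continuousOn_const.add (qq_cont.continuousOn.div (continuousOn_const.mul (rho_cont.comp continuous_fst).continuousOn) ?_)
  intro p hp
  have : 0 < rho p.1 := hp
  positivity

lemma Uf_cont : Continuous (Uf μ R) := by
  have hs := Mj_summable (B := B) hodd h1 h2
  have hμ : 0 < μ := lt_of_le_of_lt (Nat.cast_nonneg m) h1
  rw [continuous_iff_continuousAt]
  intro x
  have he : Uf μ R = fun x => rho x ^ μ * ∑' l, al μ l * Tm R l x := funext (Uf_tsum hodd h1 h2 hR hB)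
  rcases (rho_nonneg x).eq_or_lt with h0 | h0
  · have hx0 : Uf μ R x = 0 := by rw [Uf_eq, ← h0, Real.zero_rpow hμ.ne', zero_mul]
    rw [ContinuousAt, hx0]
    have hlim : Tendsto (fun y => rho y ^ μ * ∑' l, Mj μ B l) (nhds x) (nhds 0) := by
      have : ContinuousAt (fun y => rho y ^ μ * ∑' l, Mj μ B l) x :=
        ((rho_cont.continuousAt).rpow_const (Or.inr hμ.le)).mul continuousAt_const
      have h := this.tendsto
      simp only [← h0, Real.zero_rpow hμ.ne', zero_mul] at h
      exact h
    refine squeeze_zero_norm (fun y => ?_) hlim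
    rw [Uf_tsum hodd h1 h2 hR hB, norm_mul, Real.norm_eq_abs, Real.norm_eq_abs, abs_of_nonneg (Real.rpow_nonneg (rho_nonneg y) μ)]
    refine mul_le_mul_of_nonneg_left ?_ (Real.rpow_nonneg (rho_nonneg y) μ)
    exact tsum_of_norm_bounded (f := fun l => al μ l * Tm R l y) hs.hasSum (fun l => Tm_le hR hB y l)
  · rw [he]
    have hopen : IsOpen {x : E3 | 0 < rho x} := isOpen_lt continuous_const rho_cont
    have hc : ContinuousOn (fun x => ∑' l, al μ l * Tm R l x) {x : E3 | 0 < rho x} :=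
      continuousOn_tsum (fun l y hy => (continuousAt_const.mul (Tm_cont hR hB l hy)).continuousWithinAt) hs (fun l y _ => Tm_le hR hB y l)
    exact ((rho_cont.continuousAt).rpow_const (Or.inr hμ.le)).mul (hc.continuousAt (hopen.mem_nhds h0))

omit hodd h1 h2 hR hB

lemma Uf_symm (x : E3) : Uf μ R (Function.update x 2 (-(x 2))) = Uf μ R x := by
  have hr : rho (Function.update x 2 (-(x 2))) = rho x := by unfold rho; simp [Function.update]
  have hs : ∀ θ, ss (Function.update x 2 (-(x 2))) θ = ss x θ := by
    intro θ; unfold ss; rw [hr]; unfold qq; simp [Function.update]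
  rw [Uf_eq, Uf_eq, hr]; simp only [hs]

lemma rho_smul {r : ℝ} (hr : 0 < r) (x : E3) : rho (r • x) = r * rho x := by
  unfold rho
  rw [← Real.sqrt_sq hr.le, ← Real.sqrt_mul (sq_nonneg r), Real.sqrt_sq hr.le]
  congr 1; simp; ring

lemma Uf_homog {r : ℝ} (hr : 0 < r) (x : E3) : Uf μ R (r • x) = r ^ μ * Uf μ R x := by
  have hs : ∀ θ, ss (r • x) θ = ss x θ := by
    intro θ; unfold ss; rw [rho_smul hr]; unfold qq; simp only [Pi.smul_apply, smul_eq_mul]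
    rw [show r * x 0 * cos θ + r * x 1 * sin θ = r * (x 0 * cos θ + x 1 * sin θ) by ring, show 2 * (r * rho x) = r * (2 * rho x) by ring, mul_div_mul_left _ _ hr.ne']
  rw [Uf_eq, Uf_eq, rho_smul hr, Real.mul_rpow hr.le (rho_nonneg x)]; simp only [hs]
  ring

end
end TO

namespace TO

lemma rho_zero {x : E3} (h : rho x = 0) : x = 0 := by
  have := rho_sq x
  rw [h] at this
  have a : x 0 ^2 = 0 := by nlinarith [sq_nonneg (x 0), sq_nonneg (x 1), sq_nonneg (x 2)]
  have b : x 1 ^2 = 0 := by nlinarith [sq_nonneg (x 0), sq_nonneg (x 1), sq_nonneg (x 2)]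
  have c : x 2 ^2 = 0 := by nlinarith [sq_nonneg (x 0), sq_nonneg (x 1), sq_nonneg (x 2)]
  funext i
  fin_cases i
  · simpa using a
  · simpa using b
  · simpa using c

lemma qq_eq_rho {x : E3} {θ : ℝ} (h : qq x θ = rho x) : x = rho x • ev θ := by
  have h1 := rho_sq x
  rw [← h] at h1 ⊢
  have e : x 0 ^2 + x 1 ^2 - qq x θ ^2 = (x 0 * sin θ - x 1 * cos θ)^2 := by
    unfold qq
    have h := Real.sin_sq_add_cos_sq θ
    linear_combination (-(x 0^2) - x 1 ^2) * h
  have a : (x 0 * sin θ - x 1 * cos θ)^2 = 0 := by nlinarith [sq_nonneg (x 0 * sin θ - x 1 * cos θ), sq_nonneg (x 2)]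
  have c : x 2 ^2 = 0 := by nlinarith [sq_nonneg (x 0 * sin θ - x 1 * cos θ), sq_nonneg (x 2)]
  have a' : x 0 * sin θ - x 1 * cos θ = 0 := by simpa using a
  have hcs := Real.sin_sq_add_cos_sq θ
  funext i
  fin_cases i
  · simp [ev, qq]; linear_combination (-(x 0)) * hcs + sin θ * a'
  · simp [ev, qq]; linear_combination (-(x 1)) * hcs - cos θ * a'
  · simpa [ev] using c

section
variable {m : ℕ} {μ : ℝ} (hodd : Odd m) (h1 : (m:ℝ) < μ) (h2 : μ < m + 1) {R : ℝ → ℝ} {B : ℝ} (hR : Measurable R) (hB : ∀ θ, |R θ| ≤ B)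

def SS (μ : ℝ) (R : ℝ → ℝ) : Set ℝ := Icc (-π) π ∩ {θ | Uf μ R (ev θ) = 0}

lemma ev_cont : Continuous ev := by unfold ev; fun_prop

include hodd h1 h2 hR hB

lemma SS_compact : IsCompact (SS μ R) :=
  isCompact_Icc.inter_right (isClosed_eq ((Uf_cont hodd h1 h2 hR hB).comp ev_cont) continuous_const)

omit hR hB in
lemma Z_sub : (contactSet (Uf μ R) 2)ᶜ ⊆ UU (SS μ R) WW := by
  intro x hx θ hθ
  have hμ : 0 < μ := lt_of_le_of_lt (Nat.cast_nonneg m) h1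
  have hr : 0 < rho x := by
    refine lt_of_le_of_ne (rho_nonneg x) fun h => hx ?_
    have h0 := rho_zero h.symm
    refine ⟨by rw [h0]; rfl, ?_⟩
    rw [Uf_eq, ← h, Real.zero_rpow hμ.ne', zero_mul]
  refine ⟨hr, lt_of_le_of_ne (le_of_abs_le (abs_qq_le x θ)) fun h => hx ?_⟩
  have h3 := qq_eq_rho h
  simp only at h3
  refine ⟨?_, ?_⟩
  · have := congrFun h3 2
    simpa [ev] using this
  · rw [h3, Uf_homog hr, hθ.2, mul_zero]

omit hodd h1 h2 hR hB in
lemma Uf_SS (hz : ∀ θ, R θ ≠ 0 → Uf μ R (ev θ) = 0) (hS : MeasurableSet (SS μ R)) : Uf μ R = pint (SS μ R) R (zz μ (ps (al μ))) := by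
  funext x
  show pint _ _ _ _ = _
  unfold pint
  refine MeasureTheory.setIntegral_eq_of_subset_of_forall_diff_eq_zero measurableSet_Icc inter_subset_left ?_
  rintro θ ⟨hθ, hn⟩
  have : R θ = 0 := by
    by_contra hc
    exact hn ⟨hθ, hz θ hc⟩
  rw [this, zero_smul]

omit hR hB in
lemma zz_lap {p : E3 × ℝ} (hp : p ∈ WW) : ∑ i : Fin 3, F1 (fun p => F1 (zz μ (ps (al μ))) p (Pi.single i 1)) p (Pi.single i 1) = 0 := by
  have hP := al_PG hodd h1 h2
  exact lap_eq (P := ps (al μ)) (P' := ps (dc (al μ))) (P'' := ps (dc (dc (al μ)))) (fun s hs => hP.deriv (abs_lt.2 hs)) (fun s hs => hP.dC.deriv (abs_lt.2 hs)) (by exact_mod_cast hP.contDiffOn 2) (fun s hs => legendre_ode hodd h1 h2 (abs_lt.2 hs)) hp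

lemma Uf_smooth (hz : ∀ θ, R θ ≠ 0 → Uf μ R (ev θ) = 0) : ContDiffOn ℝ 2 (Uf μ R) (contactSet (Uf μ R) 2)ᶜ := by
  have hS := SS_compact hodd h1 h2 hR hB
  have hP := al_PG hodd h1 h2
  have := pint_contDiff hS WW_open hR hB 2 (zz_contDiff (ν := μ) 2 (hP.contDiffOn 2))
  rw [← Uf_SS hz hS.measurableSet] at this
  exact (by exact_mod_cast this : ContDiffOn ℝ 2 (Uf μ R) _).mono (Z_sub hodd h1 h2)

lemma Uf_harm (hz : ∀ θ, R θ ≠ 0 → Uf μ R (ev θ) = 0) {x : E3} (hx : x ∈ (contactSet (Uf μ R) 2)ᶜ) : lap (Uf μ R) x = 0 := by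
  have hS := SS_compact hodd h1 h2 hR hB
  have hP := al_PG hodd h1 h2
  have hx := Z_sub hodd h1 h2 hx
  have hc2 : ContDiffOn ℝ 2 (zz μ (ps (al μ))) WW := by exact_mod_cast zz_contDiff (ν := μ) 2 (hP.contDiffOn 2)
  have hc1 : ContDiffOn ℝ 1 (zz μ (ps (al μ))) WW := hc2.of_le (by norm_num)
  have hF1 : ∀ i : Fin 3, ContDiffOn ℝ 1 (fun p => F1 (zz μ (ps (al μ))) p (Pi.single i 1)) WW := by
    intro i
    have h1 : ContDiffOn ℝ 1 (F1 (zz μ (ps (al μ)))) WW :=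
      (hc2.fderiv_of_isOpen WW_open (by norm_num)).clm_comp contDiffOn_const
    exact h1.clm_apply contDiffOn_const
  unfold lap
  have key : ∀ i : Fin 3, pd i (pd i (Uf μ R)) x = pint (SS μ R) R (fun p => F1 (fun p => F1 (zz μ (ps (al μ))) p (Pi.single i 1)) p (Pi.single i 1)) x := by
    intro i
    rw [← pint_pd hS WW_open hR hB (hF1 i) hx i]
    unfold pd
    congr 1
    refine Filter.EventuallyEq.fderiv_eq ?_
    filter_upwards [(UU_open hS WW_open).mem_nhds hx] with y hy
    rw [Uf_SS hz hS.measurableSet]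
    exact pint_pd hS WW_open hR hB hc1 hy i
  simp only [key]
  unfold pint
  rw [← MeasureTheory.integral_finset_sum]
  · rw [MeasureTheory.setIntegral_congr_fun (g := fun _ => 0) hS.measurableSet]
    · simp
    · intro θ hθ
      simp only [smul_eq_mul]
      rw [← Finset.mul_sum, zz_lap hodd h1 h2 (hx θ hθ), mul_zero]
  · intro i _
    have := F1_int hS WW_open hR hB (hF1 i) hx
    exact this.apply_continuousLinearMap (Pi.single i 1)
end
end TO

namespace TO

lemma rt_lim (ρ0 : ℝ) (h : 0 < ρ0) : Tendsto (fun t : ℝ => √(ρ0^2+t^2)) (nhdsWithin 0 (Ioi 0)) (nhds ρ0) := by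
  have : Continuous (fun t : ℝ => √(ρ0^2+t^2)) := by fun_prop
  have h2 := this.tendsto 0
  simp only [ne_eq, OfNat.ofNat_ne_zero, not_false_eq_true, zero_pow, add_zero, Real.sqrt_sq h.le] at h2
  exact h2.mono_left nhdsWithin_le_nhds

lemma cos_quot (y : ℝ) : Tendsto (fun t : ℝ => (1 - cos (t*y))/t^2) (nhdsWithin 0 (Ioi 0)) (nhds (y^2/2)) := by
  have h0 : HasDerivAt (fun t : ℝ => sin (t*(y/2))) (y/2) 0 := by
    have := ((hasDerivAt_id (0:ℝ)).mul_const (y/2)).sin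
    refine this.congr_deriv ?_
    simp
  have h1 := h0.tendsto_slope_zero_right
  have h2 := (h1.pow 2).const_mul 2
  have e : 2 * (y/2)^2 = y^2/2 := by ring
  rw [e] at h2
  refine h2.congr' ?_
  filter_upwards [self_mem_nhdsWithin] with t ht
  have ht : 0 < t := ht
  simp only [zero_add, zero_mul, Real.sin_zero, sub_zero, smul_eq_mul]
  have := Real.sin_sq_eq_half_sub (t*(y/2))
  rw [mul_pow, this, show 2 * (t*(y/2)) = t*y by ring]
  field_simp

lemma ker_lim {ρ0 : ℝ} (h : 0 < ρ0) (y : ℝ) : Tendsto (fun t : ℝ => t * (t / (√(ρ0^2+t^2) - ρ0 * cos (t*y)))) (nhdsWithin 0 (Ioi 0)) (nhds (1/(1/(2*ρ0) + ρ0 * (y^2/2)))) := by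
  have h1 : Tendsto (fun t : ℝ => 1 / (√(ρ0^2+t^2) + ρ0) + ρ0 * ((1 - cos (t*y))/t^2)) (nhdsWithin 0 (Ioi 0)) (nhds (1/(2*ρ0) + ρ0 * (y^2/2))) := by
    refine Tendsto.add ?_ ((cos_quot y).const_mul ρ0)
    refine tendsto_const_nhds.div ?_ (by positivity)
    rw [two_mul]
    exact (rt_lim ρ0 h).add_const ρ0
  have h2 := tendsto_const_nhds (x := (1:ℝ)).div h1 (by positivity)
  refine h2.congr' ?_
  filter_upwards [self_mem_nhdsWithin] with t ht
  have ht : 0 < t := ht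
  have hs : √(ρ0^2+t^2)^2 = ρ0^2+t^2 := Real.sq_sqrt (by positivity)
  have hs0 := Real.sqrt_nonneg (ρ0^2+t^2)
  simp only [Pi.div_apply]
  set r := √(ρ0^2+t^2)
  have hr : 1/(r+ρ0) = (r - ρ0)/t^2 := by
    rw [div_eq_div_iff (by positivity) (by positivity)]; nlinarith
  rw [hr, show (r-ρ0)/t^2 + ρ0*((1-cos (t*y))/t^2) = (r - ρ0*cos (t*y))/t^2 by ring, one_div_div]
  ring

lemma ker_bd {ρ0 : ℝ} (h : 0 < ρ0) {t y : ℝ} (ht : 0 < t) (ht1 : t ≤ 1) (hy : 0 < y) (hty : t * y ≤ π) :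
    0 < √(ρ0^2+t^2) - ρ0 * cos (t*y) ∧ t * (t / (√(ρ0^2+t^2) - ρ0 * cos (t*y))) ≤ 1/(1/(2*ρ0+1) + 2*ρ0/π^2*y^2) := by
  have hs : √(ρ0^2+t^2)^2 = ρ0^2+t^2 := Real.sq_sqrt (by positivity)
  have hs0 := Real.sqrt_nonneg (ρ0^2+t^2)
  have hc := Real.cos_le_one_sub_mul_cos_sq (x := t*y) (by rw [abs_of_pos (by positivity)]; exact hty)
  set r := √(ρ0^2+t^2)
  have hr : r ≤ ρ0 + 1 := by
    refine abs_le_of_sq_le_sq' (by nlinarith) (by linarith) |>.2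
  have hr0 : t^2/(2*ρ0+1) ≤ r - ρ0 := by
    rw [div_le_iff₀ (by positivity)]
    have hrρ : 0 ≤ r - ρ0 := by
      have := abs_le_of_sq_le_sq' (a := ρ0) (b := r) (by nlinarith) hs0 |>.2
      linarith
    nlinarith
  have key : t^2 * (1/(2*ρ0+1) + 2*ρ0/π^2*y^2) ≤ r - ρ0*cos (t*y) := by
    have : ρ0 * cos (t*y) ≤ ρ0 * (1 - 2/π^2*(t*y)^2) := mul_le_mul_of_nonneg_left hc h.le
    have e : t^2 * (1/(2*ρ0+1) + 2*ρ0/π^2*y^2) = t^2/(2*ρ0+1) + ρ0*(2/π^2*(t*y)^2) := by ring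
    rw [e]; nlinarith
  have hpos : 0 < t^2 * (1/(2*ρ0+1) + 2*ρ0/π^2*y^2) := by positivity
  refine ⟨by linarith, ?_⟩
  rw [← mul_div_assoc, div_le_div_iff₀ (by linarith) (by positivity)]
  nlinarith

lemma quad_int {a b : ℝ} (ha : 0 < a) (hb : 0 < b) : MeasureTheory.Integrable (fun y : ℝ => 1/(a + b*y^2)) := by
  refine MeasureTheory.Integrable.mono' (integrable_inv_one_add_sq.const_mul (1/(min a b))) ?_ ?_
  · refine Continuous.aestronglyMeasurable ?_
    refine continuous_const.div (by fun_prop) fun y => ?_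
    positivity
  · refine Eventually.of_forall fun y => ?_
    rw [Real.norm_of_nonneg (by positivity), ← one_div, div_mul_div_comm, mul_one]
    have hm : 0 < min a b := lt_min ha hb
    refine div_le_div_of_nonneg_left zero_le_one (by positivity) ?_
    have := min_le_left a b
    have := min_le_right a b
    nlinarith [sq_nonneg y]

noncomputable def kint (ρ0 : ℝ) (H : ℝ → ℝ) (t τ : ℝ) : ℝ :=
  ρ0 * cos τ * H (1/2 + ρ0 * cos τ / (2 * √(ρ0^2+t^2))) * (t / (√(ρ0^2+t^2) - ρ0 * cos τ))

lemma core {ρ0 : ℝ} (h : 0 < ρ0) {A H : ℝ → ℝ} {B C L : ℝ} (hA : Measurable A) (hB : ∀ τ, |A τ| ≤ B) (hL : Tendsto A (nhdsWithin 0 (Ioi 0)) (nhds L))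
    (hH : Continuous H) (hC : ∀ s, |H s| ≤ C) :
    Tendsto (fun t => ∫ τ in (0:ℝ)..π, A τ * kint ρ0 H t τ) (nhdsWithin 0 (Ioi 0))
      (nhds (∫ y in Ioi (0:ℝ), L * (ρ0 * 1 * H 1 * (1/(1/(2*ρ0) + ρ0 * (y^2/2)))))) := by
  have hpi := Real.pi_pos
  set N : ℝ → ℝ → ℝ := fun t => indicator (Ioc 0 (π/t)) (fun y => t * (A (t*y) * kint ρ0 H t (t*y))) with hN
  have hkm : ∀ t, Measurable (kint ρ0 H t) := by
    intro t
    unfold kint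
    have := hH.measurable
    fun_prop
  have e : ∀ᶠ t in nhdsWithin (0:ℝ) (Ioi 0), ∫ y in Ioi (0:ℝ), N t y = ∫ τ in (0:ℝ)..π, A τ * kint ρ0 H t τ := by
    filter_upwards [self_mem_nhdsWithin] with t ht
    have ht : 0 < t := ht
    have h3 := intervalIntegral.mul_integral_comp_mul_left (a := 0) (b := π/t) (f := fun τ => A τ * kint ρ0 H t τ) t
    rw [mul_zero, mul_div_cancel₀ _ ht.ne'] at h3
    rw [← h3, hN]
    simp only
    rw [MeasureTheory.setIntegral_indicator measurableSet_Ioc, inter_eq_self_of_subset_right (fun y hy => hy.1), MeasureTheory.integral_const_mul,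
      intervalIntegral.integral_of_le (by positivity)]
  refine Tendsto.congr' e ?_
  have hC0 : 0 ≤ C := (abs_nonneg _).trans (hC 0)
  have hB0 : 0 ≤ B := (abs_nonneg _).trans (hB 0)
  refine MeasureTheory.tendsto_integral_filter_of_dominated_convergence (fun y => B * (ρ0 * C) * (1/(1/(2*ρ0+1) + 2*ρ0/π^2*y^2))) ?_ ?_ ?_ ?_
  · refine Eventually.of_forall fun t => ?_
    have := hkm t
    refine Measurable.aestronglyMeasurable (Measurable.indicator ?_ measurableSet_Ioc)
    fun_prop
  · have ht1 : ∀ᶠ t in nhdsWithin (0:ℝ) (Ioi 0), t ≤ 1 := nhdsWithin_le_nhds (eventually_le_nhds zero_lt_one)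
    filter_upwards [self_mem_nhdsWithin, ht1] with t ht ht1
    have ht : 0 < t := ht
    refine Eventually.of_forall fun y => ?_
    simp only [hN]
    by_cases hy : y ∈ Ioc 0 (π/t)
    · rw [indicator_of_mem hy]
      have hty : t * y ≤ π := by have := hy.2; rw [le_div_iff₀ ht] at this; linarith
      obtain ⟨k1, k2⟩ := ker_bd h ht ht1 hy.1 hty
      unfold kint
      rw [show t * (A (t*y) * (ρ0 * cos (t*y) * H (1/2 + ρ0 * cos (t*y) / (2 * √(ρ0^2+t^2))) * (t / (√(ρ0^2+t^2) - ρ0 * cos (t*y))))) =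
        A (t*y) * (ρ0 * (cos (t*y) * H (1/2 + ρ0 * cos (t*y) / (2 * √(ρ0^2+t^2))))) * (t * (t / (√(ρ0^2+t^2) - ρ0 * cos (t*y)))) by ring]
      rw [norm_mul, norm_mul, norm_mul, norm_mul, Real.norm_of_nonneg h.le]
      simp only [Real.norm_eq_abs]
      have hk0 : 0 ≤ t * (t / (√(ρ0^2+t^2) - ρ0 * cos (t*y))) := by positivity
      rw [abs_of_nonneg hk0]
      have hcc : |cos (t*y)| * |H (1/2 + ρ0 * cos (t*y) / (2 * √(ρ0^2+t^2)))| ≤ C := by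
        calc _ ≤ 1 * C := mul_le_mul (Real.abs_cos_le_one _) (hC _) (abs_nonneg _) zero_le_one
          _ = C := one_mul C
      exact mul_le_mul (mul_le_mul (hB _) (mul_le_mul_of_nonneg_left hcc h.le) (by positivity) hB0) k2 hk0 (by positivity)
    · rw [indicator_of_notMem hy]
      simp only [norm_zero]; positivity
  · exact ((quad_int (by positivity) (by positivity)).const_mul _).integrableOn
  · filter_upwards [MeasureTheory.ae_restrict_mem measurableSet_Ioi] with y hy
    have hy : 0 < y := hy
    have hev : ∀ᶠ t in nhdsWithin (0:ℝ) (Ioi 0), A (t*y) * (ρ0 * cos (t*y) * H (1/2 + ρ0 * cos (t*y) / (2 * √(ρ0^2+t^2))) * (t * (t / (√(ρ0^2+t^2) - ρ0 * cos (t*y))))) = N t y := by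
      have ht1 : ∀ᶠ t in nhdsWithin (0:ℝ) (Ioi 0), t ≤ π/y := nhdsWithin_le_nhds (eventually_le_nhds (by positivity))
      filter_upwards [self_mem_nhdsWithin, ht1] with t ht ht1
      have ht : 0 < t := ht
      have : y ∈ Ioc 0 (π/t) := ⟨hy, by rw [le_div_iff₀ ht]; rw [le_div_iff₀ hy] at ht1; linarith⟩
      simp only [hN]
      rw [indicator_of_mem this]
      unfold kint; ring
    refine Tendsto.congr' hev ?_
    have hty : Tendsto (fun t : ℝ => t*y) (nhdsWithin 0 (Ioi 0)) (nhdsWithin 0 (Ioi 0)) := by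
      refine tendsto_nhdsWithin_iff.2 ⟨?_, ?_⟩
      · have : Continuous (fun t : ℝ => t*y) := by fun_prop
        have := this.tendsto 0
        rw [zero_mul] at this
        exact this.mono_left nhdsWithin_le_nhds
      · filter_upwards [self_mem_nhdsWithin] with t ht
        exact mul_pos ht hy
    have hcos : Tendsto (fun t : ℝ => cos (t*y)) (nhdsWithin 0 (Ioi 0)) (nhds 1) := by
      have := (Real.continuous_cos.tendsto 0).comp (hty.mono_right nhdsWithin_le_nhds)
      rwa [Real.cos_zero] at this
    refine (hL.comp hty).mul (((hcos.const_mul ρ0).mul ?_).mul (ker_lim h y))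
    have harg : Tendsto (fun t : ℝ => 1/2 + ρ0 * cos (t*y) / (2 * √(ρ0^2+t^2))) (nhdsWithin 0 (Ioi 0)) (nhds 1) := by
      have := ((hcos.const_mul ρ0).div ((rt_lim ρ0 h).const_mul 2) (by positivity)).const_add (1/2)
      have e : 1/2 + ρ0 * 1 / (2*ρ0) = 1 := by field_simp; norm_num
      rwa [e] at this
    exact (hH.tendsto 1).comp harg

end TO

namespace TO

lemma upper_of_deriv {u : E3 → ℝ} {x : E3} {e : ℝ} (hu : Continuous u)
    (hd : ∀ t : ℝ, 0 < t → DifferentiableAt ℝ (fun t : ℝ => u (x + t • (Pi.single 2 1 : E3))) t)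
    (hl : Tendsto (fun t : ℝ => deriv (fun t : ℝ => u (x + t • (Pi.single 2 1 : E3))) t) (nhdsWithin 0 (Ioi 0)) (nhds e)) :
    HasUpperDeriv u 2 x e := by
  have hc : Continuous (fun t : ℝ => u (x + t • (Pi.single 2 1 : E3))) := hu.comp (by fun_prop)
  have h := hasDerivWithinAt_Ici_of_tendsto_deriv (s := Ioi 0) (a := 0) (fun t ht => (hd t ht).differentiableWithinAt) hc.continuousWithinAt self_mem_nhdsWithin hl
  rw [← hasDerivWithinAt_Ioi_iff_Ici, hasDerivWithinAt_iff_tendsto_slope' (by simp)] at h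
  unfold HasUpperDeriv
  refine h.congr fun t => ?_
  rw [slope_def_field]; simp

section
variable {m : ℕ} {μ : ℝ} (hodd : Odd m) (h1 : (m:ℝ) < μ) (h2 : μ < m + 1) {R : ℝ → ℝ} {B : ℝ} (hR : Measurable R) (hB : ∀ θ, |R θ| ≤ B)
include hodd h1 h2 hR hB

lemma upper_zero : HasUpperDeriv (Uf μ R) 2 0 0 := by
  obtain ⟨k, hk⟩ := hodd
  have hμ : 1 < μ := by
    have : (1:ℝ) ≤ m := by rw [hk]; push_cast; linarith [(Nat.cast_nonneg k : (0:ℝ) ≤ k)]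
    linarith
  unfold HasUpperDeriv
  have h0 : Uf μ R 0 = 0 := by
    rw [Uf_eq]
    have : rho (0:E3) = 0 := by unfold rho; simp
    rw [this, Real.zero_rpow (by linarith), zero_mul]
  have hl : Tendsto (fun t : ℝ => t^(μ-1) * Uf μ R (Pi.single 2 1)) (nhdsWithin 0 (Ioi 0)) (nhds 0) := by
    have : ContinuousAt (fun t : ℝ => t^(μ-1)) 0 := Real.continuousAt_rpow_const _ _ (Or.inr (by linarith))
    have h3 := (this.tendsto.mul_const (Uf μ R (Pi.single 2 1))).mono_left (nhdsWithin_le_nhds (s := Ioi 0))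
    rwa [Real.zero_rpow (by linarith), zero_mul] at h3
  refine hl.congr' ?_
  filter_upwards [self_mem_nhdsWithin] with t ht
  have ht : 0 < t := ht
  rw [h0, zero_add, sub_zero, Uf_homog ht, Real.rpow_sub_one ht.ne']
  ring

omit hR hB in
lemma Hc_exists : ∃ H : ℝ → ℝ, Continuous H ∧ (∃ C, ∀ s, |H s| ≤ C) ∧ (∀ s ∈ Icc (-1:ℝ) 1, H s = ps (dl μ) s) := by
  have hc := H_cont hodd h1 h2
  have hm : ∀ s : ℝ, max (-1) (min 1 s) ∈ Icc (-1:ℝ) 1 := fun s => ⟨le_max_left _ _, max_le (by norm_num) (min_le_left _ _)⟩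
  refine ⟨fun s => ps (dl μ) (max (-1) (min 1 s)), hc.comp_continuous (by fun_prop) hm, ?_, ?_⟩
  · obtain ⟨C, hC⟩ := isCompact_Icc.exists_bound_of_continuousOn hc
    exact ⟨C, fun s => hC _ (hm s)⟩
  · intro s hs
    simp only
    rw [min_eq_right hs.2, max_eq_right hs.1]

omit hodd h1 h2 in
lemma even_split (hper : Function.Periodic R (2*π)) {k : ℝ → ℝ} (hk : Continuous k) (hkp : Function.Periodic k (2*π)) (hke : ∀ τ, k (-τ) = k τ) (α : ℝ) :
    ∫ θ in Icc (-π) π, R θ * k (θ - α) = ∫ τ in (0:ℝ)..π, (R (α + τ) + R (α - τ)) * k τ := by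
  rw [Icc_int]
  have h3 := shift_int (f := fun θ => R (θ + α) * k θ) (by
    intro θ
    simp only
    rw [hkp θ, show θ + 2*π+α = θ+α+2*π by ring, hper]) α
  simp only [sub_add_cancel] at h3
  rw [h3]
  have hi : ∀ a b : ℝ, IntervalIntegrable (fun θ => R (θ + α) * k θ) MeasureTheory.volume a b := by
    intro a b
    have := (hk.intervalIntegrable (μ := MeasureTheory.volume) a b)
    rw [intervalIntegrable_iff] at this ⊢
    exact this.bdd_mul (hR.comp (measurable_id.add_const α)).aestronglyMeasurable (c := B) (Eventually.of_forall fun θ => hB _)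
  rw [← intervalIntegral.integral_add_adjacent_intervals (hi (-π) 0) (hi 0 π)]
  have h4 := intervalIntegral.integral_comp_neg (a := 0) (b := π) (fun θ => R (θ + α) * k θ)
  rw [neg_zero] at h4
  rw [← h4, ← intervalIntegral.integral_add]
  · congr 1; funext τ
    rw [hke, show -τ + α = α - τ by ring, add_comm τ α]; ring
  · have := (hi (-0) (-π)).comp_mul_left (c := -1)
    simpa using this
  · exact hi 0 π

lemma upper_pos (hR0 : ∀ θ, 0 ≤ R θ) (hper : Function.Periodic R (2*π))
    (hlim : ∀ α, ∃ L, Tendsto (fun τ => R (α + τ) + R (α - τ)) (nhdsWithin 0 (Ioi 0)) (nhds L))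
    {x : E3} (hx2 : x 2 = 0) (hx : 0 < rho x) : ∃ d, d ≤ 0 ∧ HasUpperDeriv (Uf μ R) 2 x d := by
  obtain ⟨α, hα⟩ := polar x
  have hρ : √(x 0^2+x 1^2) = rho x := by unfold rho; rw [hx2]; simp
  rw [hρ] at hα
  obtain ⟨L, hL⟩ := hlim α
  have hL0 : 0 ≤ L := ge_of_tendsto' hL fun τ => add_nonneg (hR0 _) (hR0 _)
  obtain ⟨H, hHc, ⟨C, hC⟩, hH⟩ := Hc_exists hodd h1 h2
  set ρ0 := rho x with hρ0
  set Y : ℝ → E3 := fun t => x + t • (Pi.single 2 1 : E3) with hY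
  have hYr : ∀ t, rho (Y t) = √(ρ0^2+t^2) := by
    intro t; rw [hY]; simp only; rw [rho_line, hx2]; simp; rfl
  have hYq : ∀ t θ, qq (Y t) θ = ρ0 * cos (θ - α) := by
    intro t θ; rw [hY]; simp only; rw [qq_line, hα]; simp [ev]
  have hlt : ∀ t : ℝ, 0 < t → ρ0 < √(ρ0^2+t^2) := by
    intro t ht
    refine Real.lt_sqrt_of_sq_lt ?_
    nlinarith
  have hcosle : ∀ τ, ρ0 * cos τ ≤ ρ0 := fun τ => mul_le_of_le_one_right hx.le (Real.cos_le_one τ)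
  have hmem : ∀ t : ℝ, 0 < t → Y t ∈ UU (Icc (-π) π) WW := by
    intro t ht θ _
    have := hlt t ht
    refine ⟨by simp only; rw [hYr]; linarith, ?_⟩
    simp only; rw [hYr, hYq]; linarith [hcosle (θ-α)]
  have hP := al_PG hodd h1 h2
  have hc2 : ContDiffOn ℝ 2 (zz μ (ps (al μ))) WW := by exact_mod_cast zz_contDiff (ν := μ) 2 (hP.contDiffOn 2)
  have hc1 : ContDiffOn ℝ 1 (zz μ (ps (al μ))) WW := hc2.of_le (by norm_num)
  have hder : ∀ t : ℝ, 0 < t → HasDerivAt (fun t => Uf μ R (Y t)) (pd 2 (Uf μ R) (Y t)) t := by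
    intro t ht
    have hd := (pint_deriv isCompact_Icc WW_open hR hB hc1 (hmem t ht)).differentiableAt.hasFDerivAt
    have hy : HasDerivAt Y (Pi.single 2 1 : E3) t := by
      have := ((hasDerivAt_id t).smul_const (Pi.single 2 1 : E3)).const_add x
      rwa [one_smul] at this
    exact hd.comp_hasDerivAt t hy
  have hkc : ∀ t : ℝ, 0 < t → Continuous (kint ρ0 H t) := by
    intro t ht
    unfold kint
    have := hlt t ht
    refine Continuous.mul (by fun_prop) (continuous_const.div (by fun_prop) fun τ => ?_)
    linarith [hcosle τ]
  have hval : ∀ t : ℝ, 0 < t → pd 2 (Uf μ R) (Y t) = t * (μ * √(ρ0^2+t^2)^(μ-2) * (Uf μ R (Y t) / √(ρ0^2+t^2)^μ))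
      - √(ρ0^2+t^2)^(μ-2) * ∫ τ in (0:ℝ)..π, (R (α + τ) + R (α - τ)) * kint ρ0 H t τ := by
    intro t ht
    have hlt' := hlt t ht
    rw [← even_split hR hB hper (hkc t ht) (by intro τ; unfold kint; simp) (by intro τ; unfold kint; simp) α]
    have e1 : pd 2 (Uf μ R) (Y t) = ∫ θ in Icc (-π) π, R θ • F1 (zz μ (ps (al μ))) (Y t, θ) (Pi.single 2 1) :=
      pint_pd isCompact_Icc WW_open hR hB hc1 (hmem t ht) 2
    have hpos : 0 < √(ρ0^2+t^2)^μ := Real.rpow_pos_of_pos (by linarith) μ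
    rw [e1, Uf_eq, hYr, mul_div_cancel_left₀ _ hpos.ne']
    set ρ := √(ρ0^2+t^2)
    have hρpos : 0 < ρ := by linarith
    have hPc : ContinuousOn (fun θ => ps (al μ) (ss (Y t) θ)) (Icc (-π) π) := by
      refine ContinuousOn.comp (t := Ioo (-1) 1) (hP.contDiffOn 0).continuousOn (ss_cont _).continuousOn ?_
      intro θ hθ
      exact ss_mem (hmem t ht θ hθ)
    have i1 : MeasureTheory.IntegrableOn (fun θ => R θ * ps (al μ) (ss (Y t) θ)) (Icc (-π) π) :=
      (hPc.integrableOn_compact isCompact_Icc).bdd_mul hR.aestronglyMeasurable (c := B) (Eventually.of_forall hB)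
    have i2 : MeasureTheory.IntegrableOn (fun θ => R θ * kint ρ0 H t (θ - α)) (Icc (-π) π) :=
      R_int hR hB ((hkc t ht).comp (by fun_prop))
    rw [← MeasureTheory.integral_const_mul, ← MeasureTheory.integral_const_mul, ← MeasureTheory.integral_const_mul,
      ← MeasureTheory.integral_sub ((i1.const_mul _).const_mul _) (i2.const_mul _)]
    refine MeasureTheory.setIntegral_congr_fun measurableSet_Icc fun θ hθ => ?_
    have hw := hmem t ht θ hθ
    simp only [smul_eq_mul]
    rw [grad_eq (P' := ps (dc (al μ))) (fun s hs => hP.deriv (abs_lt.2 hs)) (by exact_mod_cast hP.contDiffOn 2) hw 2]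
    have hs := ss_mem hw
    have hHe := H_eq hodd h1 h2 (ss_lt hw)
    rw [← hH _ ⟨hs.1.le, hs.2.le⟩] at hHe
    simp only at hs hHe
    have hsv : ss (Y t) θ = 1/2 + ρ0 * cos (θ - α) / (2 * ρ) := by unfold ss; rw [hYq, hYr]
    have hY2 : Y t 2 = t := by simp [hY, hx2]
    have hden : 0 < ρ - ρ0 * cos (θ - α) := by linarith [hcosle (θ - α)]
    have hk : kint ρ0 H t (θ - α) = t * ((ss (Y t) θ - 1/2) * ps (dc (al μ)) (ss (Y t) θ)) := by
      unfold kint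
      rw [← hsv, ← hHe]
      have hq : ρ0 * cos (θ - α) = (ss (Y t) θ - 1/2) * (2 * ρ) := by rw [hsv]; field_simp; ring
      have hd : ρ - ρ0 * cos (θ - α) = 2 * ρ * (1 - ss (Y t) θ) := by rw [hsv]; field_simp; ring
      have h1s : 0 < 1 - ss (Y t) θ := by linarith [hs.2]
      rw [show √(ρ0^2+t^2) = ρ from rfl, hd, hq]
      field_simp
    rw [hk]
    unfold gi zz
    simp only [hYr, hY2, ev, Matrix.cons_val]
    rw [show √(ρ0^2+t^2) = ρ from rfl]
    ring
  refine ⟨-(ρ0^(μ-2) * ∫ y in Ioi (0:ℝ), L * (ρ0 * 1 * H 1 * (1/(1/(2*ρ0) + ρ0 * (y^2/2))))), ?_, ?_⟩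
  · have hH1 : 0 ≤ H 1 := by rw [hH 1 (by norm_num)]; exact H_one hodd h1 h2
    have : 0 ≤ ∫ y in Ioi (0:ℝ), L * (ρ0 * 1 * H 1 * (1/(1/(2*ρ0) + ρ0 * (y^2/2)))) :=
      MeasureTheory.integral_nonneg fun y => by positivity
    have := Real.rpow_pos_of_pos hx (μ-2)
    simp only [Left.neg_nonpos_iff]
    positivity
  · refine upper_of_deriv (Uf_cont hodd h1 h2 hR hB) (fun t ht => (hder t ht).differentiableAt) ?_
    have hr := rt_lim ρ0 hx
    have hA : Measurable (fun τ => R (α + τ) + R (α - τ)) := by fun_prop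
    have hk := core hx hA (B := B + B) (fun τ => (abs_add_le _ _).trans (add_le_add (hB _) (hB _))) hL hHc hC
    have hrp : ∀ ν : ℝ, Tendsto (fun t : ℝ => √(ρ0^2+t^2)^ν) (nhdsWithin 0 (Ioi 0)) (nhds (ρ0^ν)) := fun ν => hr.rpow_const (Or.inl hx.ne')
    have hYc : Tendsto (fun t => Uf μ R (Y t)) (nhdsWithin 0 (Ioi 0)) (nhds (Uf μ R x)) := by
      have hc : Continuous (fun t : ℝ => Uf μ R (Y t)) := (Uf_cont hodd h1 h2 hR hB).comp (by fun_prop)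
      have := hc.tendsto 0
      simp only [hY, zero_smul, add_zero] at this
      exact this.mono_left nhdsWithin_le_nhds
    have ht0 : Tendsto (fun t : ℝ => t) (nhdsWithin 0 (Ioi 0)) (nhds 0) := tendsto_id.mono_left nhdsWithin_le_nhds
    have hfin := (ht0.mul (((hrp (μ-2)).const_mul μ).mul (hYc.div (hrp μ) (Real.rpow_pos_of_pos hx μ).ne'))).sub ((hrp (μ-2)).mul hk)
    rw [zero_mul, zero_sub] at hfin
    refine hfin.congr' ?_
    filter_upwards [self_mem_nhdsWithin] with t ht
    rw [(hder t ht).deriv, hval t ht]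
    rfl
end
end TO

namespace TO

lemma cos_side (a : ℝ) : Tendsto (fun h => cos (a+h)) (nhdsWithin 0 (Ioi 0)) (nhdsWithin (cos a) (Iio (cos a))) ∨
    Tendsto (fun h => cos (a+h)) (nhdsWithin 0 (Ioi 0)) (nhdsWithin (cos a) (Ioi (cos a))) := by
  have hc : Tendsto (fun h => cos (a+h)) (nhdsWithin 0 (Ioi 0)) (nhds (cos a)) := by
    have : Continuous (fun h => cos (a+h)) := by fun_prop
    have := this.tendsto 0
    rw [add_zero] at this
    exact this.mono_left nhdsWithin_le_nhds
  have hid : ∀ h, cos (a+h) - cos a = -2 * sin (a + h/2) * sin (h/2) := by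
    intro h
    rw [Real.cos_sub_cos, show (a+h+a)/2 = a+h/2 by ring, show (a+h-a)/2 = h/2 by ring]
  have hsm : ∀ᶠ h in nhdsWithin (0:ℝ) (Ioi 0), 0 < sin (h/2) := by
    filter_upwards [self_mem_nhdsWithin, nhdsWithin_le_nhds (eventually_lt_nhds (Real.pi_pos))] with h h0 h1
    have h0 : 0 < h := h0
    exact Real.sin_pos_of_pos_of_lt_pi (by linarith) (by linarith)
  have hsc : Tendsto (fun h => sin (a+h/2)) (nhdsWithin 0 (Ioi 0)) (nhds (sin a)) := by
    have : Continuous (fun h => sin (a+h/2)) := by fun_prop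
    have := this.tendsto 0
    simp only [zero_div, add_zero] at this
    exact this.mono_left nhdsWithin_le_nhds
  have hcase : (∀ᶠ h in nhdsWithin (0:ℝ) (Ioi 0), 0 < sin (a+h/2)) ∨ (∀ᶠ h in nhdsWithin (0:ℝ) (Ioi 0), sin (a+h/2) < 0) := by
    rcases lt_trichotomy (sin a) 0 with h | h | h
    · right; exact hsc.eventually_lt_const h
    · have he : ∀ h, sin (a+h/2) = cos a * sin (h/2) := by intro t; rw [Real.sin_add, h]; ring
      have hsq := Real.sin_sq_add_cos_sq a
      rw [h] at hsq
      rcases lt_trichotomy (cos a) 0 with h' | h' | h'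
      · right; filter_upwards [hsm] with t ht
        rw [he]; exact mul_neg_of_neg_of_pos h' ht
      · rw [h'] at hsq; norm_num at hsq
      · left; filter_upwards [hsm] with t ht
        rw [he]; exact mul_pos h' ht
    · left; exact hsc.eventually_const_lt h
  rcases hcase with h | h
  · left
    refine tendsto_nhdsWithin_iff.2 ⟨hc, ?_⟩
    filter_upwards [h, hsm] with t h1 h2
    have := hid t
    show cos (a+t) < cos a
    nlinarith
  · right
    refine tendsto_nhdsWithin_iff.2 ⟨hc, ?_⟩
    filter_upwards [h, hsm] with t h1 h2
    have := hid t
    show cos a < cos (a+t)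
    nlinarith

/-- the folded density -/
noncomputable def Rm (m : ℕ) (r : ℝ → ℝ) (θ : ℝ) : ℝ := r (arccos (cos (m * θ)))

section
variable {m : ℕ} (hm : 0 < m) {r : ℝ → ℝ} {B : ℝ} (hr : Antitone r) (hb : ∀ x, 0 ≤ r x ∧ r x ≤ B)
include hr

lemma Rm_meas : Measurable (Rm m r) := by
  unfold Rm
  exact hr.measurable.comp (Real.continuous_arccos.measurable.comp (by fun_prop))

omit hr in
lemma Rm_per : Function.Periodic (Rm m r) (2*π) := by
  intro θ
  unfold Rm
  rw [show (m:ℝ) * (θ + 2*π) = m*θ + m * (2*π) by ring, Real.cos_add_nat_mul_two_pi]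

omit hr in
include hm in
lemma Rm_per' : Function.Periodic (Rm m r) (2*π/m) := by
  intro θ
  unfold Rm
  have : (m:ℝ) ≠ 0 := by positivity
  rw [show (m:ℝ) * (θ + 2*π/m) = m*θ + 2*π by field_simp, Real.cos_add_two_pi]

omit hr in
lemma Rm_even (θ : ℝ) : Rm m r (-θ) = Rm m r θ := by
  unfold Rm
  rw [mul_neg, Real.cos_neg]

omit hr in
include hb in
lemma Rm_bd (θ : ℝ) : |Rm m r θ| ≤ B := by
  unfold Rm; rw [abs_of_nonneg (hb _).1]; exact (hb _).2

include hm in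
lemma Rm_lim1 (α : ℝ) : ∃ L, Tendsto (fun τ => Rm m r (α + τ)) (nhdsWithin 0 (Ioi 0)) (nhds L) := by
  have hmon : Monotone (fun c => r (arccos c)) := fun a b hab => hr (Real.antitone_arccos hab)
  have hmp : (0:ℝ) < m := by exact_mod_cast hm
  have hmt : Tendsto (fun τ : ℝ => m * τ) (nhdsWithin 0 (Ioi 0)) (nhdsWithin 0 (Ioi 0)) := by
    refine tendsto_nhdsWithin_iff.2 ⟨?_, ?_⟩
    · have : Continuous (fun τ : ℝ => m * τ) := by fun_prop
      have := this.tendsto 0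
      rw [mul_zero] at this
      exact this.mono_left nhdsWithin_le_nhds
    · filter_upwards [self_mem_nhdsWithin] with t ht
      exact mul_pos hmp ht
  have he : (fun τ => Rm m r (α + τ)) = (fun c => r (arccos c)) ∘ (fun h => cos (m*α + h)) ∘ (fun τ : ℝ => m * τ) := by
    funext τ; simp [Rm, mul_add]
  rw [he]
  rcases cos_side (m*α) with h | h
  · exact ⟨_, (hmon.tendsto_nhdsLT _).comp (h.comp hmt)⟩
  · exact ⟨_, (hmon.tendsto_nhdsGT _).comp (h.comp hmt)⟩

include hm in
lemma Rm_lim (α : ℝ) : ∃ L, Tendsto (fun τ => Rm m r (α + τ) + Rm m r (α - τ)) (nhdsWithin 0 (Ioi 0)) (nhds L) := by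
  obtain ⟨L1, h1⟩ := Rm_lim1 hm hr α
  obtain ⟨L2, h2⟩ := Rm_lim1 hm hr (-α)
  refine ⟨L1 + L2, h1.add (h2.congr fun τ => ?_)⟩
  rw [← Rm_even]; congr 1; ring

end

/-- folding integrals -/
lemma fold_int {m : ℕ} (hm : 0 < m) {g : ℝ → ℝ} {B : ℝ} (hg : Measurable g) (hB : ∀ x, |g x| ≤ B) (hper : Function.Periodic g (2*π)) (hev : ∀ x, g (-x) = g x) :
    ∫ θ in (-π)..π, g (m * θ) = 2 * ∫ φ in (0:ℝ)..π, g φ := by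
  have hmp : (m:ℝ) ≠ 0 := by positivity
  have hi : ∀ a b, IntervalIntegrable g MeasureTheory.volume a b := by
    intro a b
    refine IntervalIntegrable.mono_fun' (g := fun _ => B) intervalIntegrable_const hg.aestronglyMeasurable (Eventually.of_forall hB)
  rw [intervalIntegral.integral_comp_mul_left _ hmp]
  have h1 := hper.intervalIntegral_add_zsmul_eq (m:ℤ) (m * -π) hi
  have h2 := hper.intervalIntegral_add_eq (m * -π) (-π)
  have e1 : (m:ℝ) * -π + (m:ℤ) • (2*π) = m * π := by simp; ring
  rw [e1] at h1
  rw [h1, h2, show -π + 2*π = π by ring]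
  have h3 := even_split hg hB hper (k := fun _ => 1) continuous_const (fun _ => rfl) (fun _ => rfl) 0
  simp only [mul_one, zero_add, zero_sub, hev] at h3
  rw [Icc_int] at h3
  rw [h3, ← intervalIntegral.integral_const_mul]
  simp only [zsmul_eq_mul, smul_eq_mul, Int.cast_natCast]
  rw [← mul_assoc, inv_mul_cancel₀ hmp, one_mul]
  congr 1; funext τ; ring

end TO

namespace TO

lemma rho_ev (θ : ℝ) : rho (ev θ) = 1 := by
  unfold rho ev; simp

lemma ss_ev (θ τ : ℝ) : ss (ev θ) τ = (1 + cos (τ - θ))/2 := by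
  unfold ss; rw [rho_ev]; unfold qq ev; simp [Real.cos_sub]; ring

lemma inner_int (l k : ℕ) (τ : ℝ) : ∫ θ in (-π)..π, ((1 + cos (τ - θ))/2)^l * cos (k*θ) = 2 * π * BB l k * cos (k*τ) := by
  have h1 := shift_int (f := fun θ => ((1 + cos θ)/2)^l * cos (k*(θ+τ))) (by
    intro θ
    simp only [Real.cos_add_two_pi]
    rw [show (k:ℝ) * (θ + 2*π+τ) = k*(θ+τ) + k * (2*π) by ring, Real.cos_add_nat_mul_two_pi]) τ
  simp only [sub_add_cancel] at h1
  have e : ∀ θ, cos (τ - θ) = cos (θ - τ) := fun θ => by rw [← Real.cos_neg]; congr 1; ring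
  simp only [e]
  rw [h1]
  have hodd : ∫ θ in (-π)..π, ((1 + cos θ)/2)^l * sin (k*θ) = 0 := by
    have := intervalIntegral.integral_comp_neg (a := -π) (b := π) (fun θ => ((1 + cos θ)/2)^l * sin (k*θ))
    simp only [Real.cos_neg, mul_neg, Real.sin_neg, neg_neg, intervalIntegral.integral_neg] at this
    linarith
  have e2 : ∀ θ, ((1 + cos θ)/2)^l * cos (k*(θ+τ)) = cos (k*τ) * (((1 + cos θ)/2)^l * cos (k*θ)) - sin (k*τ) * (((1 + cos θ)/2)^l * sin (k*θ)) := by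
    intro θ; rw [mul_add, Real.cos_add]; ring
  simp only [e2]
  rw [intervalIntegral.integral_sub (Continuous.intervalIntegrable (by fun_prop) _ _) (Continuous.intervalIntegrable (by fun_prop) _ _),
    intervalIntegral.integral_const_mul, intervalIntegral.integral_const_mul, hodd, BB_int]
  ring

section
variable {m : ℕ} {μ : ℝ} (hodd : Odd m) (h1 : (m:ℝ) < μ) (h2 : μ < m + 1) {R : ℝ → ℝ} {B : ℝ} (hR : Measurable R) (hB : ∀ θ, |R θ| ≤ B)
include hR hB

lemma Tm_fourier (l k : ℕ) : ∫ θ in Icc (-π) π, Tm R l (ev θ) * cos (k*θ) = 2 * π * BB l k * ∫ τ in Icc (-π) π, R τ * cos (k*τ) := by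
  unfold Tm
  simp only [ss_ev, ← MeasureTheory.integral_mul_const]
  rw [MeasureTheory.integral_integral_swap]
  · rw [← MeasureTheory.integral_const_mul]
    congr 1; funext τ
    have := inner_int l k τ
    rw [← Icc_int] at this
    simp only [mul_assoc (R τ)]
    rw [MeasureTheory.integral_const_mul, this]; ring
  · have hfin : MeasureTheory.IsFiniteMeasure (MeasureTheory.volume.restrict (Icc (-π) π)) := inferInstance
    refine MeasureTheory.Integrable.of_bound (C := B) ?_ (Eventually.of_forall ?_)
    · refine Measurable.aestronglyMeasurable ?_
      simp only [Function.uncurry_def]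
      fun_prop
    · rintro ⟨θ, τ⟩
      simp only [Function.uncurry]
      rw [norm_mul, norm_mul]
      simp only [Real.norm_eq_abs]
      have ha : |((1 + cos (τ - θ))/2)^l| ≤ 1 := by
        rw [abs_pow]
        refine pow_le_one₀ (abs_nonneg _) (abs_le.2 ⟨?_, ?_⟩) <;> linarith [Real.cos_le_one (τ-θ), Real.neg_one_le_cos (τ - θ)]
      have hB0 : 0 ≤ B := (abs_nonneg _).trans (hB 0)
      calc _ ≤ B * 1 * 1 := mul_le_mul (mul_le_mul (hB τ) ha (abs_nonneg _) hB0) (Real.abs_cos_le_one _) (abs_nonneg _) (by positivity)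
        _ = B := by ring

include hodd h1 h2

omit hR hB in
lemma Uf_ev (θ : ℝ) : Uf μ R (ev θ) = ∫ τ in Icc (-π) π, R τ * ps (al μ) ((1 + cos (τ - θ))/2) := by
  rw [Uf_eq, rho_ev, Real.one_rpow, one_mul]
  simp only [ss_ev]

lemma Uf_fourier (k : ℕ) : ∫ θ in Icc (-π) π, Uf μ R (ev θ) * cos (k*θ) = 2 * π * Gh μ k * ∫ τ in Icc (-π) π, R τ * cos (k*τ) := by
  have hs := Mj_summable (B := B) hodd h1 h2
  have hTc : ∀ l, Continuous (fun θ => Tm R l (ev θ)) := by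
    intro l
    rw [continuous_iff_continuousAt]
    intro θ
    exact ContinuousAt.comp (f := ev) (Tm_cont hR hB l (by rw [rho_ev]; exact one_pos)) ev_cont.continuousAt
  have hint : ∀ l, MeasureTheory.IntegrableOn (fun θ => al μ l * Tm R l (ev θ) * cos (k*θ)) (Icc (-π) π) := by
    intro l
    have := hTc l
    exact Continuous.integrableOn_Icc (by fun_prop)
  have hsum := MeasureTheory.hasSum_integral_of_summable_integral_norm (μ := MeasureTheory.volume.restrict (Icc (-π) π)) (F := fun l θ => al μ l * Tm R l (ev θ) * cos (k*θ)) hint (by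
    refine Summable.of_nonneg_of_le (fun l => MeasureTheory.integral_nonneg fun θ => norm_nonneg _) (fun l => ?_) (hs.mul_left (2*π))
    have : ∫ θ in Icc (-π) π, ‖al μ l * Tm R l (ev θ) * cos (k*θ)‖ ≤ ∫ θ in Icc (-π) π, Mj μ B l := by
      refine MeasureTheory.integral_mono (hint l).norm (MeasureTheory.integrableOn_const (by simp)) fun θ => ?_
      simp only [norm_mul _ (cos _)]
      have h0 := Tm_le (μ := μ) hR hB (ev θ) l
      calc _ ≤ Mj μ B l * 1 := mul_le_mul h0 (Real.abs_cos_le_one _) (abs_nonneg _) ((abs_nonneg _).trans h0)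
        _ = _ := mul_one _
    refine this.trans (le_of_eq ?_)
    rw [Icc_int, intervalIntegral.integral_const, smul_eq_mul]; ring)
  have e1 : (fun θ => ∑' l, al μ l * Tm R l (ev θ) * cos (k*θ)) = fun θ => Uf μ R (ev θ) * cos (k*θ) := by
    funext θ
    rw [tsum_mul_right, Uf_tsum hodd h1 h2 hR hB, rho_ev, Real.one_rpow, one_mul]
  rw [e1] at hsum
  have e2 : (fun l => ∫ θ in Icc (-π) π, al μ l * Tm R l (ev θ) * cos (k*θ)) = fun l => al μ l * BB l k * (2 * π * ∫ τ in Icc (-π) π, R τ * cos (k*τ)) := by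
    funext l
    simp only [mul_assoc (al μ l)]
    rw [MeasureTheory.integral_const_mul, Tm_fourier hR hB]; ring
  rw [e2] at hsum
  have h3 := (Gh_hasSum hodd h1 h2 k).mul_right (2 * π * ∫ τ in Icc (-π) π, R τ * cos (k*τ))
  rw [hsum.unique h3]; ring

end

section
variable {m : ℕ} {μ : ℝ} (hodd : Odd m) (h1 : (m:ℝ) < μ) (h2 : μ < m + 1) {r : ℝ → ℝ} {B : ℝ} (hr : Antitone r) (hb : ∀ x, 0 ≤ r x ∧ r x ≤ B)

noncomputable def fb (m : ℕ) (μ : ℝ) (r : ℝ → ℝ) (φ : ℝ) : ℝ := Uf μ (Rm m r) (ev (φ / m))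

include hodd h1 h2

lemma fb_even (φ : ℝ) : fb m μ r (-φ) = fb m μ r φ := by
  unfold fb
  rw [Uf_ev hodd h1 h2, Uf_ev hodd h1 h2, Icc_int, Icc_int]
  have := intervalIntegral.integral_comp_neg (a := -π) (b := π) (fun τ => Rm m r τ * ps (al μ) ((1 + cos (τ - φ/m))/2))
  rw [neg_neg] at this
  rw [← this]
  congr 1; funext τ
  rw [Rm_even, ← Real.cos_neg]
  congr 4; ring_nf

lemma fb_per : Function.Periodic (fb m μ r) (2*π) := by
  intro φ
  have hm : 0 < m := hodd.pos
  unfold fb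
  rw [Uf_ev hodd h1 h2, Uf_ev hodd h1 h2, Icc_int, Icc_int]
  have := shift_int (f := fun τ => Rm m r τ * ps (al μ) ((1 + cos (τ - φ/m))/2)) (by
    intro τ
    simp only [Rm_per τ]
    rw [show τ + 2*π - φ/m = τ - φ/m + 2*π by ring, Real.cos_add_two_pi]) (2*π/m)
  rw [← this]
  congr 1; funext τ
  rw [← Rm_per' hm (τ - 2*π/m), sub_add_cancel]
  congr 4; ring_nf

include hr hb

lemma fb_cont : Continuous (fb m μ r) := 
  (Uf_cont hodd h1 h2 (Rm_meas hr) (Rm_bd hb)).comp (ev_cont.comp (by fun_prop))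

lemma fb_fourier : ∃ K > 0, ∀ j, rh (fb m μ r) j = K * (rh r j / cc μ (j*m)) := by
  have hm : 0 < m := hodd.pos
  have hpi := Real.pi_pos
  obtain ⟨κ, hκ, hG⟩ := Gh_cc hodd h1 h2
  refine ⟨2 * π * κ, by positivity, fun j => ?_⟩
  have hU := Uf_fourier hodd h1 h2 (Rm_meas (m := m) hr) (Rm_bd hb) (j*m)
  rw [Icc_int, Icc_int] at hU
  have hcont := fb_cont hodd h1 h2 hr hb
  have hcp : Function.Periodic (fun φ => cos (j*φ)) (2*π) := by
    intro φ; simp only; rw [mul_add, Real.cos_add_nat_mul_two_pi]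
  obtain ⟨C, hC⟩ : ∃ C, ∀ x, |fb m μ r x * cos (j*x)| ≤ C := by
    obtain ⟨C, hC⟩ := isCompact_Icc.exists_bound_of_continuousOn (s := Icc 0 (2*π)) (f := fun x => fb m μ r x * cos (j*x)) (by fun_prop)
    refine ⟨C, fun x => ?_⟩
    obtain ⟨y, hy, he⟩ := ((fb_per hodd h1 h2 (r := r)).mul hcp).exists_mem_Ico₀ (by positivity) x
    have := hC y ⟨hy.1, hy.2.le⟩
    simp only [Pi.mul_apply] at he
    rw [he]; exact this
  have f1 := fold_int hm (g := fun φ => fb m μ r φ * cos (j*φ)) (by fun_prop) hC ((fb_per hodd h1 h2).mul hcp) (by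
    intro x; beta_reduce; rw [fb_even hodd h1 h2, mul_neg, Real.cos_neg])
  have hB0 : 0 ≤ B := (hb 0).1.trans (hb 0).2
  have hrm : Measurable (fun φ => r (arccos (cos φ))) := hr.measurable.comp (Real.continuous_arccos.measurable.comp (by fun_prop))
  have f2 := fold_int hm (g := fun φ => r (arccos (cos φ)) * cos (j*φ)) (B := B) (hrm.mul (by fun_prop)) (by
    intro x
    rw [abs_mul, abs_of_nonneg (hb _).1]
    calc _ ≤ B * 1 := mul_le_mul (hb _).2 (Real.abs_cos_le_one _) (abs_nonneg _) hB0
      _ = B := mul_one B) (by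
    intro x; simp only [Real.cos_add_two_pi]; congr 1; exact hcp x) (by
    intro x; beta_reduce; rw [Real.cos_neg, mul_neg, Real.cos_neg])
  have g1 : ∫ θ in (-π)..π, fb m μ r (m*θ) * cos (j*(m*θ)) = ∫ θ in (-π)..π, Uf μ (Rm m r) (ev θ) * cos ((j*m:ℕ)*θ) := by
    congr 1; funext θ
    unfold fb
    rw [mul_div_cancel_left₀ _ (by positivity : (m:ℝ) ≠ 0)]; push_cast; rw [mul_assoc]
  have g2 : ∫ θ in (-π)..π, r (arccos (cos (m*θ))) * cos (j*(m*θ)) = ∫ θ in (-π)..π, Rm m r θ * cos ((j*m:ℕ)*θ) := by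
    congr 1; funext θ
    unfold Rm
    push_cast; rw [mul_assoc]
  have g3 : ∫ φ in (0:ℝ)..π, r (arccos (cos φ)) * cos (j*φ) = ∫ φ in (0:ℝ)..π, r φ * cos (j*φ) := by
    refine intervalIntegral.integral_congr fun φ hφ => ?_
    rw [uIcc_of_le hpi.le] at hφ
    beta_reduce
    rw [Real.arccos_cos hφ.1 hφ.2]
  rw [g1, hU, ← g2, f2, g3] at f1
  unfold rh
  have hGj := hG (j*m)
  have hcn := cc_ne h1 h2 (j*m)
  have hGe : Gh μ (j*m) = κ / cc μ (j*m) := by rw [eq_div_iff hcn, mul_comm]; exact hGj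
  rw [hGe] at f1
  have f3 : ∫ φ in (0:ℝ)..π, fb m μ r φ * cos (j*φ) = 2 * π * (κ / cc μ (j*m)) * ∫ φ in (0:ℝ)..π, r φ * cos (j*φ) := by linarith
  rw [f3]; ring
end
end TO

namespace TO

lemma cos_span_mul {f : ℝ → ℝ} (hf : f ∈ Submodule.span ℝ (range (fun (j:ℕ) (φ:ℝ) => cos (j*φ)))) :
    (fun φ => cos φ * f φ) ∈ Submodule.span ℝ (range (fun (j:ℕ) (φ:ℝ) => cos (j*φ))) := by
  induction hf using Submodule.span_induction with
  | mem x hx =>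
    obtain ⟨j, rfl⟩ := hx
    rcases j with _ | j
    · refine Submodule.subset_span ⟨1, ?_⟩
      funext φ; simp
    · have e : (fun φ => cos φ * cos (((j+1:ℕ):ℝ)*φ)) = (1/2:ℝ) • (fun φ => cos (((j+2:ℕ):ℝ)*φ)) + (1/2:ℝ) • (fun φ => cos ((j:ℝ)*φ)) := by
        funext φ
        simp only [Pi.add_apply, Pi.smul_apply, smul_eq_mul]
        push_cast
        rw [show ((j:ℝ)+2)*φ = (j+1)*φ + φ by ring, show (j:ℝ)*φ = (j+1)*φ - φ by ring, Real.cos_add, Real.cos_sub]; ring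
      beta_reduce
      rw [e]
      exact Submodule.add_mem _ (Submodule.smul_mem _ _ (Submodule.subset_span ⟨j+2, rfl⟩)) (Submodule.smul_mem _ _ (Submodule.subset_span ⟨j, rfl⟩))
  | zero =>
    have e : (fun φ => cos φ * (0 : ℝ → ℝ) φ) = 0 := by funext φ; simp
    rw [e]; exact Submodule.zero_mem _
  | add x y _ _ hx hy =>
    convert Submodule.add_mem _ hx hy using 1
    funext φ; simp [mul_add]
  | smul a x _ hx =>
    convert Submodule.smul_mem _ a hx using 1
    funext φ; simp; ring

lemma cos_span_poly (p : Polynomial ℝ) :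
    (fun φ => p.eval (cos φ)) ∈ Submodule.span ℝ (range (fun (j:ℕ) (φ:ℝ) => cos (j*φ))) := by
  have hpow : ∀ n : ℕ, (fun φ => cos φ ^ n) ∈ Submodule.span ℝ (range (fun (j:ℕ) (φ:ℝ) => cos (j*φ))) := by
    intro n
    induction n with
    | zero => exact Submodule.subset_span ⟨0, by funext φ; simp⟩
    | succ n ih =>
      convert cos_span_mul ih using 1
      funext φ; rw [pow_succ, mul_comm]
  induction p using Polynomial.induction_on' with
  | add p q hp hq =>
    convert Submodule.add_mem _ hp hq using 1
    funext φ; simp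
  | monomial n a =>
    convert Submodule.smul_mem _ a (hpow n) using 1
    funext φ; simp

lemma cos_poly (p : Polynomial ℝ) : ∃ (α : ℕ → ℝ) (n : ℕ), ∀ φ, p.eval (cos φ) = ∑ j ∈ Finset.range n, α j * cos (j*φ) := by
  obtain ⟨c, hc⟩ := Finsupp.mem_span_range_iff_exists_finsupp.1 (cos_span_poly p)
  refine ⟨c, c.support.sup id + 1, fun φ => ?_⟩
  have := congrFun hc φ
  beta_reduce at this
  rw [← this, Finsupp.sum, Finset.sum_apply]
  refine Finset.sum_subset ?_ ?_
  · intro j hj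
    rw [Finset.mem_range]
    exact Nat.lt_succ_of_le (Finset.le_sup (f := id) hj)
  · intro j _ hj
    simp [Finsupp.notMem_support_iff.1 hj]

lemma cos_weier {η : ℝ → ℝ} (hη : Continuous η) {ε : ℝ} (hε : 0 < ε) :
    ∃ (α : ℕ → ℝ) (n : ℕ), ∀ φ ∈ Icc 0 π, |∑ j ∈ Finset.range n, α j * cos (j*φ) - η φ| < ε := by
  obtain ⟨p, hp⟩ := exists_polynomial_near_of_continuousOn (-1) 1 (fun x => η (arccos x)) (hη.comp Real.continuous_arccos).continuousOn ε hε
  obtain ⟨α, n, h⟩ := cos_poly p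
  refine ⟨α, n, fun φ hφ => ?_⟩
  have := hp (cos φ) ⟨Real.neg_one_le_cos _, Real.cos_le_one _⟩
  rw [Real.arccos_cos hφ.1 hφ.2, h] at this
  exact this

section
variable {f : ℝ → ℝ} {σ : ℝ} (hf : Continuous f)
  (ht : ∀ (α : ℕ → ℝ) (n : ℕ) (δ : ℝ), 0 < δ →
      (∀ c ∈ Icc 0 π, σ - δ < c → 0 ≤ ∫ φ in c..π, ∑ j ∈ Finset.range n, α j * cos (j * φ)) →
      0 ≤ ∑ j ∈ Finset.range n, α j * rh f j)
include hf

lemma sum_rh (α : ℕ → ℝ) (n : ℕ) : ∑ j ∈ Finset.range n, α j * rh f j = (1/π) * ∫ φ in (0:ℝ)..π, f φ * ∑ j ∈ Finset.range n, α j * cos (j * φ) := by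
  simp only [Finset.mul_sum]
  rw [intervalIntegral.integral_finsetSum (fun j _ => Continuous.intervalIntegrable (by fun_prop) _ _), Finset.mul_sum]
  refine Finset.sum_congr rfl fun j _ => ?_
  unfold rh
  rw [mul_left_comm, ← intervalIntegral.integral_const_mul]
  congr 2; funext φ; ring

include ht

lemma test_cont {η : ℝ → ℝ} (hη : Continuous η) {δ : ℝ} (hδ : 0 < δ) (h : ∀ c ∈ Icc 0 π, σ - δ < c → 0 ≤ ∫ φ in c..π, η φ) :
    0 ≤ ∫ φ in (0:ℝ)..π, f φ * η φ := by
  have hpi := Real.pi_pos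
  obtain ⟨C, hC⟩ := isCompact_Icc.exists_bound_of_continuousOn (s := Icc 0 π) (f := f) hf.continuousOn
  have hC0 : 0 ≤ C := (norm_nonneg _).trans (hC 0 ⟨le_rfl, hpi.le⟩)
  refine le_of_forall_pos_lt_add fun e he => ?_
  set ε := e / (4 * π * (C+1)) with hεd
  have hε : 0 < ε := by positivity
  obtain ⟨α, n, hα⟩ := cos_weier (η := fun φ => η φ + ε) (by fun_prop) hε
  have hpc : Continuous (fun φ => ∑ j ∈ Finset.range n, α j * cos (j * φ)) := by fun_prop
  have h0 := ht α n δ hδ (by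
    intro c hc hcs
    refine (h c hc hcs).trans (intervalIntegral.integral_mono_on hc.2 (hη.intervalIntegrable _ _) (hpc.intervalIntegrable _ _) fun φ hφ => ?_)
    have := abs_lt.1 (hα φ ⟨hc.1.trans hφ.1, hφ.2⟩)
    linarith [this.1])
  rw [sum_rh hf] at h0
  have h1 : 0 ≤ ∫ φ in (0:ℝ)..π, f φ * ∑ j ∈ Finset.range n, α j * cos (j * φ) := by
    by_contra hn
    push Not at hn
    have := mul_neg_of_pos_of_neg (one_div_pos.2 hpi) hn
    linarith
  have h2 : ‖∫ φ in (0:ℝ)..π, (f φ * ∑ j ∈ Finset.range n, α j * cos (j * φ) - f φ * η φ)‖ ≤ C * (2*ε) * |π - 0| := by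
    refine intervalIntegral.norm_integral_le_of_norm_le_const fun φ hφ => ?_
    rw [uIoc_of_le hpi.le] at hφ
    have hφ' : φ ∈ Icc 0 π := ⟨hφ.1.le, hφ.2⟩
    rw [← mul_sub, norm_mul]
    refine mul_le_mul (hC φ hφ') ?_ (norm_nonneg _) hC0
    have := abs_lt.1 (hα φ hφ')
    rw [Real.norm_eq_abs, abs_le]
    constructor <;> linarith [this.1, this.2]
  rw [intervalIntegral.integral_sub (Continuous.intervalIntegrable (by fun_prop) _ _) (Continuous.intervalIntegrable (by fun_prop) _ _), sub_zero, abs_of_pos hpi, Real.norm_eq_abs] at h2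
  have h3 := (abs_le.1 h2).2
  have h4 : C * (2*ε) * π < e := by
    have : C * (2*ε)*π = e * (C / (2*(C+1))) := by rw [hεd]; field_simp; ring
    rw [this]
    have : C / (2*(C+1)) < 1 := by rw [div_lt_one (by positivity)]; linarith
    nlinarith
  linarith

lemma f_zero (hσ : σ ∈ Icc 0 π) (hσ0 : 0 < σ) : ∀ φ ∈ Icc 0 σ, f φ = 0 := by
  have hpi := Real.pi_pos
  have key : ∀ φ ∈ Ico 0 σ, f φ = 0 := by
    intro φ0 hφ0
    set a := (φ0 + σ)/2 with ha
    have ha1 : φ0 < a := by rw [ha]; linarith [hφ0.2]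
    have ha2 : a < σ := by rw [ha]; linarith [hφ0.2]
    have h := test_cont hf ht (η := fun φ => - (f φ * max 0 (a - φ))) (by fun_prop) (δ := σ - a) (by linarith) (by
      intro c hc hca
      refine le_of_eq ?_
      rw [intervalIntegral.integral_congr (g := fun _ => (0:ℝ))]
      · simp
      · intro φ hφ
        rw [uIcc_of_le hc.2] at hφ
        beta_reduce
        rw [max_eq_left (by linarith [hφ.1])]; simp)
    by_contra hne
    have hp : 0 < ∫ φ in (0:ℝ)..π, f φ * (f φ * max 0 (a - φ)) := by
      refine intervalIntegral.integral_pos hpi (by fun_prop) (fun φ _ => ?_) ⟨φ0, ⟨hφ0.1, by linarith [hσ.2]⟩, ?_⟩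
      · rw [← mul_assoc]; exact mul_nonneg (mul_self_nonneg _) (le_max_left _ _)
      · rw [← mul_assoc]
        refine mul_pos (mul_self_pos.2 hne) (lt_max_of_lt_right (by linarith))
    simp only [mul_neg, intervalIntegral.integral_neg] at h
    linarith
  intro φ hφ
  have hcl : closure (Ico 0 σ) ⊆ {x | f x = 0} :=
    closure_minimal key (isClosed_eq hf continuous_const)
  rw [closure_Ico hσ0.ne] at hcl
  exact hcl hφ

lemma f_mono_aux {a d : ℝ} (ha : 0 < a) (hd : 0 < d) (had : a + d < π) : f a ≤ f (a + d) := by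
  have hpi := Real.pi_pos
  by_contra hlt
  push Not at hlt
  have hop : ∀ᶠ x in nhds (a+d), f x < f (x - d) := by
    refine (isOpen_lt hf (by fun_prop)).mem_nhds ?_
    simpa using hlt
  obtain ⟨ε0, hε0, hb⟩ := Metric.eventually_nhds_iff.1 hop
  set ε := min ε0 (min a (π - (a+d))) with hε
  have he1 : ε ≤ ε0 := min_le_left _ _
  have he2 : ε ≤ a := (min_le_right _ _).trans (min_le_left _ _)
  have he3 : ε ≤ π - (a+d) := (min_le_right _ _).trans (min_le_right _ _)
  have he : 0 < ε := lt_min hε0 (lt_min ha (by linarith))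
  set T : ℝ → ℝ := fun x => max 0 (ε - |x - (a+d)|) with hT
  have hTc : Continuous T := by rw [hT]; fun_prop
  have hT0 : ∀ x, 0 ≤ T x := fun x => le_max_left _ _
  have hTr : ∀ x, π ≤ x → T x = 0 := fun x hx => max_eq_left (by
    rw [abs_of_nonneg (by linarith)]; linarith)
  have hTl : ∀ x, x ≤ d → T x = 0 := fun x hx => max_eq_left (by
    rw [abs_of_nonpos (by linarith)]; linarith)
  have hii : ∀ (g : ℝ → ℝ), Continuous g → ∀ x y, IntervalIntegrable g MeasureTheory.volume x y := fun g hg x y => hg.intervalIntegrable _ _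
  have h := test_cont hf ht (η := fun x => T x - T (x + d)) (by fun_prop) (δ := 1) one_pos (by
    intro c hc _
    rw [intervalIntegral.integral_sub (hii _ (by fun_prop) _ _) (hii _ (by fun_prop) _ _), intervalIntegral.integral_comp_add_right T d]
    have e1 := intervalIntegral.integral_add_adjacent_intervals (hii T hTc c π) (hii T hTc π (π+d))
    have e2 := intervalIntegral.integral_add_adjacent_intervals (hii T hTc c (c+d)) (hii T hTc (c+d) (π+d))
    have e3 : ∫ x in π..(π+d), T x = 0 := by
      rw [intervalIntegral.integral_congr (g := fun _ => (0:ℝ))]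
      · simp
      · intro x hx
        rw [uIcc_of_le (by linarith)] at hx
        exact hTr x hx.1
    have e4 : 0 ≤ ∫ x in c..(c+d), T x := intervalIntegral.integral_nonneg (by linarith) fun x _ => hT0 x
    linarith)
  have e0 : ∫ x in (0:ℝ)..π, f x * (T x - T (x+d)) = (∫ x in (0:ℝ)..π, f x * T x) - ∫ x in (0:ℝ)..π, f x * T (x+d) := by
    simp only [mul_sub]
    exact intervalIntegral.integral_sub (hii _ (by fun_prop) _ _) (hii _ (by fun_prop) _ _)
  have e1 : ∫ x in (0:ℝ)..π, f x * T (x+d) = ∫ x in (0+d)..(π+d), f (x - d) * T x := by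
    rw [← intervalIntegral.integral_comp_add_right (fun x => f (x-d) * T x) d]
    simp only [add_sub_cancel_right]
  have e2 : ∫ x in (0:ℝ)..π, f x * T x = ∫ x in d..π, f x * T x := by
    rw [← intervalIntegral.integral_add_adjacent_intervals (b := d) (hii _ (by fun_prop) _ _) (hii _ (by fun_prop) _ _), intervalIntegral.integral_congr (a := 0) (b := d) (g := fun _ => (0:ℝ))]
    · simp
    · intro x hx
      rw [uIcc_of_le hd.le] at hx
      beta_reduce
      rw [hTl x hx.2, mul_zero]
  have e3 : ∫ x in (0+d)..(π+d), f (x-d) * T x = ∫ x in d..π, f (x-d) * T x := by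
    rw [zero_add, ← intervalIntegral.integral_add_adjacent_intervals (b := π) (hii _ (by fun_prop) _ _) (hii _ (by fun_prop) _ _), intervalIntegral.integral_congr (a := π) (b := π + d) (g := fun _ => (0:ℝ))]
    · simp
    · intro x hx
      rw [uIcc_of_le (by linarith)] at hx
      beta_reduce
      rw [hTr x hx.1, mul_zero]
  have hp : 0 < ∫ x in d..π, (f (x-d) * T x - f x * T x) := by
    refine intervalIntegral.integral_pos (by linarith) (by fun_prop) (fun x _ => ?_) ⟨a+d, ⟨by linarith, had.le⟩, ?_⟩
    · rw [← sub_mul]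
      by_cases hx : dist x (a+d) < ε0
      · exact mul_nonneg (sub_nonneg.2 (hb hx).le) (hT0 x)
      · have : T x = 0 := max_eq_left (by rw [Real.dist_eq] at hx; linarith)
        rw [this, mul_zero]
    · rw [← sub_mul, add_sub_cancel_right]
      refine mul_pos (sub_pos.2 hlt) ?_
      rw [hT]; simpa using he
  rw [intervalIntegral.integral_sub (hii _ (by fun_prop) _ _) (hii _ (by fun_prop) _ _)] at hp
  rw [e0, e1, e2, e3] at h
  linarith

lemma f_mono : MonotoneOn f (Icc 0 π) := by
  have h : MonotoneOn f (Ioo 0 π) := by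
    intro x hx y hy hxy
    rcases hxy.eq_or_lt with rfl | hlt
    · exact le_rfl
    · have := f_mono_aux hf ht (a := x) (d := y - x) hx.1 (by linarith) (by linarith [hy.2])
      simpa using this
  intro x hx y hy hxy
  have hpi := Real.pi_pos
  have hl : ∀ z : ℝ, Tendsto (fun t : ℝ => f ((1-t)*z + t*(π/2))) (nhdsWithin 0 (Ioi 0)) (nhds (f z)) := by
    intro z
    have hc : Continuous (fun t : ℝ => f ((1-t)*z + t*(π/2))) := by fun_prop
    have := hc.tendsto 0
    simp only [sub_zero, one_mul, zero_mul, add_zero] at this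
    exact this.mono_left nhdsWithin_le_nhds
  refine le_of_tendsto_of_tendsto (hl x) (hl y) ?_
  have hin : ∀ z ∈ Icc 0 π, ∀ t ∈ Ioo (0:ℝ) 1, (1-t)*z + t*(π/2) ∈ Ioo 0 π := by
    intro z hz t ht'
    have h1 : 0 < t * (π/2) := mul_pos ht'.1 (by linarith)
    have h2 : 0 ≤ (1-t)*z := mul_nonneg (by linarith [ht'.2]) hz.1
    have h3 : (1-t)*z ≤ (1-t)*π := mul_le_mul_of_nonneg_left hz.2 (by linarith [ht'.2])
    exact ⟨by linarith, by nlinarith⟩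
  filter_upwards [Ioo_mem_nhdsGT (one_pos : (0:ℝ) < 1)] with t ht'
  refine h (hin x hx t ht') (hin y hy t ht') ?_
  have := mul_le_mul_of_nonneg_left hxy (by linarith [ht'.2] : 0 ≤ 1 - t)
  linarith

end
end TO

namespace TO

lemma arccos_cos_le_iff {s : ℝ} (hs0 : 0 ≤ s) (hs : s ≤ π) (ψ : ℝ) : arccos (cos ψ) ≤ s ↔ ∃ k : ℤ, |ψ - 2*π*k| ≤ s := by
  constructor
  · intro h
    have h1 : cos (arccos (cos ψ)) = cos ψ := Real.cos_arccos (Real.neg_one_le_cos _) (Real.cos_le_one _)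
    obtain ⟨k, hk⟩ := Real.cos_eq_cos_iff.1 h1
    refine ⟨k, ?_⟩
    have h0 := Real.arccos_nonneg (cos ψ)
    rcases hk with hk | hk
    · rw [abs_le]; constructor <;> linarith
    · rw [abs_le]; constructor <;> linarith
  · rintro ⟨k, hk⟩
    have e : cos ψ = cos |ψ - 2*π*k| := by
      rw [Real.cos_abs, show ψ - 2*π*k = ψ - k*(2*π) by ring, Real.cos_sub_int_mul_two_pi]
    rw [e, Real.arccos_cos (abs_nonneg _) (hk.trans hs)]
    exact hk

lemma plane_polar {x : E3} (hx : x 2 = 0) : ∃ θ, x = rho x • ev θ := by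
  obtain ⟨α, hα⟩ := polar x
  refine ⟨α, qq_eq_rho ?_⟩
  rw [hα, sub_self, Real.cos_zero, mul_one]; unfold rho; simp [hx]

theorem main_thm {m : ℕ} (hodd : Odd m) (hpos : 0 < m) :
    ∃ (μ σ : ℝ) (u : (Fin 3 → ℝ) → ℝ),
      (m : ℝ) < μ ∧ μ < m + 1 ∧ 0 < σ ∧ σ < 1 ∧
      IsTOPSol μ u 2 ∧ u ≠ 0 ∧ contactSet u 2 = slitCone m σ := by
  have hpi := Real.pi_pos
  have hm0 : (0:ℝ) < m := by exact_mod_cast hpos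
  obtain ⟨μ, h1, h2, r, B, σ, hr, hb, hrz, hσ, hr0, ht⟩ := limit_thm hodd
  have hμ : 0 < μ := hm0.trans h1
  obtain ⟨K, hK, hF⟩ := fb_fourier hodd h1 h2 hr hb
  have hc := fb_cont hodd h1 h2 hr hb
  have hRm := Rm_meas (m := m) hr
  have hRB := Rm_bd (m := m) hb
  have ht' : ∀ (α : ℕ → ℝ) (n : ℕ) (δ : ℝ), 0 < δ →
      (∀ c ∈ Icc 0 π, σ - δ < c → 0 ≤ ∫ φ in c..π, ∑ j ∈ Finset.range n, α j * cos (j * φ)) →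
      0 ≤ ∑ j ∈ Finset.range n, α j * rh (fb m μ r) j := by
    intro α n δ hδ h
    have := mul_nonneg hK.le (ht α n δ hδ h)
    rw [Finset.mul_sum] at this
    refine this.trans (le_of_eq (Finset.sum_congr rfl fun j _ => ?_))
    rw [hF]; ring
  have hc0 := cc_zero_pos h1 h2 hodd
  have hσ0 : 0 < σ := by
    by_contra hn
    have hz : rh r 0 = 0 := by
      unfold rh
      rw [intervalIntegral.integral_zero_ae, mul_zero]
      refine Eventually.of_forall fun x hx => ?_
      rw [uIoc_of_le hpi.le] at hx
      rw [hrz x (by linarith [hx.1]), zero_mul]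
    linarith
  have hz := f_zero hc ht' hσ hσ0
  have hmono := f_mono hc ht'
  have hfold : ∀ φ, fb m μ r φ = fb m μ r (arccos (cos φ)) := by
    intro φ
    have h1' : cos (arccos (cos φ)) = cos φ := Real.cos_arccos (Real.neg_one_le_cos _) (Real.cos_le_one _)
    obtain ⟨k, hk⟩ := Real.cos_eq_cos_iff.1 h1'
    have hp : ∀ y, fb m μ r (y + k * (2*π)) = fb m μ r y := (fb_per hodd h1 h2).int_mul k
    rcases hk with hk | hk
    · conv_lhs => rw [hk]
      rw [← hp (arccos (cos φ))]; congr 1; ring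
    · conv_lhs => rw [hk]
      rw [← fb_even hodd h1 h2 (arccos (cos φ)), ← hp (-arccos (cos φ))]; congr 1; ring
  have hacc : ∀ φ, arccos (cos φ) ∈ Icc 0 π := fun φ => ⟨Real.arccos_nonneg _, Real.arccos_le_pi _⟩
  have hnn : ∀ φ, 0 ≤ fb m μ r φ := by
    intro φ
    rw [hfold, ← hz 0 ⟨le_rfl, hσ0.le⟩]
    exact hmono ⟨le_rfl, hpi.le⟩ (hacc φ) (hacc φ).1
  have hpos' : 0 < fb m μ r π := by
    by_contra hn
    have hzz : rh (fb m μ r) 0 = 0 := by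
      unfold rh
      rw [intervalIntegral.integral_zero_ae, mul_zero]
      refine Eventually.of_forall fun x hx => ?_
      rw [uIoc_of_le hpi.le] at hx
      have := hmono ⟨hx.1.le, hx.2⟩ ⟨hpi.le, le_rfl⟩ hx.2
      rw [le_antisymm (this.trans (not_lt.1 hn)) (hnn x), zero_mul]
    rw [hF, hr0, zero_mul, div_self hc0.ne'] at hzz
    linarith
  -- the zero set on [0,π]
  obtain ⟨s, hs0, hsπ, hsz⟩ : ∃ s, 0 < s ∧ s < π ∧ ∀ φ ∈ Icc 0 π, fb m μ r φ = 0 ↔ φ ≤ s := by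
    set S : Set ℝ := Icc 0 π ∩ {φ | fb m μ r φ = 0} with hS
    have hcomp : IsCompact S := isCompact_Icc.inter_right (isClosed_eq hc continuous_const)
    have hne : σ ∈ S := ⟨hσ, hz σ ⟨hσ0.le, le_rfl⟩⟩
    have hmem := hcomp.sSup_mem ⟨σ, hne⟩
    refine ⟨sSup S, lt_of_lt_of_le hσ0 (le_csSup hcomp.bddAbove hne), ?_, fun φ hφ => ⟨fun h => le_csSup hcomp.bddAbove ⟨hφ, h⟩, fun h => ?_⟩⟩
    · refine lt_of_le_of_ne hmem.1.2 fun he => ?_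
      have := hmem.2
      rw [he] at this
      exact hpos'.ne' this
    · have h3 := hmono hφ hmem.1 h
      rw [show fb m μ r (sSup S) = 0 from hmem.2] at h3
      exact le_antisymm h3 (hnn φ)
  have hsz' : ∀ φ, fb m μ r φ = 0 ↔ ∃ k : ℤ, |φ - 2*π*k| ≤ s := by
    intro φ
    rw [hfold, hsz _ (hacc φ), arccos_cos_le_iff hs0.le hsπ.le]
  have hUev : ∀ θ, Uf μ (Rm m r) (ev θ) = fb m μ r (m*θ) := by
    intro θ; unfold fb; rw [mul_div_cancel_left₀ _ hm0.ne']
  have hzR : ∀ θ, Rm m r θ ≠ 0 → Uf μ (Rm m r) (ev θ) = 0 := by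
    intro θ hθ
    rw [hUev, hfold]
    refine hz _ ⟨(hacc _).1, ?_⟩
    by_contra hn
    exact hθ (hrz _ (not_le.1 hn))
  have hU0 : Uf μ (Rm m r) 0 = 0 := by
    have := Uf_homog (μ := μ) (R := Rm m r) (two_pos : (0:ℝ) < 2) 0
    rw [smul_zero] at this
    have h4 : (1:ℝ) < 2 ^ μ := Real.one_lt_rpow (by norm_num) hμ
    have : (2^μ - 1) * Uf μ (Rm m r) 0 = 0 := by linarith
    rcases mul_eq_zero.1 this with h | h
    · linarith
    · exact h
  have hrn : ∀ x : E3, 0 ≤ rho x := fun x => Real.sqrt_nonneg _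
  refine ⟨μ, s/π, Uf μ (Rm m r), h1, h2, by positivity, (div_lt_one hpi).2 hsπ, ?_, ?_, ?_⟩
  · refine ⟨Uf_cont hodd h1 h2 hRm hRB, fun x => Uf_symm x, fun r hr x => Uf_homog hr x, Uf_smooth hodd h1 h2 hRm hRB hzR, fun x hx => Uf_harm hodd h1 h2 hRm hRB hzR hx, ?_, ?_⟩
    · intro x hx
      rcases (hrn x).eq_or_lt with h | h
      · rw [rho_zero h.symm, hU0]
      · obtain ⟨θ, hθ⟩ := plane_polar hx
        rw [hθ, Uf_homog h, hUev]
        exact mul_nonneg (Real.rpow_nonneg h.le _) (hnn _)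
    · intro x hx
      rcases (hrn x).eq_or_lt with h | h
      · rw [rho_zero h.symm]
        exact ⟨0, le_rfl, upper_zero hodd h1 h2 hRm hRB⟩
      · exact upper_pos hodd h1 h2 hRm hRB (fun θ => (hb _).1) Rm_per (Rm_lim hpos hr) hx h
  · intro he
    have := congrFun he (ev (π/m))
    exact hpos'.ne' this
  · have hslit : ∀ θ : ℝ, (∃ k : ℤ, |θ - 2 * π * k / m| ≤ s/π * π / m) ↔ Uf μ (Rm m r) (ev θ) = 0 := by
      intro θ
      rw [hUev, hsz']
      refine exists_congr fun k => ?_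
      rw [div_mul_cancel₀ _ hpi.ne', le_div_iff₀ hm0, ← abs_of_pos hm0, ← abs_mul, abs_of_pos hm0]
      rw [show (θ - 2*π*k/m)*m = m*θ - 2*π*k by field_simp]
    have hevs : ∀ t θ : ℝ, t • ev θ = ![t * cos θ, t * sin θ, 0] := by
      intro t θ; unfold ev; simp
    ext x
    constructor
    · rintro ⟨hx, hu⟩
      rcases (hrn x).eq_or_lt with h | h
      · refine ⟨0, le_rfl, 0, ⟨0, ?_⟩, ?_⟩
        · simp only [Int.cast_zero, mul_zero, zero_div, sub_zero, abs_zero]; positivity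
        · rw [rho_zero h.symm]; funext i; fin_cases i <;> simp
      · obtain ⟨θ, hθ⟩ := plane_polar hx
        refine ⟨rho x, h.le, θ, (hslit θ).2 ?_, by rw [← hevs]; exact hθ⟩
        rw [hθ, Uf_homog h] at hu
        exact (mul_eq_zero.1 hu).resolve_left (Real.rpow_pos_of_pos h _).ne'
    · rintro ⟨t, h0, θ, hk, rfl⟩
      refine ⟨by simp, ?_⟩
      rw [← hevs]
      rcases h0.eq_or_lt with h | h
      · rw [← h, zero_smul, hU0]
      · rw [Uf_homog h, (hslit θ).1 hk, mul_zero]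

end TO

/-- **Theorem 1.1.** For each odd positive integer `m` there are `μ ∈ (m, m+1)`,
`σ ∈ (0,1)` and a nontrivial `μ`-homogeneous solution of the thin obstacle problem
in `ℝ³` whose contact set is the slit cone `slitCone m σ`. -/
theorem thin_obstacle_odd_homogeneous_solutions (m : ℕ) (hodd : Odd m) (hpos : 0 < m) :
    ∃ (μ σ : ℝ) (u : (Fin 3 → ℝ) → ℝ),
      (m : ℝ) < μ ∧ μ < m + 1 ∧ 0 < σ ∧ σ < 1 ∧
      IsTOPSol μ u 2 ∧ u ≠ 0 ∧ contactSet u 2 = slitCone m σ := by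
  exact TO.main_thm hodd hpos
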